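/- Let ε > 0 and let X ⊂ ℙ⁴ be a del Pezzo surface of degree 4 over the number field k (i.e. a non-singular complete intersection of two quadrics in ℙ⁴, anticanonically embedded), and suppose X contains a non-singular conic defined over k. Let U ⊂ X be the complement of the 16 exceptional curves (lines) on X, and let N(U,k,B) = #{x ∈ U(k) : H_k(x) ≤ B}, where H_k is the height on ℙ⁴(k). Then there exists a constant C = C(ε, X, k) such that N(U,k,B) ≤ C·B^{1+ε} for all B ≥ 1. -/

import Mathlib

open NumberField

/-- The normalized absolute value `∥x∥_w = |x|_w^{d_w}` at an infinite place `w`. -/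
noncomputable def plNorm {k : Type*} [Field k] [NumberField k]
    (w : InfinitePlace k) (x : k) : ℝ := w x ^ w.mult

/-- The height `H_k` of the projective point with integral homogeneous coordinates `y`:
`H_k = N(⟨y_0, …, y_n⟩)⁻¹ · ∏_{w | ∞} max_i ∥y_i∥_w`; this is independent of the choice
of integral representative. -/
noncomputable def heightFn {k : Type*} [Field k] [NumberField k] {m : ℕ}
    (y : Fin m → 𝓞 k) : ℝ :=
  (Ideal.absNorm (Ideal.span (Set.range y)) : ℝ)⁻¹ *
    ∏ w : InfinitePlace k, ⨆ i, plNorm w (y i)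

/-- The point with homogeneous coordinates `ξ ≠ 0` (over a field `K`) lies on a
projective line contained in the common zero locus of the polynomials `P a`. -/
def liesOnLineIn {K : Type*} [Field K] {m N : ℕ}
    (P : Fin N → MvPolynomial (Fin m) K) (ξ : Fin m → K) : Prop :=
  ∃ w : Fin m → K, (∀ c : K, w ≠ c • ξ) ∧
    ∀ s t : K, ∀ a, MvPolynomial.eval (s • ξ + t • w) (P a) = 0

universe u

section IdealDivisors

open UniqueFactorizationMonoid

theorem card_primes_absNorm_lt_le {K : Type u} [Field K] [NumberField K] {D : ℕ}
    (hD : Module.finrank ℚ K ≤ D) (Y : ℕ) (S : Finset (Ideal (𝓞 K)))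
    (hS : ∀ p ∈ S, Prime p ∧ Ideal.absNorm p ≤ Y) : S.card ≤ Y.factorial ^ D := by
  have hne : ∀ p ∈ S, 2 ≤ Ideal.absNorm p := by
    intro p hp
    have h0 : Ideal.absNorm p ≠ 0 := by
      rw [Ne, Ideal.absNorm_eq_zero_iff]; exact (hS p hp).1.ne_zero
    have h1 : Ideal.absNorm p ≠ 1 := by
      rw [Ne, Ideal.absNorm_eq_one_iff]
      intro h
      exact (hS p hp).1.not_isUnit (Ideal.isUnit_iff.mpr h)
    omega
  have hdvd : ∏ p ∈ S, p ∣ Ideal.span {((Y.factorial : ℕ) : 𝓞 K)} := by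
    refine Finset.prod_primes_dvd _ (fun p hp => (hS p hp).1) (fun p hp => ?_)
    rw [Ideal.dvd_span_singleton]
    have h1 : ((Ideal.absNorm p : ℕ) : 𝓞 K) ∈ p := Ideal.absNorm_mem p
    have h2 : Ideal.absNorm p ∣ Y.factorial :=
      Nat.dvd_factorial (by have := hne p hp; omega) (hS p hp).2
    obtain ⟨c, hc⟩ := h2
    rw [hc, Nat.cast_mul]
    exact Ideal.mul_mem_right _ _ h1
  have h1 : Ideal.absNorm (∏ p ∈ S, p) ∣ Ideal.absNorm (Ideal.span {((Y.factorial : ℕ) : 𝓞 K)}) :=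
    Ideal.absNorm_dvd_absNorm_of_le (Ideal.le_of_dvd hdvd)
  have h2 : Ideal.absNorm (Ideal.span {((Y.factorial : ℕ) : 𝓞 K)}) =
      Y.factorial ^ Module.finrank ℚ K := by
    rw [Ideal.absNorm_span_singleton, ← RingOfIntegers.rank K]
    simp [Algebra.norm_natCast]
  rw [h2, map_prod] at h1
  have h3 := Nat.le_of_dvd (by positivity) h1
  have h4 : 2 ^ S.card ≤ ∏ p ∈ S, Ideal.absNorm p := by
    rw [← Finset.prod_const]
    exact Finset.prod_le_prod (fun _ _ => by norm_num) hne
  calc S.card ≤ 2 ^ S.card := Nat.lt_two_pow_self.le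
    _ ≤ _ := h4.trans h3
    _ ≤ _ := Nat.pow_le_pow_right (Nat.factorial_pos _) hD

theorem exists_card_ideal_dvd_le {ε : ℝ} (hε : 0 < ε) (D : ℕ) :
    ∃ C : ℝ, 0 < C ∧ ∀ (K : Type u) [Field K] [NumberField K], Module.finrank ℚ K ≤ D →
      ∀ I : Ideal (𝓞 K), I ≠ 0 → ∃ s : Finset (Ideal (𝓞 K)), (∀ J, J ∣ I → J ∈ s) ∧
        (s.card : ℝ) ≤ C * (Ideal.absNorm I : ℝ) ^ ε := by
  classical
  set Y : ℕ := ⌈(2 : ℝ) ^ (1 / ε)⌉₊ with hY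
  have hl2 : 0 < Real.log 2 := Real.log_pos (by norm_num)
  set c₀ : ℝ := 1 + 1 / (ε * Real.log 2) with hc₀
  have hc₀1 : 1 ≤ c₀ := by rw [hc₀]; have : 0 < 1 / (ε * Real.log 2) := by positivity
                           linarith
  refine ⟨c₀ ^ (Y.factorial ^ D), by positivity, fun K _ _ hD I hI => ?_⟩
  refine ⟨(Finset.Iic (normalizedFactors I)).image Multiset.prod, fun J hJ => ?_, ?_⟩
  · have hJ0 : J ≠ 0 := fun h => hI (by rw [h] at hJ; exact zero_dvd_iff.mp hJ)
    rw [Finset.mem_image]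
    exact ⟨normalizedFactors J, Finset.mem_Iic.mpr
      ((dvd_iff_normalizedFactors_le_normalizedFactors hJ0 hI).mp hJ),
      Ideal.prod_normalizedFactors_eq_self hJ0⟩
  set M := normalizedFactors I with hM
  have hp : ∀ p ∈ M.toFinset, Prime p := fun p hp =>
    prime_of_normalized_factor p (Multiset.mem_toFinset.mp hp)
  have hN2 : ∀ p ∈ M.toFinset, 2 ≤ Ideal.absNorm p := by
    intro p hpM
    have h0 : Ideal.absNorm p ≠ 0 := by
      rw [Ne, Ideal.absNorm_eq_zero_iff]; exact (hp p hpM).ne_zero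
    have h1 : Ideal.absNorm p ≠ 1 := by
      rw [Ne, Ideal.absNorm_eq_one_iff]
      intro h
      exact (hp p hpM).not_isUnit (Ideal.isUnit_iff.mpr h)
    omega
  have hnorm : (Ideal.absNorm I : ℝ) ^ ε =
      ∏ p ∈ M.toFinset, ((Ideal.absNorm p : ℝ) ^ ε) ^ (M.count p) := by
    have : Ideal.absNorm I = ∏ p ∈ M.toFinset, Ideal.absNorm p ^ M.count p := by
      conv_lhs => rw [← Ideal.prod_normalizedFactors_eq_self hI, ← hM, map_multiset_prod,
        Finset.prod_multiset_map_count]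
    rw [this]
    push_cast
    rw [← Real.finsetProd_rpow _ _ (fun i _ => by positivity)]
    refine Finset.prod_congr rfl fun p _ => ?_
    rw [← Real.rpow_natCast, ← Real.rpow_natCast, ← Real.rpow_mul (by positivity),
      ← Real.rpow_mul (by positivity), mul_comm]
  have hterm : ∀ p ∈ M.toFinset, ((M.count p + 1 : ℕ) : ℝ) ≤
      (if Ideal.absNorm p ≤ Y then c₀ else 1) * ((Ideal.absNorm p : ℝ) ^ ε) ^ (M.count p) := by
    intro p hpM
    have h2 : (2 : ℝ) ≤ Ideal.absNorm p := by exact_mod_cast hN2 p hpM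
    split_ifs with h
    · have h3 : (2 : ℝ) ^ ε ≤ (Ideal.absNorm p : ℝ) ^ ε :=
        Real.rpow_le_rpow (by norm_num) h2 hε.le
      have h4 : 1 + (M.count p : ℝ) * (ε * Real.log 2) ≤ ((2 : ℝ) ^ ε) ^ (M.count p) := by
        have := Real.add_one_le_exp ((M.count p : ℝ) * (ε * Real.log 2))
        rw [Real.rpow_def_of_pos (by norm_num), ← Real.exp_nat_mul]
        rw [mul_comm ε] at this ⊢
        linarith
      calc ((M.count p + 1 : ℕ) : ℝ) ≤ c₀ * (1 + (M.count p : ℝ) * (ε * Real.log 2)) := by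
            have h5 : c₀ * (1 + (M.count p : ℝ) * (ε * Real.log 2)) =
              1 + M.count p + 1 / (ε * Real.log 2) + M.count p * (ε * Real.log 2) := by
              rw [hc₀]; field_simp; ring
            rw [h5]; push_cast
            have : 0 ≤ 1 / (ε * Real.log 2) + M.count p * (ε * Real.log 2) := by positivity
            linarith
        _ ≤ c₀ * ((Ideal.absNorm p : ℝ) ^ ε) ^ (M.count p) := by
            gcongr
            exact h4.trans (pow_le_pow_left₀ (by positivity) h3 _)
    · push Not at h
      have h3 : (2 : ℝ) ^ (1 / ε) ≤ Ideal.absNorm p :=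
        (Nat.le_ceil _).trans (by exact_mod_cast h.le)
      have h4 : (2 : ℝ) ≤ (Ideal.absNorm p : ℝ) ^ ε := by
        have := Real.rpow_le_rpow (by positivity) h3 hε.le
        rwa [← Real.rpow_mul (by norm_num), one_div, inv_mul_cancel₀ hε.ne', Real.rpow_one] at this
      rw [one_mul]
      calc ((M.count p + 1 : ℕ) : ℝ) ≤ (2 : ℝ) ^ (M.count p) := by
            exact_mod_cast Nat.lt_two_pow_self
        _ ≤ _ := pow_le_pow_left₀ (by norm_num) h4 _
  calc (((Finset.Iic M).image Multiset.prod).card : ℝ) ≤ ((Finset.Iic M).card : ℝ) := by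
        exact_mod_cast Finset.card_image_le
    _ = ∏ p ∈ M.toFinset, ((M.count p + 1 : ℕ) : ℝ) := by
        rw [Multiset.card_Iic]; push_cast; rfl
    _ ≤ ∏ p ∈ M.toFinset, ((if Ideal.absNorm p ≤ Y then c₀ else 1) *
          ((Ideal.absNorm p : ℝ) ^ ε) ^ (M.count p)) :=
        Finset.prod_le_prod (fun _ _ => by positivity) hterm
    _ = c₀ ^ (M.toFinset.filter (fun p => Ideal.absNorm p ≤ Y)).card *
          (Ideal.absNorm I : ℝ) ^ ε := by
        rw [Finset.prod_mul_distrib, hnorm, Finset.prod_ite]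
        simp
    _ ≤ _ := by
        gcongr
        refine card_primes_absNorm_lt_le hD Y _ fun p hpS => ?_
        rw [Finset.mem_filter] at hpS
        exact ⟨hp p hpS.1, hpS.2⟩

end IdealDivisors

section ConicClasses

/-- The polar form of the ternary quadratic form `α u² + β u v + γ v² - w²`. -/
def conicPolar {R : Type*} [CommRing R] (α β γ : R) (P P' : R × R × R) : R :=
  2 * α * P.1 * P'.1 + β * (P.1 * P'.2.1 + P'.1 * P.2.1) + 2 * γ * P.2.1 * P'.2.1 -
    2 * P.2.2 * P'.2.2

/-- The point `(u, v, w)` satisfies `w² = α u² + β u v + γ v²`. -/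
def OnConic {R : Type*} [CommRing R] (α β γ : R) (P : R × R × R) : Prop :=
  P.2.2 ^ 2 = α * P.1 ^ 2 + β * P.1 * P.2.1 + γ * P.2.1 ^ 2

/-- The discriminant of the binary quadratic form with coefficients `α, β, γ`. -/
def qdisc {R : Type*} [CommRing R] (α β γ : R) : R := β ^ 2 - 4 * α * γ

theorem map_qdisc {R S : Type*} [CommRing R] [CommRing S] (φ : R →+* S) (α β γ : R) :
    φ (qdisc α β γ) = qdisc (φ α) (φ β) (φ γ) := by
  simp [qdisc, map_ofNat]

theorem map_conicPolar {R S : Type*} [CommRing R] [CommRing S] (φ : R →+* S) (α β γ : R)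
    (P P' : R × R × R) : φ (conicPolar α β γ P P') =
      conicPolar (φ α) (φ β) (φ γ) (φ P.1, φ P.2.1, φ P.2.2) (φ P'.1, φ P'.2.1, φ P'.2.2) := by
  simp [conicPolar, map_ofNat]

theorem OnConic.map {R S : Type*} [CommRing R] [CommRing S] (φ : R →+* S) {α β γ : R}
    {P : R × R × R} (h : OnConic α β γ P) :
    OnConic (φ α) (φ β) (φ γ) (φ P.1, φ P.2.1, φ P.2.2) := by
  simpa [OnConic] using congrArg φ h

theorem qdisc_dvd_of_mem_span {R : Type*} [CommRing R] {α β γ ρ : R} (hρ : ρ ^ 2 = α)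
    {P P' : R × R × R} (hP : OnConic α β γ P) (hP' : OnConic α β γ P')
    (hx : 2 * α * P'.1 + β * P'.2.1 - 2 * ρ * P'.2.2 ∈
      Ideal.span {2 * α * P.1 + β * P.2.1 - 2 * ρ * P.2.2, qdisc α β γ})
    (hy : 2 * α * P'.1 + β * P'.2.1 + 2 * ρ * P'.2.2 ∈
      Ideal.span {2 * α * P.1 + β * P.2.1 + 2 * ρ * P.2.2, qdisc α β γ}) :
    qdisc α β γ ∣ 4 * α * conicPolar α β γ P P' := by
  obtain ⟨u, v, w⟩ := P
  obtain ⟨u', v', w'⟩ := P'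
  rw [Ideal.mem_span_pair] at hx hy
  obtain ⟨s, t, hs⟩ := hx
  obtain ⟨s', t', hs'⟩ := hy
  simp only [OnConic, conicPolar, qdisc] at *
  subst hρ
  refine ⟨s' * v ^ 2 + t' * (2 * ρ ^ 2 * u + β * v - 2 * ρ * w) + s * v ^ 2 +
    t * (2 * ρ ^ 2 * u + β * v + 2 * ρ * w) - 2 * v * v', ?_⟩
  linear_combination (-(2 * ρ ^ 2 * u + β * v - 2 * ρ * w)) * hs' -
    (2 * ρ ^ 2 * u + β * v + 2 * ρ * w) * hs - (4 * ρ ^ 2 * s + 4 * ρ ^ 2 * s') * hP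

theorem norm_algebraMap_ringOfIntegers {k K : Type*} [Field k] [NumberField k] [Field K]
    [NumberField K] [Algebra k K] (x : 𝓞 k) :
    Algebra.norm ℤ (algebraMap (𝓞 k) (𝓞 K) x) = Algebra.norm ℤ x ^ Module.finrank k K := by
  have : FiniteDimensional k K := Module.Finite.of_restrictScalars_finite ℚ k K
  apply Int.cast_injective (α := ℚ)
  rw [Int.cast_pow, Algebra.coe_norm_int, Algebra.coe_norm_int, ← map_pow,
    ← Algebra.norm_norm (S := k)]
  congr 1
  exact Algebra.norm_algebraMap (S := K) (x : k)

theorem exists_sqrt_extension {k : Type u} [Field k] [NumberField k] (α : 𝓞 k) :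
    ∃ (K : Type u) (_ : Field K) (_ : NumberField K) (_ : Algebra k K),
      Module.finrank k K ≤ 2 ∧ ∃ ρ : 𝓞 K, ρ ^ 2 = algebraMap (𝓞 k) (𝓞 K) α := by
  obtain ⟨r, hr⟩ := IsAlgClosed.exists_pow_nat_eq
    (algebraMap k (AlgebraicClosure k) (α : k)) (n := 2) (by norm_num)
  have hmonic : (Polynomial.X ^ 2 - Polynomial.C (α : k)).Monic :=
    Polynomial.monic_X_pow_sub_C _ (by norm_num)
  have hroot : Polynomial.aeval r (Polynomial.X ^ 2 - Polynomial.C (α : k)) = 0 := by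
    simp [hr]
  have hr_int : IsIntegral k r := ⟨_, hmonic, by simpa [Polynomial.aeval_def] using hroot⟩
  have hfd : FiniteDimensional k (IntermediateField.adjoin k {r}) :=
    IntermediateField.adjoin.finiteDimensional hr_int
  have hfdQ : FiniteDimensional ℚ (IntermediateField.adjoin k {r}) :=
    Module.Finite.trans k _
  have hcz : CharZero (IntermediateField.adjoin k {r}) := charZero_of_injective_algebraMap
    (algebraMap k (IntermediateField.adjoin k {r})).injective
  refine ⟨IntermediateField.adjoin k {r}, inferInstance, { }, inferInstance, ?_, ?_⟩
  · rw [IntermediateField.adjoin.finrank hr_int]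
    calc (minpoly k r).natDegree ≤ (Polynomial.X ^ 2 - Polynomial.C (α : k)).natDegree :=
          Polynomial.natDegree_le_of_dvd (minpoly.dvd k r hroot) hmonic.ne_zero
      _ ≤ 2 := by rw [Polynomial.natDegree_X_pow_sub_C]
  · have hsq : (IntermediateField.AdjoinSimple.gen k r) ^ 2 =
        algebraMap k (IntermediateField.adjoin k {r}) (α : k) := by
      apply (algebraMap (IntermediateField.adjoin k {r}) (AlgebraicClosure k)).injective
      rw [map_pow, IntermediateField.AdjoinSimple.algebraMap_gen, hr]
      exact IsScalarTower.algebraMap_apply k (IntermediateField.adjoin k {r}) _ _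
    have hI : IsIntegral ℤ (IntermediateField.AdjoinSimple.gen k r) := by
      apply IsIntegral.of_pow (n := 2) (by norm_num)
      rw [hsq]
      exact α.isIntegral_coe.map ((algebraMap k _).toIntAlgHom)
    refine ⟨⟨_, hI⟩, ?_⟩
    apply RingOfIntegers.ext
    exact hsq

theorem dvd_of_algebraMap_dvd {k K : Type*} [Field k] [NumberField k] [Field K]
    [NumberField K] [Algebra k K] {x y : 𝓞 k} (hx : x ≠ 0)
    (h : algebraMap (𝓞 k) (𝓞 K) x ∣ algebraMap (𝓞 k) (𝓞 K) y) : x ∣ y := by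
  obtain ⟨c, hc⟩ := h
  have hxk : (x : k) ≠ 0 := by simpa using hx
  have hc' : algebraMap k K (y : k) = algebraMap k K (x : k) * (c : K) := by
    have := congrArg (algebraMap (𝓞 K) K) hc
    rw [map_mul, ← IsScalarTower.algebraMap_apply, ← IsScalarTower.algebraMap_apply,
      IsScalarTower.algebraMap_apply (𝓞 k) k K, IsScalarTower.algebraMap_apply (𝓞 k) k K] at this
    exact this
  have hq : IsIntegral ℤ ((y : k) / x) := by
    have : algebraMap k K ((y : k) / x) = c := by
      rw [map_div₀, hc']
      field_simp [(map_ne_zero (algebraMap k K)).mpr hxk]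
    have hi := c.isIntegral_coe
    rw [← show _ = (algebraMap (𝓞 K) K) c from this] at hi
    exact (isIntegral_algebraMap_iff (algebraMap k K).injective).mp hi
  refine ⟨⟨_, hq⟩, ?_⟩
  apply RingOfIntegers.ext
  change (y : k) = x * (y / x)
  field_simp

theorem exists_conic_class_fst {k : Type u} [Field k] [NumberField k] {ε : ℝ} (hε : 0 < ε) :
    ∃ C : ℝ, 0 < C ∧ ∀ α β γ : 𝓞 k, qdisc α β γ ≠ 0 →
      ∃ (ι : Type) (_ : Fintype ι) (f : 𝓞 k × 𝓞 k × 𝓞 k → ι),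
        (Fintype.card ι : ℝ) ≤ C * (Ideal.absNorm (Ideal.span {qdisc α β γ}) : ℝ) ^ ε ∧
        ∀ P P', OnConic α β γ P → OnConic α β γ P' → f P = f P' →
          qdisc α β γ ∣ 4 * α * conicPolar α β γ P P' := by
  classical
  obtain ⟨C, hC, H⟩ := exists_card_ideal_dvd_le.{u} (ε := ε / 4) (by positivity)
    (2 * Module.finrank ℚ k)
  refine ⟨C ^ 2, by positivity, fun α β γ hΔ => ?_⟩
  obtain ⟨K, _, _, _, hK, ρ, hρ⟩ := exists_sqrt_extension α
  have : FiniteDimensional k K := Module.Finite.of_restrictScalars_finite ℚ k K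
  have hdeg : Module.finrank ℚ K ≤ 2 * Module.finrank ℚ k := by
    rw [← Module.finrank_mul_finrank ℚ k K, mul_comm]
    gcongr
  set φ := algebraMap (𝓞 k) (𝓞 K) with hφ
  have hinj : Function.Injective φ := FaithfulSMul.algebraMap_injective (𝓞 k) (𝓞 K)
  have hΔ' : φ (qdisc α β γ) ≠ 0 := by rwa [Ne, map_eq_zero_iff _ hinj]
  obtain ⟨s, hs, hcard⟩ := H K hdeg (Ideal.span {φ (qdisc α β γ)})
    (by rwa [Ne, Ideal.zero_eq_bot, Ideal.span_singleton_eq_bot])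
  have hmem : ∀ x : 𝓞 K, Ideal.span {x, φ (qdisc α β γ)} ∈ s := fun x => hs _ (by
    rw [Ideal.dvd_span_singleton]; exact Ideal.subset_span (by simp))
  let g : 𝓞 k × 𝓞 k × 𝓞 k → s × s := fun P =>
    (⟨_, hmem (φ (2 * α * P.1 + β * P.2.1) - 2 * ρ * φ P.2.2)⟩,
      ⟨_, hmem (φ (2 * α * P.1 + β * P.2.1) + 2 * ρ * φ P.2.2)⟩)
  refine ⟨Fin (Fintype.card (s × s)), inferInstance, fun P => Fintype.equivFin _ (g P), ?_, ?_⟩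
  · rw [Fintype.card_fin, Fintype.card_prod, Fintype.card_coe]
    have hN : (Ideal.absNorm (Ideal.span {φ (qdisc α β γ)}) : ℝ) ≤
        (Ideal.absNorm (Ideal.span {qdisc α β γ}) : ℝ) ^ 2 := by
      rw [Ideal.absNorm_span_singleton, Ideal.absNorm_span_singleton,
        norm_algebraMap_ringOfIntegers, Int.natAbs_pow]
      norm_cast
      refine Nat.pow_le_pow_right ?_ hK
      exact Int.natAbs_pos.mpr (Algebra.norm_ne_zero_iff.mpr hΔ)
    push_cast
    calc (s.card : ℝ) * s.card ≤ (C * (Ideal.absNorm (Ideal.span {φ (qdisc α β γ)}) : ℝ) ^ (ε / 4)) *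
          (C * (Ideal.absNorm (Ideal.span {φ (qdisc α β γ)}) : ℝ) ^ (ε / 4)) := by gcongr
      _ = C ^ 2 * (Ideal.absNorm (Ideal.span {φ (qdisc α β γ)}) : ℝ) ^ (ε / 2) := by
          rw [show ε / 2 = ε / 4 + ε / 4 by ring, Real.rpow_add_of_nonneg (by positivity)
            (by positivity) (by positivity)]
          ring
      _ ≤ C ^ 2 * ((Ideal.absNorm (Ideal.span {qdisc α β γ}) : ℝ) ^ 2) ^ (ε / 2) := by gcongr
      _ = _ := by
          rw [← Real.rpow_natCast_mul (by positivity)]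
          congr 2
          push_cast
          ring
  · intro P P' hP hP' h
    have h1 := (Fintype.equivFin (s × s)).injective h
    rw [Prod.ext_iff] at h1
    have h2 : Ideal.span _ = Ideal.span _ := congrArg Subtype.val h1.1
    have h3 : Ideal.span _ = Ideal.span _ := congrArg Subtype.val h1.2
    apply dvd_of_algebraMap_dvd (K := K) hΔ
    have key := qdisc_dvd_of_mem_span (R := 𝓞 K) (α := φ α) (β := φ β) (γ := φ γ) (ρ := ρ) hρ
      (P := (φ P.1, φ P.2.1, φ P.2.2)) (P' := (φ P'.1, φ P'.2.1, φ P'.2.2))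
      (hP.map φ) (hP'.map φ) ?_ ?_
    · rw [← map_qdisc, ← map_conicPolar] at key
      rw [map_mul, map_mul, map_ofNat]
      exact key
    · rw [← map_qdisc]
      simp only [map_add, map_mul, map_ofNat] at h2 ⊢
      rw [h2]
      exact Ideal.subset_span (by simp)
    · rw [← map_qdisc]
      simp only [map_add, map_mul, map_ofNat] at h3 ⊢
      rw [h3]
      exact Ideal.subset_span (by simp)

theorem exists_conic_class {k : Type u} [Field k] [NumberField k] {ε : ℝ} (hε : 0 < ε) :
    ∃ C : ℝ, 0 < C ∧ ∀ α β γ : 𝓞 k, qdisc α β γ ≠ 0 →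
      ∃ (ι : Type) (_ : Fintype ι) (f : 𝓞 k × 𝓞 k × 𝓞 k → ι),
        (Fintype.card ι : ℝ) ≤ C * (Ideal.absNorm (Ideal.span {qdisc α β γ}) : ℝ) ^ ε ∧
        ∀ P P', OnConic α β γ P → OnConic α β γ P' → f P = f P' →
          qdisc α β γ ∣ 4 * α * conicPolar α β γ P P' ∧
          qdisc α β γ ∣ 4 * β * conicPolar α β γ P P' ∧
          qdisc α β γ ∣ 4 * γ * conicPolar α β γ P P' := by
  obtain ⟨C, hC, H⟩ := exists_conic_class_fst (k := k) (ε := ε / 3) (by positivity)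
  refine ⟨C ^ 3, by positivity, fun α β γ hΔ => ?_⟩
  have e2 : qdisc γ β α = qdisc α β γ := by simp only [qdisc]; ring
  have e3 : qdisc (α + β + γ) (β + 2 * γ) γ = qdisc α β γ := by simp only [qdisc]; ring
  obtain ⟨ι₁, _, f₁, hc₁, h₁⟩ := H α β γ hΔ
  obtain ⟨ι₂, _, f₂, hc₂, h₂⟩ := H γ β α (by rwa [e2])
  obtain ⟨ι₃, _, f₃, hc₃, h₃⟩ := H (α + β + γ) (β + 2 * γ) γ (by rwa [e3])
  rw [e2] at hc₂
  rw [e3] at hc₃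
  refine ⟨ι₁ × ι₂ × ι₃, inferInstance, fun P => (f₁ P, f₂ (P.2.1, P.1, P.2.2),
    f₃ (P.1, P.2.1 - P.1, P.2.2)), ?_, ?_⟩
  · simp only [Fintype.card_prod]
    push_cast
    set N : ℝ := (Ideal.absNorm (Ideal.span {qdisc α β γ}) : ℝ)
    calc (Fintype.card ι₁ : ℝ) * (Fintype.card ι₂ * Fintype.card ι₃) ≤
        (C * N ^ (ε / 3)) * ((C * N ^ (ε / 3)) * (C * N ^ (ε / 3))) := by gcongr
      _ = C ^ 3 * (N ^ (ε / 3)) ^ 3 := by ring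
      _ = C ^ 3 * N ^ ε := by
        rw [← Real.rpow_mul_natCast (by positivity)]
        congr 2
        push_cast
        ring
  · rintro ⟨u, v, w⟩ ⟨u', v', w'⟩ hP hP' h
    simp only [Prod.mk.injEq] at h
    have d1 := h₁ _ _ hP hP' h.1
    have d2 := h₂ _ _ (by simp only [OnConic] at hP ⊢; rw [hP]; ring)
      (by simp only [OnConic] at hP' ⊢; rw [hP']; ring) h.2.1
    have d3 := h₃ _ _ (by simp only [OnConic] at hP ⊢; rw [hP]; ring)
      (by simp only [OnConic] at hP' ⊢; rw [hP']; ring) h.2.2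
    rw [e2] at d2
    rw [e3] at d3
    have d2' : qdisc α β γ ∣ 4 * γ * conicPolar α β γ (u, v, w) (u', v', w') := by
      convert d2 using 2; simp only [conicPolar]; ring
    have d3' : qdisc α β γ ∣ 4 * (α + β + γ) * conicPolar α β γ (u, v, w) (u', v', w') := by
      convert d3 using 2; simp only [conicPolar]; ring
    refine ⟨d1, ?_, d2'⟩
    convert (d3'.sub d1).sub d2' using 1
    ring

end ConicClasses

section Cells

theorem exists_interval_cells {M θ : ℝ} (hM : 1 ≤ M) (hθ : 0 < θ) (hθ1 : θ ≤ 1) :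
    ∃ (ι : Type) (_ : Fintype ι) (f : ℝ → ι), (Fintype.card ι : ℝ) ≤ (2 * M + 2) / θ ∧
      ∀ x y, |x| ≤ M → |y| ≤ M → f x = f y → |x - y| ≤ θ := by
  set n := ⌈2 * M / θ⌉₊ with hn
  refine ⟨Fin (n + 1), inferInstance,
    fun x => ⟨min ⌊(x + M) / θ⌋₊ n, by omega⟩, ?_, ?_⟩
  · rw [Fintype.card_fin]
    push_cast
    have h1 := (Nat.ceil_lt_add_one (show 0 ≤ 2 * M / θ by positivity)).le
    rw [← hn] at h1
    have h2 : 1 ≤ 1 / θ := by rw [le_div_iff₀ hθ]; linarith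
    calc (n : ℝ) + 1 ≤ 2 * M / θ + (1 / θ + 1 / θ) := by linarith
      _ = _ := by ring
  · intro x y hx hy h
    have key : ∀ z, |z| ≤ M → min ⌊(z + M) / θ⌋₊ n = ⌊(z + M) / θ⌋₊ := by
      intro z hz
      apply min_eq_left
      apply (Nat.floor_le_floor (?_ : _ ≤ 2 * M / θ)).trans (Nat.floor_le_ceil _)
      gcongr
      linarith [le_abs_self z]
    simp only [Fin.mk.injEq] at h
    rw [key x hx, key y hy] at h
    have hx0 : 0 ≤ (x + M) / θ := div_nonneg (by linarith [neg_abs_le x]) hθ.le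
    have hy0 : 0 ≤ (y + M) / θ := div_nonneg (by linarith [neg_abs_le y]) hθ.le
    have a1 := Nat.floor_le hx0
    have a2 := Nat.lt_floor_add_one ((x + M) / θ)
    have b1 := Nat.floor_le hy0
    have b2 := Nat.lt_floor_add_one ((y + M) / θ)
    rw [h] at a1 a2
    rw [abs_le]
    rw [le_div_iff₀ hθ] at a1 b1
    rw [div_lt_iff₀ hθ] at a2 b2
    constructor <;> linarith

theorem exists_complex_cells {M θ : ℝ} (hM : 1 ≤ M) (hθ : 0 < θ) (hθ1 : θ ≤ 1) :
    ∃ (ι : Type) (_ : Fintype ι) (f : ℂ → ι), (Fintype.card ι : ℝ) ≤ ((2 * M + 2) / θ) ^ 2 ∧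
      ∀ x y, ‖x‖ ≤ M → ‖y‖ ≤ M → f x = f y → ‖x - y‖ ≤ 2 * θ := by
  obtain ⟨ι, _, f, hc, hf⟩ := exists_interval_cells hM hθ hθ1
  refine ⟨ι × ι, inferInstance, fun z => (f z.re, f z.im), ?_, ?_⟩
  · rw [Fintype.card_prod, sq]
    push_cast
    gcongr
  · intro x y hx hy h
    rw [Prod.mk.injEq] at h
    have h1 := hf _ _ ((Complex.abs_re_le_norm x).trans hx) ((Complex.abs_re_le_norm y).trans hy) h.1
    have h2 := hf _ _ ((Complex.abs_im_le_norm x).trans hx) ((Complex.abs_im_le_norm y).trans hy) h.2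
    have := Complex.norm_le_abs_re_add_abs_im (x - y)
    rw [Complex.sub_re, Complex.sub_im] at this
    linarith

/-- A parameter of norm at most `1` on the complex conic `w² = α u² + β u v + γ v²`, where `ρ` is
a square root of the discriminant. -/
noncomputable def conicSlope (α β ρ : ℂ) (P : ℂ × ℂ × ℂ) : ℂ :=
  2 * (√‖α‖ : ℝ) * P.2.2 / (2 * α * P.1 + β * P.2.1 - ρ * P.2.1)

theorem OnConic.factor {α β γ ρ : ℂ} (hρ : ρ ^ 2 = qdisc α β γ) {P : ℂ × ℂ × ℂ}
    (hP : OnConic α β γ P) :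
    (2 * α * P.1 + β * P.2.1 - ρ * P.2.1) * (2 * α * P.1 + β * P.2.1 + ρ * P.2.1) =
      4 * α * P.2.2 ^ 2 := by
  simp only [OnConic, qdisc] at *
  rw [hP]
  linear_combination (-P.2.1 ^ 2) * hρ

theorem norm_conicSlope_sq_mul {α β γ ρ : ℂ} (hρ : ρ ^ 2 = qdisc α β γ) {P : ℂ × ℂ × ℂ}
    (hP : OnConic α β γ P) :
    ‖conicSlope α β ρ P‖ ^ 2 * ‖2 * α * P.1 + β * P.2.1 - ρ * P.2.1‖ ^ 2 =
      if 2 * α * P.1 + β * P.2.1 - ρ * P.2.1 = 0 then 0 else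
      ‖2 * α * P.1 + β * P.2.1 - ρ * P.2.1‖ * ‖2 * α * P.1 + β * P.2.1 + ρ * P.2.1‖ := by
  rw [conicSlope, ← norm_mul (2 * α * P.1 + β * P.2.1 - ρ * P.2.1), hP.factor hρ]
  set m := 2 * α * P.1 + β * P.2.1 - ρ * P.2.1
  split_ifs with h
  · simp [h]
  · have : ‖m‖ ≠ 0 := by simpa using h
    simp only [norm_div, norm_mul, norm_pow, Complex.norm_real, Real.norm_eq_abs,
      abs_of_nonneg (Real.sqrt_nonneg _)]
    rw [div_pow, div_mul_cancel₀ _ (by positivity), mul_pow, mul_pow, Real.sq_sqrt (by positivity)]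
    norm_num

theorem norm_conicSlope_le {α β γ ρ : ℂ} (hρ : ρ ^ 2 = qdisc α β γ) {P : ℂ × ℂ × ℂ}
    (hP : OnConic α β γ P)
    (h : ‖2 * α * P.1 + β * P.2.1 + ρ * P.2.1‖ ≤ ‖2 * α * P.1 + β * P.2.1 - ρ * P.2.1‖) :
    ‖conicSlope α β ρ P‖ ≤ 1 := by
  have := norm_conicSlope_sq_mul hρ hP
  split_ifs at this with h0
  · simp [conicSlope, h0]
  · have hm : 0 < ‖2 * α * P.1 + β * P.2.1 - ρ * P.2.1‖ := norm_pos_iff.mpr h0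
    by_contra! hc
    have h1 : 1 < ‖conicSlope α β ρ P‖ ^ 2 := by nlinarith
    nlinarith [sq_nonneg (‖2 * α * P.1 + β * P.2.1 - ρ * P.2.1‖), mul_le_mul_of_nonneg_left h hm.le,
      mul_lt_mul_of_pos_right h1 (pow_pos hm 2)]

theorem norm_conicPolar_le_slope {α β γ ρ : ℂ} (hρ : ρ ^ 2 = qdisc α β γ) {P P' : ℂ × ℂ × ℂ}
    (hP : OnConic α β γ P) (hP' : OnConic α β γ P')
    (h : ‖2 * α * P.1 + β * P.2.1 + ρ * P.2.1‖ ≤ ‖2 * α * P.1 + β * P.2.1 - ρ * P.2.1‖)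
    (h' : ‖2 * α * P'.1 + β * P'.2.1 + ρ * P'.2.1‖ ≤ ‖2 * α * P'.1 + β * P'.2.1 - ρ * P'.2.1‖) :
    ‖4 * α * conicPolar α β γ P P'‖ ≤ ‖2 * α * P.1 + β * P.2.1 - ρ * P.2.1‖ *
      ‖2 * α * P'.1 + β * P'.2.1 - ρ * P'.2.1‖ *
      ‖conicSlope α β ρ P - conicSlope α β ρ P'‖ ^ 2 := by
  have f1 := hP.factor hρ
  have f2 := hP'.factor hρ
  have e : 4 * α * conicPolar α β γ P P' =
      (2 * α * P.1 + β * P.2.1 - ρ * P.2.1) * (2 * α * P'.1 + β * P'.2.1 + ρ * P'.2.1) +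
      (2 * α * P'.1 + β * P'.2.1 - ρ * P'.2.1) * (2 * α * P.1 + β * P.2.1 + ρ * P.2.1) -
      8 * α * P.2.2 * P'.2.2 := by
    simp only [conicPolar, qdisc] at *
    linear_combination (2 * P.2.1 * P'.2.1) * hρ
  rw [e]
  unfold conicSlope
  set m := 2 * α * P.1 + β * P.2.1 - ρ * P.2.1
  set n := 2 * α * P.1 + β * P.2.1 + ρ * P.2.1
  set m' := 2 * α * P'.1 + β * P'.2.1 - ρ * P'.2.1
  set n' := 2 * α * P'.1 + β * P'.2.1 + ρ * P'.2.1
  by_cases hm : m = 0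
  · have hn : n = 0 := by simpa [hm] using h
    have : α * P.2.2 = 0 := by
      rw [hm, hn] at f1
      have : α * P.2.2 ^ 2 = 0 := by linear_combination (-1 / 4 : ℂ) * f1
      simpa using this
    have : m * n' + m' * n - 8 * α * P.2.2 * P'.2.2 = 0 := by
      rw [hm, hn]; linear_combination (-8 * P'.2.2) * this
    rw [this, norm_zero]
    positivity
  by_cases hm' : m' = 0
  · have hn' : n' = 0 := by simpa [hm'] using h'
    have : α * P'.2.2 = 0 := by
      rw [hm', hn'] at f2
      have : α * P'.2.2 ^ 2 = 0 := by linear_combination (-1 / 4 : ℂ) * f2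
      simpa using this
    have : m * n' + m' * n - 8 * α * P.2.2 * P'.2.2 = 0 := by
      rw [hm', hn']; linear_combination (-8 * P.2.2) * this
    rw [this, norm_zero]
    positivity
  have hn : n = 4 * α * P.2.2 ^ 2 / m := by rw [eq_div_iff hm, ← f1]; ring
  have hn' : n' = 4 * α * P'.2.2 ^ 2 / m' := by rw [eq_div_iff hm', ← f2]; ring
  have e2 : m * n' + m' * n - 8 * α * P.2.2 * P'.2.2 =
      m * m' * (4 * α * (P.2.2 / m - P'.2.2 / m') ^ 2) := by
    rw [hn, hn']; field_simp; ring
  have e3 : 2 * ((√‖α‖ : ℝ) : ℂ) * P.2.2 / m - 2 * ((√‖α‖ : ℝ) : ℂ) * P'.2.2 / m' =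
      2 * ((√‖α‖ : ℝ) : ℂ) * (P.2.2 / m - P'.2.2 / m') := by ring
  rw [e2, e3]
  simp only [norm_mul, norm_pow, Complex.norm_real, Real.norm_eq_abs,
      abs_of_nonneg (Real.sqrt_nonneg _), mul_pow]
  rw [Real.sq_sqrt (by positivity)]
  norm_num

end Cells

section DominantCells

theorem norm_sub_le_abs_arg_sub {x y : ℂ} (hx : ‖x‖ = 1) (hy : ‖y‖ = 1) :
    ‖x - y‖ ≤ |x.arg - y.arg| := by
  have h1 := Complex.norm_mul_exp_arg_mul_I x
  have h2 := Complex.norm_mul_exp_arg_mul_I y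
  rw [hx, Complex.ofReal_one, one_mul] at h1
  rw [hy, Complex.ofReal_one, one_mul] at h2
  have e : x - y = y * (Complex.exp (Complex.I * ((x.arg - y.arg : ℝ) : ℂ)) - 1) := by
    nth_rewrite 1 [← h1]
    nth_rewrite 1 [← h2]
    nth_rewrite 2 [← h2]
    rw [mul_sub, mul_one, ← Complex.exp_add]
    congr 2
    push_cast
    ring
  rw [e, norm_mul, hy, one_mul]
  exact Real.norm_exp_I_mul_ofReal_sub_one_le

/-- The parameters `conicSlope` of the points with coordinates in `S` on any conic with coefficients
in `S` can be divided into at most `K` cells of diameter at most `2 * θ`. -/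
def HasSlopeCells (S : Subring ℂ) (K θ : ℝ) : Prop :=
  ∀ α ∈ S, ∀ β ∈ S, ∀ γ ∈ S, ∃ ρ : ℂ, ρ ^ 2 = qdisc α β γ ∧ ∀ ρ' : ℂ, (ρ' = ρ ∨ ρ' = -ρ) →
    ∃ (ι : Type) (_ : Fintype ι) (f : ℂ → ι), (Fintype.card ι : ℝ) ≤ K ∧
    ∀ P P' : ℂ × ℂ × ℂ, OnConic α β γ P → OnConic α β γ P' →
      (P.1 ∈ S ∧ P.2.1 ∈ S ∧ P.2.2 ∈ S) → (P'.1 ∈ S ∧ P'.2.1 ∈ S ∧ P'.2.2 ∈ S) →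
      ‖conicSlope α β ρ' P‖ ≤ 1 → ‖conicSlope α β ρ' P'‖ ≤ 1 →
      f (conicSlope α β ρ' P) = f (conicSlope α β ρ' P') →
      ‖conicSlope α β ρ' P - conicSlope α β ρ' P'‖ ≤ 2 * θ

theorem hasSlopeCells_top {θ : ℝ} (hθ : 0 < θ) (hθ1 : θ ≤ 1) :
    HasSlopeCells ⊤ ((20 / θ) ^ 2) θ := by
  intro α _ β _ γ _
  obtain ⟨ρ, hρ⟩ := IsAlgClosed.exists_pow_nat_eq (qdisc α β γ) (n := 2) (by norm_num)
  refine ⟨ρ, hρ, fun ρ' _ => ?_⟩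
  obtain ⟨ι, h, f, hc, hf⟩ := exists_complex_cells le_rfl hθ hθ1
  refine ⟨ι, h, f, hc.trans ?_, fun P P' _ _ _ _ h1 h2 h3 => hf _ _ h1 h2 h3⟩
  gcongr
  norm_num

theorem hasSlopeCells_real {θ : ℝ} (hθ : 0 < θ) (hθ1 : θ ≤ 1) :
    HasSlopeCells Complex.ofRealHom.range (20 / θ) θ := by
  rintro _ ⟨α, rfl⟩ _ ⟨β, rfl⟩ _ ⟨γ, rfl⟩
  simp only [Complex.ofRealHom_eq_coe]
  have hd : qdisc (α : ℂ) β γ = ((qdisc α β γ : ℝ) : ℂ) := by simp [qdisc]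
  rcases le_or_gt 0 (qdisc α β γ) with hΔ | hΔ
  · refine ⟨(√(qdisc α β γ) : ℝ), ?_, fun ρ' hρ' => ?_⟩
    · rw [hd, ← Complex.ofReal_pow, Real.sq_sqrt hΔ]
    have : ∃ r : ℝ, ρ' = r := by
      rcases hρ' with rfl | rfl
      · exact ⟨_, rfl⟩
      · exact ⟨-√(qdisc α β γ), by push_cast; rfl⟩
    obtain ⟨r, rfl⟩ := this
    obtain ⟨ι, h, f, hc, hf⟩ := exists_interval_cells le_rfl hθ hθ1
    refine ⟨ι, h, fun z => f z.re, hc.trans ?_, ?_⟩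
    · gcongr
      norm_num
    · rintro ⟨u, v, w⟩ ⟨u', v', w'⟩ - - ⟨⟨u, rfl⟩, ⟨v, rfl⟩, ⟨w, rfl⟩⟩
        ⟨⟨u', rfl⟩, ⟨v', rfl⟩, ⟨w', rfl⟩⟩ h1 h2 h3
      have key : ∀ u v w : ℝ, conicSlope α β r (u, v, w) =
          ((2 * √‖(α : ℂ)‖ * w / (2 * α * u + β * v - r * v) : ℝ) : ℂ) := by
        intro u v w; simp [conicSlope]
      simp only [Complex.ofRealHom_eq_coe] at *
      rw [key] at h1 h2 h3
      rw [key] at h3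
      rw [key, key]
      rw [Complex.ofReal_re, Complex.ofReal_re] at h3
      rw [Complex.norm_real, Real.norm_eq_abs] at h1 h2
      rw [← Complex.ofReal_sub, Complex.norm_real, Real.norm_eq_abs]
      linarith [hf _ _ h1 h2 h3]
  · refine ⟨(√(-qdisc α β γ) : ℝ) * Complex.I, ?_, fun ρ' hρ' => ?_⟩
    · rw [hd, mul_pow, ← Complex.ofReal_pow, Real.sq_sqrt (by linarith), Complex.I_sq]
      push_cast; ring
    have hsq : ρ' ^ 2 = qdisc (α : ℂ) β γ := by
      have : ρ' ^ 2 = ((√(-qdisc α β γ) : ℝ) * Complex.I) ^ 2 := by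
        rcases hρ' with rfl | rfl <;> ring
      rw [this, hd, mul_pow, ← Complex.ofReal_pow, Real.sq_sqrt (by linarith), Complex.I_sq]
      push_cast; ring
    have : ∃ r : ℝ, ρ' = r * Complex.I := by
      rcases hρ' with rfl | rfl
      · exact ⟨_, rfl⟩
      · exact ⟨-√(-qdisc α β γ), by push_cast; ring⟩
    obtain ⟨r, rfl⟩ := this
    obtain ⟨ι, h, f, hc, hf⟩ := exists_interval_cells (M := 4) (by norm_num) hθ hθ1
    classical
    refine ⟨Bool × ι, inferInstance, fun z => (decide (z = 0), f z.arg), ?_, ?_⟩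
    · rw [Fintype.card_prod, Fintype.card_bool]
      push_cast
      calc (2 : ℝ) * Fintype.card ι ≤ 2 * ((2 * 4 + 2) / θ) := by gcongr
        _ = _ := by ring
    · have key : ∀ P : ℂ × ℂ × ℂ, OnConic (α : ℂ) β γ P →
          (P.1 ∈ Complex.ofRealHom.range ∧ P.2.1 ∈ Complex.ofRealHom.range ∧
            P.2.2 ∈ Complex.ofRealHom.range) →
          conicSlope α β (r * Complex.I) P = 0 ∨ ‖conicSlope α β (r * Complex.I) P‖ = 1 := by
        rintro ⟨u, v, w⟩ hP ⟨⟨u, rfl⟩, ⟨v, rfl⟩, ⟨w, rfl⟩⟩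
        have h1 := norm_conicSlope_sq_mul hsq hP
        simp only [Complex.ofRealHom_eq_coe] at *
        split_ifs at h1 with h0
        · left
          simp [conicSlope, h0]
        · right
          have hm : 0 < ‖2 * (α : ℂ) * u + β * v - r * Complex.I * v‖ := norm_pos_iff.mpr h0
          have e : ‖2 * (α : ℂ) * u + β * v + r * Complex.I * v‖ =
              ‖2 * (α : ℂ) * u + β * v - r * Complex.I * v‖ := by
            rw [← Complex.norm_conj]
            simp [sub_eq_add_neg, map_ofNat]
          rw [e, ← sq] at h1
          have h2 := mul_right_cancel₀ (b := ‖2 * (α : ℂ) * u + β * v - r * Complex.I * v‖ ^ 2)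
            (by positivity) (h1.trans (one_mul _).symm)
          exact (pow_eq_one_iff_of_nonneg (norm_nonneg _) two_ne_zero).mp h2
      intro P P' hP hP' hS hS' _ _ h3
      simp only [Prod.mk.injEq, decide_eq_decide] at h3
      rcases key P hP hS with h0 | h0
      · rw [h0, h3.1.mp h0]
        simpa using hθ.le
      rcases key P' hP' hS' with h0' | h0'
      · rw [h0', h3.1.mpr h0']
        simpa using hθ.le
      have b : ∀ z : ℂ, |z.arg| ≤ 4 := fun z => by
        linarith [Complex.abs_arg_le_pi z, Real.pi_le_four]
      linarith [norm_sub_le_abs_arg_sub h0 h0', hf _ _ (b _) (b _) h3.2]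

end DominantCells

section PlaceCells

theorem exists_conic_cells_dominant {S : Subring ℂ} {K θ R : ℝ} (hS : HasSlopeCells S K θ)
    {α β γ : ℂ} (hα : α ∈ S) (hβ : β ∈ S) (hγ : γ ∈ S)
    (hβα : ‖β‖ ≤ 9 * ‖α‖) (hγα : ‖γ‖ ≤ 9 * ‖α‖) :
    ∃ (ι : Type) (_ : Fintype ι) (f : ℂ × ℂ × ℂ → ι), (Fintype.card ι : ℝ) ≤ 2 * K ∧
      ∀ P P' : ℂ × ℂ × ℂ, OnConic α β γ P → OnConic α β γ P' →
        (P.1 ∈ S ∧ P.2.1 ∈ S ∧ P.2.2 ∈ S) → (P'.1 ∈ S ∧ P'.2.1 ∈ S ∧ P'.2.2 ∈ S) →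
        ‖P.1‖ ≤ R → ‖P.2.1‖ ≤ R → ‖P'.1‖ ≤ R → ‖P'.2.1‖ ≤ R → f P = f P' →
        ‖conicPolar α β γ P P'‖ ≤ 484 * ‖α‖ * R ^ 2 * θ ^ 2 := by
  obtain ⟨ρ, hρ, H⟩ := hS α hα β hβ γ hγ
  obtain ⟨ι₁, _, f₁, hc₁, hf₁⟩ := H ρ (Or.inl rfl)
  obtain ⟨ι₂, _, f₂, hc₂, hf₂⟩ := H (-ρ) (Or.inr rfl)
  have hρ' : (-ρ) ^ 2 = qdisc α β γ := by rw [neg_sq, hρ]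
  classical
  have hρn : ‖ρ‖ ≤ 11 * ‖α‖ := by
    have : ‖ρ‖ ^ 2 ≤ (11 * ‖α‖) ^ 2 := by
      rw [← norm_pow, hρ, qdisc]
      calc ‖β ^ 2 - 4 * α * γ‖ ≤ ‖β ^ 2‖ + ‖4 * α * γ‖ := norm_sub_le _ _
        _ = ‖β‖ ^ 2 + 4 * ‖α‖ * ‖γ‖ := by simp
        _ ≤ (9 * ‖α‖) ^ 2 + 4 * ‖α‖ * (9 * ‖α‖) := by gcongr
        _ ≤ _ := by nlinarith [sq_nonneg ‖α‖]
    exact le_of_sq_le_sq this (by positivity)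
  have bd : ∀ ρ' : ℂ, ‖ρ'‖ = ‖ρ‖ → ρ' ^ 2 = qdisc α β γ → ∀ P P' : ℂ × ℂ × ℂ,
      OnConic α β γ P → OnConic α β γ P' → ‖P.1‖ ≤ R → ‖P.2.1‖ ≤ R → ‖P'.1‖ ≤ R → ‖P'.2.1‖ ≤ R →
      ‖2 * α * P.1 + β * P.2.1 + ρ' * P.2.1‖ ≤ ‖2 * α * P.1 + β * P.2.1 - ρ' * P.2.1‖ →
      ‖2 * α * P'.1 + β * P'.2.1 + ρ' * P'.2.1‖ ≤ ‖2 * α * P'.1 + β * P'.2.1 - ρ' * P'.2.1‖ →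
      ‖conicSlope α β ρ' P - conicSlope α β ρ' P'‖ ≤ 2 * θ →
      ‖conicPolar α β γ P P'‖ ≤ 484 * ‖α‖ * R ^ 2 * θ ^ 2 := by
    intro ρ' hn hsq P P' hP hP' h1 h2 h3 h4 h5 h6 h7
    have hR : 0 ≤ R := (norm_nonneg _).trans h1
    by_cases h0 : α = 0
    · subst h0
      have hβ0 : β = 0 := by simpa using hβα
      have hγ0 : γ = 0 := by simpa using hγα
      subst hβ0 hγ0
      have : P.2.2 = 0 := by simpa [OnConic] using hP
      simp [conicPolar, this]
    have hα0 : 0 < ‖α‖ := norm_pos_iff.mpr h0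
    have m : ∀ u v : ℂ, ‖u‖ ≤ R → ‖v‖ ≤ R → ‖2 * α * u + β * v - ρ' * v‖ ≤ 22 * ‖α‖ * R := by
      intro u v hu hv
      calc ‖2 * α * u + β * v - ρ' * v‖ ≤ ‖2 * α * u‖ + ‖β * v‖ + ‖ρ' * v‖ :=
            (norm_sub_le _ _).trans (by gcongr; exact norm_add_le _ _)
        _ = 2 * ‖α‖ * ‖u‖ + ‖β‖ * ‖v‖ + ‖ρ‖ * ‖v‖ := by simp [hn]
        _ ≤ 2 * ‖α‖ * R + 9 * ‖α‖ * R + 11 * ‖α‖ * R := by gcongr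
        _ = _ := by ring
    have key := norm_conicPolar_le_slope hsq hP hP' h5 h6
    have : 4 * ‖α‖ * ‖conicPolar α β γ P P'‖ ≤
        (22 * ‖α‖ * R) * (22 * ‖α‖ * R) * (2 * θ) ^ 2 := by
      calc 4 * ‖α‖ * ‖conicPolar α β γ P P'‖ = ‖4 * α * conicPolar α β γ P P'‖ := by simp
        _ ≤ _ := key
        _ ≤ _ := by
          gcongr
          · exact m _ _ h1 h2
          · exact m _ _ h3 h4
    have h4α : 0 < 4 * ‖α‖ := by positivity
    refine le_of_mul_le_mul_left (this.trans (le_of_eq ?_)) h4α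
    ring
  refine ⟨ι₁ ⊕ ι₂, inferInstance, fun P =>
    if ‖2 * α * P.1 + β * P.2.1 + ρ * P.2.1‖ ≤ ‖2 * α * P.1 + β * P.2.1 - ρ * P.2.1‖
    then Sum.inl (f₁ (conicSlope α β ρ P)) else Sum.inr (f₂ (conicSlope α β (-ρ) P)), ?_, ?_⟩
  · rw [Fintype.card_sum]
    push_cast
    linarith
  · intro P P' hP hP' hPS hPS' h1 h2 h3 h4 h
    beta_reduce at h
    split_ifs at h with c1 c2 c2
    · rw [Sum.inl.injEq] at h
      exact bd ρ rfl hρ P P' hP hP' h1 h2 h3 h4 c1 c2 (hf₁ P P' hP hP' hPS hPS'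
        (norm_conicSlope_le hρ hP c1) (norm_conicSlope_le hρ hP' c2) h)
    · rw [Sum.inr.injEq] at h
      have d1 : ‖2 * α * P.1 + β * P.2.1 + -ρ * P.2.1‖ ≤ ‖2 * α * P.1 + β * P.2.1 - -ρ * P.2.1‖ := by
        rw [neg_mul, sub_neg_eq_add, ← sub_eq_add_neg]; exact (not_le.mp c1).le
      have d2 : ‖2 * α * P'.1 + β * P'.2.1 + -ρ * P'.2.1‖ ≤
          ‖2 * α * P'.1 + β * P'.2.1 - -ρ * P'.2.1‖ := by
        rw [neg_mul, sub_neg_eq_add, ← sub_eq_add_neg]; exact (not_le.mp c2).le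
      exact bd (-ρ) (norm_neg _) hρ' P P' hP hP' h1 h2 h3 h4 d1 d2 (hf₂ P P' hP hP' hPS hPS'
        (norm_conicSlope_le hρ' hP d1) (norm_conicSlope_le hρ' hP' d2) h)

theorem exists_conic_cells_subring {S : Subring ℂ} {K θ R A : ℝ} (hS : HasSlopeCells S K θ)
    (hA : 0 ≤ A)
    {α β γ : ℂ} (hα : α ∈ S) (hβ : β ∈ S) (hγ : γ ∈ S)
    (hαA : ‖α‖ ≤ A) (hβA : ‖β‖ ≤ A) (hγA : ‖γ‖ ≤ A) :
    ∃ (ι : Type) (_ : Fintype ι) (f : ℂ × ℂ × ℂ → ι), (Fintype.card ι : ℝ) ≤ 2 * K ∧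
      ∀ P P' : ℂ × ℂ × ℂ, OnConic α β γ P → OnConic α β γ P' →
        (P.1 ∈ S ∧ P.2.1 ∈ S ∧ P.2.2 ∈ S) → (P'.1 ∈ S ∧ P'.2.1 ∈ S ∧ P'.2.2 ∈ S) →
        ‖P.1‖ ≤ R → ‖P.2.1‖ ≤ R → ‖P'.1‖ ≤ R → ‖P'.2.1‖ ≤ R → f P = f P' →
        ‖conicPolar α β γ P P'‖ ≤ 6000 * A * R ^ 2 * θ ^ 2 := by
  have fin : ∀ {x c : ℝ}, x ≤ 484 * c * R ^ 2 * θ ^ 2 → c ≤ A →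
      x ≤ 6000 * A * R ^ 2 * θ ^ 2 := by
    intro x c hx hc
    calc x ≤ 484 * c * R ^ 2 * θ ^ 2 := hx
      _ ≤ 484 * A * R ^ 2 * θ ^ 2 := by gcongr
      _ ≤ _ := by gcongr; norm_num
  by_cases hd : ‖β‖ ≤ 9 * ‖α‖ ∧ ‖γ‖ ≤ 9 * ‖α‖
  · obtain ⟨ι, i, f, hc, hf⟩ := exists_conic_cells_dominant (R := R) hS hα hβ hγ hd.1 hd.2
    exact ⟨ι, i, f, hc, fun P P' a1 a2 a3 a4 a5 a6 a7 a8 a9 =>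
      fin (hf P P' a1 a2 a3 a4 a5 a6 a7 a8 a9) hαA⟩
  by_cases hd' : ‖β‖ ≤ 9 * ‖γ‖ ∧ ‖α‖ ≤ 9 * ‖γ‖
  · obtain ⟨ι, i, f, hc, hf⟩ := exists_conic_cells_dominant (R := R) hS hγ hβ hα hd'.1 hd'.2
    refine ⟨ι, i, fun P => f (P.2.1, P.1, P.2.2), hc, fun P P' a1 a2 a3 a4 a5 a6 a7 a8 a9 => ?_⟩
    have e : conicPolar α β γ P P' =
        conicPolar γ β α (P.2.1, P.1, P.2.2) (P'.2.1, P'.1, P'.2.2) := by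
      simp only [conicPolar]; ring
    rw [e]
    refine fin (hf (P.2.1, P.1, P.2.2) (P'.2.1, P'.1, P'.2.2) ?_ ?_ ⟨a3.2.1, a3.1, a3.2.2⟩
      ⟨a4.2.1, a4.1, a4.2.2⟩ a6 a5 a8 a7 a9) hγA
    · simp only [OnConic] at *; rw [a1]; ring
    · simp only [OnConic] at *; rw [a2]; ring
  have hβα : 9 * ‖α‖ ≤ ‖β‖ := by
    by_contra! h
    have h1 : 9 * ‖α‖ < ‖γ‖ := by
      by_contra! h'; exact hd ⟨h.le, h'⟩
    have h2 : 9 * ‖γ‖ < ‖β‖ := by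
      by_contra! h'; exact hd' ⟨h', by linarith [norm_nonneg α, norm_nonneg γ]⟩
    linarith [norm_nonneg α, norm_nonneg γ]
  have hβγ : 9 * ‖γ‖ ≤ ‖β‖ := by
    by_contra! h
    have h1 : 9 * ‖γ‖ < ‖α‖ := by
      by_contra! h'; exact hd' ⟨h.le, h'⟩
    linarith [norm_nonneg α, norm_nonneg γ]
  have n1 : ‖β‖ ≤ ‖α + β + γ‖ + ‖α‖ + ‖γ‖ := by
    calc ‖β‖ = ‖(α + β + γ) - α - γ‖ := by congr 1; ring
      _ ≤ _ := (norm_sub_le _ _).trans (by gcongr; exact norm_sub_le _ _)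
  have n2 : ‖β + 2 * γ‖ ≤ ‖β‖ + 2 * ‖γ‖ := (norm_add_le _ _).trans (by simp)
  have n3 : ‖α + β + γ‖ ≤ 3 * A := by linarith [norm_add_le (α + β) γ, norm_add_le α β]
  obtain ⟨ι, i, f, hc, hf⟩ := exists_conic_cells_dominant (R := 2 * R) hS
    (α := α + β + γ) (β := β + 2 * γ) (γ := γ) (add_mem (add_mem hα hβ) hγ)
    (add_mem hβ (by rw [two_mul]; exact add_mem hγ hγ)) hγ (by linarith [norm_nonneg α, norm_nonneg γ])
    (by linarith [norm_nonneg α, norm_nonneg γ])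
  refine ⟨ι, i, fun P => f (P.1, P.2.1 - P.1, P.2.2), hc, fun P P' a1 a2 a3 a4 a5 a6 a7 a8 a9 => ?_⟩
  have e : conicPolar α β γ P P' = conicPolar (α + β + γ) (β + 2 * γ) γ
      (P.1, P.2.1 - P.1, P.2.2) (P'.1, P'.2.1 - P'.1, P'.2.2) := by
    simp only [conicPolar]; ring
  have hR : 0 ≤ R := (norm_nonneg _).trans a5
  rw [e]
  have := hf (P.1, P.2.1 - P.1, P.2.2) (P'.1, P'.2.1 - P'.1, P'.2.2)
    (by simp only [OnConic] at *; rw [a1]; ring) (by simp only [OnConic] at *; rw [a2]; ring)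
    ⟨a3.1, sub_mem a3.2.1 a3.1, a3.2.2⟩ ⟨a4.1, sub_mem a4.2.1 a4.1, a4.2.2⟩
    (by simp only; linarith) (by simp only; linarith [norm_sub_le P.2.1 P.1])
    (by simp only; linarith) (by simp only; linarith [norm_sub_le P'.2.1 P'.1]) a9
  calc _ ≤ _ := this
    _ ≤ 484 * (3 * A) * (2 * R) ^ 2 * θ ^ 2 := by gcongr
    _ ≤ 6000 * A * R ^ 2 * θ ^ 2 := by
      have : 0 ≤ A * R ^ 2 * θ ^ 2 := by positivity
      linarith

theorem exists_subring_hasSlopeCells {k : Type*} [Field k] (w : InfinitePlace k) {θ : ℝ}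
    (hθ : 0 < θ) (hθ1 : θ ≤ 1) : ∃ S : Subring ℂ, (∀ x : k, w.embedding x ∈ S) ∧
      HasSlopeCells S ((20 / θ) ^ w.mult) θ := by
  by_cases hw : w.IsReal
  · refine ⟨Complex.ofRealHom.range, fun x => ?_, ?_⟩
    · have h := InfinitePlace.isReal_iff.mp hw
      exact ⟨h.embedding x, by simp⟩
    · rw [InfinitePlace.mult, if_pos hw, pow_one]
      exact hasSlopeCells_real hθ hθ1
  · refine ⟨⊤, fun x => trivial, ?_⟩
    rw [InfinitePlace.mult, if_neg hw]
    exact hasSlopeCells_top hθ hθ1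

theorem exists_conic_cells {k : Type*} [Field k] (w : InfinitePlace k) {θ A R : ℝ}
    (hθ : 0 < θ) (hθ1 : θ ≤ 1) (hA : 0 ≤ A) {α β γ : k} (hαA : w α ≤ A) (hβA : w β ≤ A)
    (hγA : w γ ≤ A) :
    ∃ (ι : Type) (_ : Fintype ι) (f : k × k × k → ι),
      (Fintype.card ι : ℝ) ≤ 2 * (20 / θ) ^ w.mult ∧
      ∀ P P' : k × k × k, OnConic α β γ P → OnConic α β γ P' →
        w P.1 ≤ R → w P.2.1 ≤ R → w P'.1 ≤ R → w P'.2.1 ≤ R → f P = f P' →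
        w (conicPolar α β γ P P') ≤ 6000 * A * R ^ 2 * θ ^ 2 := by
  obtain ⟨S, hmem, hS⟩ := exists_subring_hasSlopeCells w hθ hθ1
  simp only [← InfinitePlace.norm_embedding_eq] at *
  obtain ⟨ι, i, f, hc, hf⟩ := exists_conic_cells_subring (R := R) hS hA (hmem α) (hmem β) (hmem γ)
    hαA hβA hγA
  refine ⟨ι, i, fun P => f (w.embedding P.1, w.embedding P.2.1, w.embedding P.2.2), hc,
    fun P P' h1 h2 h3 h4 h5 h6 h7 => ?_⟩
  rw [map_conicPolar]
  exact hf _ _ (h1.map _) (h2.map _) ⟨hmem _, hmem _, hmem _⟩ ⟨hmem _, hmem _, hmem _⟩ h3 h4 h5 h6 h7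

end PlaceCells

section FixedConic

theorem exists_cell_size {Y : ℝ} (hY : 0 < Y) {d : ℕ} (hd : d ≠ 0) :
    ∃ θ : ℝ, 0 < θ ∧ θ ≤ 1 ∧ θ ^ d < Y ∧ (1 / θ) ^ d ≤ 1 + 2 / Y := by
  have hm : 0 < min 1 (Y / 2) := lt_min one_pos (by positivity)
  have hp : (min 1 (Y / 2) ^ (1 / d : ℝ)) ^ d = min 1 (Y / 2) := by
    rw [one_div, Real.rpow_inv_natCast_pow hm.le hd]
  refine ⟨min 1 (Y / 2) ^ (1 / d : ℝ), Real.rpow_pos_of_pos hm _,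
    Real.rpow_le_one hm.le (min_le_left _ _) (by positivity), ?_, ?_⟩
  · rw [hp]
    exact (min_le_right _ _).trans_lt (by linarith)
  · rw [one_div, inv_pow, hp]
    have : 0 < 2 / Y := by positivity
    rcases min_cases 1 (Y / 2) with ⟨h, _⟩ | ⟨h, _⟩
    · rw [h, inv_one]; linarith
    · rw [h, inv_div]; linarith

variable {k : Type*} [Field k] [NumberField k]

theorem absNorm_span_singleton_eq_prod (x : 𝓞 k) :
    (Ideal.absNorm (Ideal.span {x}) : ℝ) = ∏ w : InfinitePlace k, w (x : k) ^ w.mult := by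
  rw [InfinitePlace.prod_eq_abs_norm, Ideal.absNorm_span_singleton, ← Algebra.coe_norm_int]
  push_cast
  rw [Nat.cast_natAbs]
  push_cast
  rfl

theorem one_le_absNorm_span_singleton {x : 𝓞 k} (hx : x ≠ 0) :
    (1 : ℝ) ≤ Ideal.absNorm (Ideal.span {x}) := by
  rw [Nat.one_le_cast, Nat.one_le_iff_ne_zero, Ne, Ideal.absNorm_eq_zero_iff,
    Ideal.span_singleton_eq_bot]
  exact hx

theorem absNorm_span_singleton_le {x : 𝓞 k} {c : InfinitePlace k → ℝ}
    (h : ∀ w : InfinitePlace k, w (x : k) ≤ c w) :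
    (Ideal.absNorm (Ideal.span {x}) : ℝ) ≤ ∏ w : InfinitePlace k, c w ^ w.mult := by
  rw [absNorm_span_singleton_eq_prod]
  gcongr with w
  exact h w

theorem absNorm_span_singleton_le_pow {x : 𝓞 k} {c : ℝ}
    (h : ∀ w : InfinitePlace k, w (x : k) ≤ c) :
    (Ideal.absNorm (Ideal.span {x}) : ℝ) ≤ c ^ Module.finrank ℚ k := by
  refine (absNorm_span_singleton_le h).trans (le_of_eq ?_)
  rw [Finset.prod_pow_eq_pow_sum, InfinitePlace.sum_mult_eq]

theorem mul_eq_mul_of_conicPolar_eq_zero {R : Type*} [CommRing R] [IsDomain R] {α β γ : R}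
    (hΔ : qdisc α β γ ≠ 0) {P P' : R × R × R} (hP : OnConic α β γ P) (hP' : OnConic α β γ P')
    (h : conicPolar α β γ P P' = 0) : P.1 * P'.2.1 = P'.1 * P.2.1 := by
  have : qdisc α β γ * (P.1 * P'.2.1 - P'.1 * P.2.1) ^ 2 = 0 := by
    simp only [conicPolar, qdisc, OnConic] at *
    linear_combination (2 * α * P.1 * P'.1 + β * (P.1 * P'.2.1 + P'.1 * P.2.1) +
      2 * γ * P.2.1 * P'.2.1 + 2 * P.2.2 * P'.2.2) * h + 4 * P'.2.2 ^ 2 * hP +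
      4 * (α * P.1 ^ 2 + β * P.1 * P.2.1 + γ * P.2.1 ^ 2) * hP'
  have := (mul_eq_zero.mp this).resolve_left hΔ
  exact sub_eq_zero.mp (pow_eq_zero_iff two_ne_zero |>.mp this)

theorem absNorm_le_of_dvd {Δ m F : 𝓞 k} {α β γ : 𝓞 k} {a : Fin 2 → 𝓞 k} (ha : a ≠ 0) {N : ℕ}
    {C₀ : ℝ} (hC₀ : (Ideal.absNorm (Ideal.span (Set.range a)) : ℝ) ≤ C₀) (hm : m ≠ 0) (hF : F ≠ 0)
    (hmem : ∀ i, m * a i ^ N ∈ Ideal.span {α, β, γ})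
    (h1 : Δ ∣ 4 * α * F) (h2 : Δ ∣ 4 * β * F) (h3 : Δ ∣ 4 * γ * F) :
    (Ideal.absNorm (Ideal.span {Δ}) : ℝ) ≤ Ideal.absNorm (Ideal.span {4 * m}) *
      Ideal.absNorm (Ideal.span {F}) * C₀ ^ (N + N) := by
  have hdiv : ∀ x ∈ Ideal.span {α, β, γ}, Δ ∣ 4 * x * F := by
    intro x hx
    rw [Ideal.mem_span_insert] at hx
    obtain ⟨r, y, hy, rfl⟩ := hx
    rw [Ideal.mem_span_pair] at hy
    obtain ⟨s, t, rfl⟩ := hy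
    have : 4 * (r * α + (s * β + t * γ)) * F =
      r * (4 * α * F) + (s * (4 * β * F) + t * (4 * γ * F)) := by ring
    rw [this]
    exact dvd_add (h1.mul_left _) (dvd_add (h2.mul_left _) (h3.mul_left _))
  have hle : Ideal.span {4 * m} * Ideal.span {F} * Ideal.span (Set.range a) ^ (N + N) ≤
      Ideal.span {Δ} := by
    have hr : Ideal.span (Set.range a) = Ideal.span {a 0} ⊔ Ideal.span {a 1} := by
      rw [← Ideal.span_insert]; congr 1; ext; simp [eq_comm]
    rw [hr]
    refine (Ideal.mul_mono_right Ideal.sup_pow_add_le_pow_sup_pow).trans ?_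
    rw [Ideal.span_singleton_pow, Ideal.span_singleton_pow, Ideal.mul_sup,
      Ideal.span_singleton_mul_span_singleton, Ideal.span_singleton_mul_span_singleton,
      Ideal.span_singleton_mul_span_singleton, sup_le_iff, Ideal.span_singleton_le_span_singleton,
      Ideal.span_singleton_le_span_singleton]
    constructor
    · have := hdiv _ (hmem 0)
      rwa [show 4 * m * F * a 0 ^ N = 4 * (m * a 0 ^ N) * F by ring]
    · have := hdiv _ (hmem 1)
      rwa [show 4 * m * F * a 1 ^ N = 4 * (m * a 1 ^ N) * F by ring]
  have hspan : Ideal.span (Set.range a) ≠ ⊥ := by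
    rw [Ne, Ideal.span_eq_bot]
    intro h
    exact ha (funext fun i => h _ ⟨i, rfl⟩)
  have hn := Ideal.absNorm_dvd_absNorm_of_le hle
  rw [map_mul, map_mul, map_pow] at hn
  have h4m : (4 * m : 𝓞 k) ≠ 0 := mul_ne_zero (by norm_num) hm
  have hpos : 0 < Ideal.absNorm (Ideal.span {4 * m}) * Ideal.absNorm (Ideal.span {F}) *
      Ideal.absNorm (Ideal.span (Set.range a)) ^ (N + N) := by
    have := Ideal.absNorm_eq_zero_iff (I := Ideal.span (Set.range a))
    have h' : 0 < Ideal.absNorm (Ideal.span (Set.range a)) := by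
      rw [Nat.pos_iff_ne_zero, Ne, this]; exact hspan
    have h1 := one_le_absNorm_span_singleton h4m
    have h2 := one_le_absNorm_span_singleton hF
    rw [Nat.one_le_cast] at h1 h2
    positivity
  calc (Ideal.absNorm (Ideal.span {Δ}) : ℝ) ≤ ((Ideal.absNorm (Ideal.span {4 * m}) *
        Ideal.absNorm (Ideal.span {F}) *
        Ideal.absNorm (Ideal.span (Set.range a)) ^ (N + N) : ℕ) : ℝ) := by
        exact_mod_cast Nat.le_of_dvd hpos hn
    _ ≤ _ := by push_cast; gcongr

end FixedConic

theorem exists_card_conic_le {k : Type*} [Field k] [NumberField k] {ε : ℝ} (hε : 0 < ε)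
    {m : 𝓞 k} (hm : m ≠ 0) (N : ℕ) {K C₀ : ℝ} (hK : 0 < K) (hC₀ : 1 ≤ C₀) :
    ∃ C > 0, ∀ α β γ : 𝓞 k, qdisc α β γ ≠ 0 → ∀ a : Fin 2 → 𝓞 k, a ≠ 0 →
      (Ideal.absNorm (Ideal.span (Set.range a)) : ℝ) ≤ C₀ →
      (∀ i, m * a i ^ N ∈ Ideal.span {α, β, γ}) → ∀ T > 0,
      (∀ w : InfinitePlace k, w (α : k) ≤ K * T ^ 2 ∧ w (β : k) ≤ K * T ^ 2 ∧
        w (γ : k) ≤ K * T ^ 2) →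
      ∀ R > 0, ∀ s : Finset (𝓞 k × 𝓞 k × 𝓞 k),
      (∀ P ∈ s, OnConic α β γ P ∧ ∀ w : InfinitePlace k, w (P.1 : k) ≤ R ∧ w (P.2.1 : k) ≤ R) →
      (∀ P ∈ s, ∀ P' ∈ s, P.1 * P'.2.1 = P'.1 * P.2.1 → P.1 = P'.1 ∧ P.2.1 = P'.2.1) →
      (s.card : ℝ) ≤ C * (Ideal.absNorm (Ideal.span {qdisc α β γ}) : ℝ) ^ ε *
        (1 + (T * R) ^ Module.finrank ℚ k /
          √(Ideal.absNorm (Ideal.span {qdisc α β γ}) : ℝ)) := by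
  obtain ⟨C₁, hC₁, H⟩ := exists_conic_class (k := k) hε
  set d := Module.finrank ℚ k with hd
  have hd0 : d ≠ 0 := Module.finrank_pos.ne'
  have h4m : (4 * m : 𝓞 k) ≠ 0 := mul_ne_zero (by norm_num) hm
  set E : ℝ := Ideal.absNorm (Ideal.span {4 * m}) * (6000 * K) ^ d * C₀ ^ (N + N) with hE
  have hE0 : 0 < E := by
    have := one_le_absNorm_span_singleton h4m
    positivity
  refine ⟨2 * C₁ * (2 ^ Fintype.card (InfinitePlace k) * 20 ^ d) * (1 + 2 * √E), by positivity, ?_⟩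
  intro α β γ hΔ a ha haC hmem T hT hαβγ R hR s hs hinj
  set Nn : ℝ := (Ideal.absNorm (Ideal.span {qdisc α β γ}) : ℝ) with hNn
  have hNn1 : 1 ≤ Nn := one_le_absNorm_span_singleton hΔ
  have hNn0 : 0 < Nn := by linarith
  obtain ⟨θ, hθ, hθ1, hθd, hθi⟩ := exists_cell_size
    (Y := √Nn / (√E * (T * R) ^ d)) (by positivity) hd0
  obtain ⟨ι, _, f, hιc, hf⟩ := H α β γ hΔ
  have := fun w : InfinitePlace k => exists_conic_cells (R := R) w hθ hθ1
    (show 0 ≤ K * T ^ 2 by positivity) (hαβγ w).1 (hαβγ w).2.1 (hαβγ w).2.2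
  choose κ hκ g hκc hg using this
  classical
  set L : 𝓞 k × 𝓞 k × 𝓞 k → ι × (∀ w, κ w) :=
    fun P => (f P, fun w => g w ((P.1 : k), (P.2.1 : k), (P.2.2 : k))) with hL
  have hcoll : ∀ P ∈ s, ∀ P' ∈ s, L P = L P' → P.1 = P'.1 ∧ P.2.1 = P'.2.1 := by
    intro P hP P' hP' hLP
    apply hinj P hP P' hP'
    apply mul_eq_mul_of_conicPolar_eq_zero hΔ (hs P hP).1 (hs P' hP').1
    by_contra hF
    simp only [hL, Prod.mk.injEq] at hLP
    obtain ⟨d1, d2, d3⟩ := hf P P' (hs P hP).1 (hs P' hP').1 hLP.1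
    have b1 := absNorm_le_of_dvd ha haC hm hF hmem d1 d2 d3
    have b2 : (Ideal.absNorm (Ideal.span {conicPolar α β γ P P'}) : ℝ) ≤
        (6000 * (K * T ^ 2) * R ^ 2 * θ ^ 2) ^ d := by
      apply absNorm_span_singleton_le_pow
      intro w
      have hh := hg w (P.1, P.2.1, P.2.2) (P'.1, P'.2.1, P'.2.2)
        ((hs P hP).1.map (algebraMap (𝓞 k) k)) ((hs P' hP').1.map (algebraMap (𝓞 k) k))
        ((hs P hP).2 w).1 ((hs P hP).2 w).2 ((hs P' hP').2 w).1 ((hs P' hP').2 w).2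
        (congrFun hLP.2 w)
      have e := map_conicPolar (algebraMap (𝓞 k) k) α β γ P P'
      change w (algebraMap (𝓞 k) k _) ≤ _
      rw [e]
      exact hh
    have b3 : Nn ≤ E * ((T * R) ^ d) ^ 2 * (θ ^ d) ^ 2 := by
      calc Nn ≤ _ := b1
        _ ≤ Ideal.absNorm (Ideal.span {4 * m}) * (6000 * (K * T ^ 2) * R ^ 2 * θ ^ 2) ^ d *
          C₀ ^ (N + N) := by gcongr
        _ = _ := by rw [hE]; simp only [mul_pow, ← pow_mul]; ring
    have b4 : E * ((T * R) ^ d) ^ 2 * (θ ^ d) ^ 2 < Nn := by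
      calc E * ((T * R) ^ d) ^ 2 * (θ ^ d) ^ 2
          < E * ((T * R) ^ d) ^ 2 * (√Nn / (√E * (T * R) ^ d)) ^ 2 := by gcongr
        _ = Nn := by
          rw [div_pow, mul_pow (√E), Real.sq_sqrt hNn0.le, Real.sq_sqrt hE0.le]
          field_simp
    linarith
  have hfib : ∀ l ∈ Finset.image L s, {P ∈ s | L P = l}.card ≤ 2 := by
    intro l hl
    obtain ⟨P, hP, rfl⟩ := Finset.mem_image.mp hl
    have hsub : {P' ∈ s | L P' = L P} ⊆ {(P.1, P.2.1, P.2.2), (P.1, P.2.1, -P.2.2)} := by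
      intro P' hP'
      rw [Finset.mem_filter] at hP'
      obtain ⟨e1, e2⟩ := hcoll P' hP'.1 P hP hP'.2
      have c1 := (hs P hP).1
      have c2 := (hs P' hP'.1).1
      simp only [OnConic] at c1 c2
      rw [e1, e2, ← c1, sq_eq_sq_iff_eq_or_eq_neg] at c2
      rw [Finset.mem_insert, Finset.mem_singleton]
      obtain ⟨u, v, z⟩ := P'
      simp only at e1 e2 c2
      rcases c2 with rfl | rfl
      · left; rw [e1, e2]
      · right; rw [e1, e2]
    exact (Finset.card_le_card hsub).trans Finset.card_le_two
  have hcard : (s.card : ℝ) ≤ 2 * (Fintype.card ι * ∏ w, (Fintype.card (κ w) : ℝ)) := by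
    have h1 := Finset.card_le_mul_card_image s 2 hfib
    have h2 := Finset.card_le_univ (Finset.image L s)
    rw [Fintype.card_prod, Fintype.card_pi] at h2
    exact_mod_cast h1.trans (Nat.mul_le_mul_left 2 h2)
  have hprod : ∏ w, (Fintype.card (κ w) : ℝ) ≤
      2 ^ Fintype.card (InfinitePlace k) * 20 ^ d * (1 / θ) ^ d := by
    calc ∏ w, (Fintype.card (κ w) : ℝ) ≤ ∏ w : InfinitePlace k, 2 * (20 / θ) ^ w.mult := by
          gcongr with w; exact hκc w
      _ = _ := by
        rw [Finset.prod_mul_distrib, Finset.prod_pow_eq_pow_sum, InfinitePlace.sum_mult_eq,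
          Finset.prod_const, Finset.card_univ, ← hd, div_eq_mul_one_div 20 θ, mul_pow]
        ring
  calc (s.card : ℝ) ≤ 2 * (Fintype.card ι * ∏ w, (Fintype.card (κ w) : ℝ)) := hcard
    _ ≤ 2 * ((C₁ * Nn ^ ε) * (2 ^ Fintype.card (InfinitePlace k) * 20 ^ d *
        (1 + 2 / (√Nn / (√E * (T * R) ^ d))))) := by
      gcongr
      exact hprod.trans (by gcongr)
    _ = 2 * C₁ * (2 ^ Fintype.card (InfinitePlace k) * 20 ^ d) * Nn ^ ε *
        (1 + 2 * √E * ((T * R) ^ d / √Nn)) := by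
      have : 2 / (√Nn / (√E * (T * R) ^ d)) = 2 * √E * ((T * R) ^ d / √Nn) := by
        field_simp
      rw [this]; ring
    _ ≤ 2 * C₁ * (2 ^ Fintype.card (InfinitePlace k) * 20 ^ d) * Nn ^ ε *
        ((1 + 2 * √E) * (1 + (T * R) ^ d / √Nn)) := by
      gcongr
      have h1 : 0 ≤ √E := by positivity
      have h2 : 0 ≤ (T * R) ^ d / √Nn := by positivity
      nlinarith
    _ = _ := by ring

section BinaryForms

variable {R : Type*} [CommRing R]

/-- The binary quadratic form with coefficients `c`. -/
def binQuad (c : Fin 3 → R) (a : Fin 2 → R) : R :=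
  c 0 * a 0 ^ 2 + c 1 * a 0 * a 1 + c 2 * a 1 ^ 2

/-- The coefficients, as binary quadratic forms in `a`, of a form of bidegree `(2, 2)` in
`(a, b)`. -/
def conicCoeff (c : Fin 3 → Fin 3 → R) (a : Fin 2 → R) (j : Fin 3) : R :=
  binQuad (fun i => c i j) a

/-- The discriminant of a form of bidegree `(2, 2)` with respect to the second set of variables. -/
def conicDisc (c : Fin 3 → Fin 3 → R) (a : Fin 2 → R) : R :=
  qdisc (conicCoeff c a 0) (conicCoeff c a 1) (conicCoeff c a 2)

theorem map_conicCoeff {S : Type*} [CommRing S] (φ : R →+* S) (c : Fin 3 → Fin 3 → R)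
    (a : Fin 2 → R) (j : Fin 3) :
    φ (conicCoeff c a j) = conicCoeff (fun i j => φ (c i j)) (fun i => φ (a i)) j := by
  simp [conicCoeff, binQuad]

theorem map_conicDisc {S : Type*} [CommRing S] (φ : R →+* S) (c : Fin 3 → Fin 3 → R)
    (a : Fin 2 → R) : φ (conicDisc c a) = conicDisc (fun i j => φ (c i j)) (fun i => φ (a i)) := by
  simp only [conicDisc, map_qdisc, map_conicCoeff]

theorem conicDisc_smul (c : Fin 3 → Fin 3 → R) (t : R) (a : Fin 2 → R) :
    conicDisc c (fun i => t * a i) = t ^ 4 * conicDisc c a := by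
  simp only [conicDisc, qdisc, conicCoeff, binQuad]
  ring

end BinaryForms

section NearRoots

theorem exists_near_root {D : Polynomial ℂ} (hD : IsCoprime D (Polynomial.derivative D)) :
    ∃ (Z : Finset ℂ) (C : ℝ), 0 < C ∧ ∀ s : ℂ, ‖s‖ ≤ 1 → ∃ r ∈ Z, ‖s - r‖ ≤ C * ‖D.eval s‖ := by
  have hcpt : IsCompact (Metric.closedBall (0 : ℂ) 1) := isCompact_closedBall 0 1
  have := hcpt.induction_on (p := fun S => ∃ (Z : Finset ℂ) (C : ℝ), 0 < C ∧
    ∀ s ∈ S, ∃ r ∈ Z, ‖s - r‖ ≤ C * ‖D.eval s‖) ⟨∅, 1, one_pos, by simp⟩ ?_ ?_ ?_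
  · simpa using this
  · rintro S S' h ⟨Z, C, hC, H⟩
    exact ⟨Z, C, hC, fun s hs => H s (h hs)⟩
  · classical
    rintro S S' ⟨Z, C, hC, H⟩ ⟨Z', C', hC', H'⟩
    refine ⟨Z ∪ Z', C + C', by positivity, ?_⟩
    rintro s (hs | hs)
    · obtain ⟨r, hr, h⟩ := H s hs
      refine ⟨r, Finset.mem_union_left _ hr, h.trans ?_⟩
      gcongr; linarith
    · obtain ⟨r, hr, h⟩ := H' s hs
      refine ⟨r, Finset.mem_union_right _ hr, h.trans ?_⟩
      gcongr; linarith
  · intro s₀ _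
    by_cases h0 : D.eval s₀ = 0
    · have hd : D.derivative.eval s₀ ≠ 0 := by
        intro h1
        obtain ⟨u, v, huv⟩ := hD
        have := congrArg (Polynomial.eval s₀) huv
        simp [h0, h1] at this
      have := ((D.hasDerivAt s₀).isTheta_sub hd).2
      rw [Asymptotics.isBigO_iff'] at this
      obtain ⟨C, hC, h⟩ := this
      rw [Filter.prod_pure, Filter.eventually_map] at h
      refine ⟨_, mem_nhdsWithin_of_mem_nhds h, {s₀}, C, hC, fun s hs => ?_⟩
      refine ⟨s₀, by simp, ?_⟩
      simpa [h0] using hs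
    · have hp : 0 < ‖D.eval s₀‖ := norm_pos_iff.mpr h0
      have h1 : ∀ᶠ s in nhds s₀, ‖D.eval s₀‖ / 2 < ‖D.eval s‖ :=
        (D.continuous.norm.continuousAt (x := s₀)).eventually_const_lt (by linarith)
      have h2 : ∀ᶠ s in nhds s₀, ‖s - s₀‖ < 1 := by
        filter_upwards [Metric.ball_mem_nhds s₀ one_pos] with s hs
        simpa [dist_eq_norm] using hs
      refine ⟨_, mem_nhdsWithin_of_mem_nhds (h1.and h2), {s₀}, 2 / ‖D.eval s₀‖, by positivity,
        fun s hs => ⟨s₀, by simp, ?_⟩⟩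
      obtain ⟨a, b⟩ := hs
      rw [div_mul_eq_mul_div, le_div_iff₀ hp]
      nlinarith

theorem exists_disc_cells {k : Type*} [Field k] (w : InfinitePlace k) (r : ℂ) {η θ : ℝ}
    (hη : 0 < η) (hθ : 0 < θ) (hθ1 : θ ≤ 1) :
    ∃ (ι : Type) (_ : Fintype ι) (f : k → ι), (Fintype.card ι : ℝ) ≤ (4 / θ) ^ w.mult ∧
      ∀ x y, ‖w.embedding x - r‖ ≤ η → ‖w.embedding y - r‖ ≤ η → f x = f y →
        w (x - y) ≤ 2 * θ * η := by
  have hs : ∀ x, ‖w.embedding x - r‖ ≤ η → ‖(w.embedding x - r) / η‖ ≤ 1 := by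
    intro x hx
    rw [norm_div, Complex.norm_real, Real.norm_eq_abs, abs_of_pos hη, div_le_one hη]
    exact hx
  have e : ∀ x y, ‖w.embedding (x - y)‖ =
      ‖(w.embedding x - r) / η - (w.embedding y - r) / η‖ * η := by
    intro x y
    rw [← sub_div, norm_div, Complex.norm_real, Real.norm_eq_abs, abs_of_pos hη,
      div_mul_cancel₀ _ hη.ne', map_sub]
    congr 1; ring
  by_cases hw : w.IsReal
  · obtain ⟨ι, i, f, hc, hf⟩ := exists_interval_cells le_rfl hθ hθ1
    refine ⟨ι, i, fun x => f ((w.embedding x - r) / η).re, ?_, fun x y hx hy h => ?_⟩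
    · rw [InfinitePlace.mult, if_pos hw, pow_one]
      exact hc.trans (by norm_num)
    · have h1 := hf _ _ ((Complex.abs_re_le_norm _).trans (hs x hx))
        ((Complex.abs_re_le_norm _).trans (hs y hy)) h
      rw [← InfinitePlace.norm_embedding_eq, e]
      have h2 := InfinitePlace.isReal_iff.mp hw
      have h3 : (w.embedding x - r) / η - (w.embedding y - r) / η =
          ((((w.embedding x - r) / η).re - ((w.embedding y - r) / η).re : ℝ) : ℂ) := by
        rw [← Complex.sub_re, ← sub_div, sub_sub_sub_cancel_right, Complex.div_ofReal_re]
        rw [← h2.coe_embedding_apply x, ← h2.coe_embedding_apply y, ← Complex.ofReal_sub,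
          Complex.ofReal_re, Complex.ofReal_div]
      rw [h3, Complex.norm_real, Real.norm_eq_abs]
      nlinarith
  · obtain ⟨ι, i, f, hc, hf⟩ := exists_complex_cells le_rfl hθ hθ1
    refine ⟨ι, i, fun x => f ((w.embedding x - r) / η), ?_, fun x y hx hy h => ?_⟩
    · rw [InfinitePlace.mult, if_neg hw]
      exact hc.trans (le_of_eq (by norm_num))
    · rw [← InfinitePlace.norm_embedding_eq, e]
      have := hf _ _ (hs x hx) (hs y hy) h
      gcongr

theorem exists_near_finset_cells {k : Type*} [Field k] (w : InfinitePlace k) (p : k → Prop)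
    {Z : Finset ℂ} {η θ : ℝ} (hη : 0 < η) (hθ : 0 < θ) (hθ1 : θ ≤ 1)
    (hZ : ∀ s : k, p s → ∃ r ∈ Z, ‖w.embedding s - r‖ ≤ η) :
    ∃ (ι : Type) (_ : Fintype ι) (f : k → ι),
      (Fintype.card ι : ℝ) ≤ (Z.card + 1) * (4 / θ) ^ w.mult ∧
      ∀ x y, p x → p y → f x = f y → w (x - y) ≤ 2 * θ * η := by
  classical
  choose ι i f hc hf using fun r : Z => exists_disc_cells (k := k) w r hη hθ hθ1
  have hZ' : ∀ s : k, p s → ∃ r : Z, ‖w.embedding s - r‖ ≤ η := fun s hs => by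
    obtain ⟨r, hr, h⟩ := hZ s hs
    exact ⟨⟨r, hr⟩, h⟩
  choose r hr using hZ'
  refine ⟨Option (Σ r : Z, ι r), inferInstance,
    fun s => if h : p s then some ⟨r s h, f _ s⟩ else none, ?_, ?_⟩
  · rw [Fintype.card_option, Fintype.card_sigma]
    push_cast
    have h1 : (∑ x : Z, (Fintype.card (ι x) : ℝ)) ≤ ∑ x : Z, (4 / θ) ^ w.mult :=
      Finset.sum_le_sum fun x _ => hc x
    have h2 : 1 ≤ (4 / θ) ^ w.mult := one_le_pow₀ (by rw [le_div_iff₀ hθ]; linarith)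
    rw [Finset.sum_const, Finset.card_univ, Fintype.card_coe, nsmul_eq_mul] at h1
    linarith
  · intro x y hx hy h
    simp only [dif_pos hx, dif_pos hy, Option.some.injEq, Sigma.mk.injEq] at h
    obtain ⟨h1, h2⟩ := h
    have h3 := hr y hy
    rw [← h1] at h3
    refine hf _ x y (hr x hx) h3 ?_
    have : ∀ r' : Z, r x hx = r' → f (r x hx) x ≍ f r' y → f (r x hx) x = f (r x hx) y := by
      rintro r' rfl h; exact eq_of_heq h
    exact this _ h1 h2

end NearRoots

section CountFirst

theorem exists_direction_cells {k : Type*} [Field k] (w : InfinitePlace k)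
    (c : Fin 3 → Fin 3 → k) {Z : Finset ℂ} {C C₁ T δ θ : ℝ} (hC : 0 < C) (hC₁ : 0 < C₁)
    (hT : 0 < T) (hδ : 0 < δ) (hθ : 0 < θ) (hθ1 : θ ≤ 1)
    (hZ : ∀ s : ℂ, ‖s‖ ≤ 1 →
      (∃ r ∈ Z, ‖s - r‖ ≤ C * ‖conicDisc (fun i j => w.embedding (c i j)) ![1, s]‖) ∧
      (∃ r ∈ Z, ‖s - r‖ ≤ C * ‖conicDisc (fun i j => w.embedding (c i j)) ![s, 1]‖)) :
    ∃ (ι : Type) (_ : Fintype ι) (f : (Fin 2 → k) → ι),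
      (Fintype.card ι : ℝ) ≤ 2 * ((Z.card + 1) * (4 / θ) ^ w.mult) ∧
      ∀ a b, (∀ i, w (a i) ≤ T) → (∃ i, T ≤ C₁ * w (a i)) → w (conicDisc c a) ≤ δ →
        (∀ i, w (b i) ≤ T) → (∃ i, T ≤ C₁ * w (b i)) → w (conicDisc c b) ≤ δ → f a = f b →
        w (a 0 * b 1 - b 0 * a 1) ≤ 2 * C * C₁ ^ 4 * θ * δ / T ^ 2 := by
  set η := C * (δ * (C₁ / T) ^ 4) with hη
  have hη0 : 0 < η := by positivity
  have e1 : ∀ s : k, w.embedding (conicDisc c ![1, s]) =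
      conicDisc (fun i j => w.embedding (c i j)) ![1, w.embedding s] := by
    intro s; rw [map_conicDisc]; congr 1; ext i; fin_cases i <;> simp
  have e2 : ∀ s : k, w.embedding (conicDisc c ![s, 1]) =
      conicDisc (fun i j => w.embedding (c i j)) ![w.embedding s, 1] := by
    intro s; rw [map_conicDisc]; congr 1; ext i; fin_cases i <;> simp
  obtain ⟨ι₀, _, f₀, hc₀, hf₀⟩ := exists_near_finset_cells w
    (fun s => w s ≤ 1 ∧ w (conicDisc c ![1, s]) ≤ δ * (C₁ / T) ^ 4) (Z := Z) hη0 hθ hθ1 (by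
      rintro s ⟨h1, h2⟩
      rw [← InfinitePlace.norm_embedding_eq] at h1 h2
      obtain ⟨r, hr, h⟩ := (hZ _ h1).1
      exact ⟨r, hr, h.trans (by rw [← e1]; rw [hη]; gcongr)⟩)
  obtain ⟨ι₁, _, f₁, hc₁, hf₁⟩ := exists_near_finset_cells w
    (fun s => w s ≤ 1 ∧ w (conicDisc c ![s, 1]) ≤ δ * (C₁ / T) ^ 4) (Z := Z) hη0 hθ hθ1 (by
      rintro s ⟨h1, h2⟩
      rw [← InfinitePlace.norm_embedding_eq] at h1 h2
      obtain ⟨r, hr, h⟩ := (hZ _ h1).2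
      exact ⟨r, hr, h.trans (by rw [← e2]; rw [hη]; gcongr)⟩)
  classical
  have key : ∀ a : Fin 2 → k, ∀ i, w (a (1 - i)) ≤ w (a i) → (∃ i, T ≤ C₁ * w (a i)) →
      w (conicDisc c a) ≤ δ → a i ≠ 0 ∧ w (a (1 - i) / a i) ≤ 1 ∧
        w (conicDisc c (fun j => (a i)⁻¹ * a j)) ≤ δ * (C₁ / T) ^ 4 := by
    intro a i hi h hd
    have hT' : T ≤ C₁ * w (a i) := by
      obtain ⟨j, hj⟩ := h
      have : j = i ∨ j = 1 - i := by fin_cases i <;> fin_cases j <;> decide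
      rcases this with rfl | rfl
      · exact hj
      · exact hj.trans (by gcongr)
    have hpos : 0 < w (a i) := by
      by_contra! h0
      nlinarith
    refine ⟨fun h0 => by simp [h0] at hpos, ?_, ?_⟩
    · rw [map_div₀, div_le_one hpos]; exact hi
    · rw [conicDisc_smul, map_mul, map_pow, map_inv₀, mul_comm]
      have : (w (a i))⁻¹ ≤ C₁ / T := by
        rw [inv_le_comm₀ hpos (by positivity), inv_div, div_le_iff₀ hC₁]
        linarith
      gcongr
  refine ⟨ι₀ ⊕ ι₁, inferInstance, fun a => if w (a 1) ≤ w (a 0) then Sum.inl (f₀ (a 1 / a 0))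
    else Sum.inr (f₁ (a 0 / a 1)), ?_, ?_⟩
  · rw [Fintype.card_sum]; push_cast; linarith
  · intro a b ha ha' haδ hb hb' hbδ h
    beta_reduce at h
    have fin : ∀ x y z : k, w x ≤ T → w y ≤ T → w z ≤ 2 * θ * η →
        w (x * y * z) ≤ 2 * C * C₁ ^ 4 * θ * δ / T ^ 2 := by
      intro x y z hx hy hz
      rw [map_mul, map_mul]
      calc w x * w y * w z ≤ T * T * (2 * θ * η) := by gcongr
        _ = _ := by rw [hη]; field_simp
    split_ifs at h with c1 c2 c2
    · rw [Sum.inl.injEq] at h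
      obtain ⟨a0, a1, a2⟩ := key a 0 c1 ha' haδ
      obtain ⟨b0, b1, b2⟩ := key b 0 c2 hb' hbδ
      have ea : (fun j => (a 0)⁻¹ * a j) = ![1, a 1 / a 0] := by
        ext j; fin_cases j <;> simp [a0, div_eq_inv_mul]
      have eb : (fun j => (b 0)⁻¹ * b j) = ![1, b 1 / b 0] := by
        ext j; fin_cases j <;> simp [b0, div_eq_inv_mul]
      rw [ea] at a2
      rw [eb] at b2
      rw [sub_zero] at a1 b1
      have := fin _ _ _ (hb 0) (ha 0) (hf₀ _ _ ⟨b1, b2⟩ ⟨a1, a2⟩ h.symm)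
      convert this using 2
      field_simp
    · rw [Sum.inr.injEq] at h
      obtain ⟨a0, a1, a2⟩ := key a 1 (not_le.mp c1).le ha' haδ
      obtain ⟨b0, b1, b2⟩ := key b 1 (not_le.mp c2).le hb' hbδ
      have ea : (fun j => (a 1)⁻¹ * a j) = ![a 0 / a 1, 1] := by
        ext j; fin_cases j <;> simp [a0, div_eq_inv_mul]
      have eb : (fun j => (b 1)⁻¹ * b j) = ![b 0 / b 1, 1] := by
        ext j; fin_cases j <;> simp [b0, div_eq_inv_mul]
      rw [ea] at a2
      rw [eb] at b2
      rw [sub_self] at a1 b1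
      have := fin _ _ _ (hb 1) (ha 1) (hf₁ _ _ ⟨a1, a2⟩ ⟨b1, b2⟩ h)
      convert this using 2
      field_simp

end CountFirst

section ReducedSystem

variable {k : Type*} [Field k] [NumberField k]

/-- A set of integral representatives of points of the projective line, of size `T` at every
archimedean place. -/
structure IsReducedSystem (S : Set (Fin 2 → 𝓞 k)) (T : (Fin 2 → 𝓞 k) → ℝ) (C₀ : ℝ) : Prop where
  eq_of_mul_eq : ∀ a ∈ S, ∀ b ∈ S, a 0 * b 1 = b 0 * a 1 → a = b
  ne_zero : ∀ a ∈ S, a ≠ 0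
  one_le : ∀ a ∈ S, 1 ≤ T a
  le : ∀ a ∈ S, ∀ (w : InfinitePlace k) (i : Fin 2), w (a i : k) ≤ T a
  ge : ∀ a ∈ S, ∀ w : InfinitePlace k, ∃ i, T a ≤ C₀ * w (a i : k)
  absNorm_le : ∀ a ∈ S, (Ideal.absNorm (Ideal.span (Set.range a)) : ℝ) ≤ C₀

/-- The discriminant of the form `c` of bidegree `(2, 2)` has simple zeros, and the conics over
these zeros are reduced. -/
structure IsSmoothFibration (c : Fin 3 → Fin 3 → 𝓞 k) : Prop where
  mem_span : ∃ (m : 𝓞 k) (N : ℕ), m ≠ 0 ∧ ∀ (a : Fin 2 → 𝓞 k) (i : Fin 2),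
    m * a i ^ N ∈ Ideal.span {conicCoeff c a 0, conicCoeff c a 1, conicCoeff c a 2}
  near_root : ∀ w : InfinitePlace k, ∃ (Z : Finset ℂ) (C : ℝ), 0 < C ∧ ∀ s : ℂ, ‖s‖ ≤ 1 →
    (∃ r ∈ Z, ‖s - r‖ ≤ C * ‖conicDisc (fun i j => w.embedding (c i j : k)) ![1, s]‖) ∧
    (∃ r ∈ Z, ‖s - r‖ ≤ C * ‖conicDisc (fun i j => w.embedding (c i j : k)) ![s, 1]‖)

theorem exists_card_first_le {S : Set (Fin 2 → 𝓞 k)} {T : (Fin 2 → 𝓞 k) → ℝ} {C₀ : ℝ}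
    (hC₀ : 1 ≤ C₀) (hS : IsReducedSystem S T C₀) {c : Fin 3 → Fin 3 → 𝓞 k}
    (hc : IsSmoothFibration c) :
    ∃ C > 0, ∀ a₀ ∈ S, conicDisc c a₀ ≠ 0 → ∀ s : Finset (Fin 2 → 𝓞 k),
      (∀ a ∈ s, a ∈ S ∧ T a ≤ 2 * T a₀ ∧ T a₀ ≤ 2 * T a ∧
        ∀ w : InfinitePlace k, w ((conicDisc c a : 𝓞 k) : k) ≤ 2 * w ((conicDisc c a₀ : 𝓞 k) : k)) →
      (s.card : ℝ) ≤ C * (1 + Ideal.absNorm (Ideal.span {conicDisc c a₀}) /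
        T a₀ ^ (2 * Module.finrank ℚ k)) := by
  choose Z D hD hZ using hc.near_root
  set d := Module.finrank ℚ k with hd
  have hd0 : d ≠ 0 := Module.finrank_pos.ne'
  set E := ∑ w, D w with hE
  have hDE : ∀ w, D w ≤ E := fun w =>
    Finset.single_le_sum (f := D) (fun i _ => (hD i).le) (Finset.mem_univ w)
  have hE0 : 0 < E := (hD (Classical.arbitrary _)).trans_le (hDE _)
  set F := 2 * E * (4 * C₀) ^ 4 with hF
  have hF0 : 0 < F := by positivity
  set P := ∏ w, (2 * ((Z w).card + 1) : ℝ) with hP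
  have hP0 : 0 < P := by
    rw [hP]
    refine Finset.prod_pos fun w _ => mul_pos two_pos ?_
    exact add_pos_of_nonneg_of_pos (Nat.cast_nonneg _) one_pos
  clear_value P F E d
  refine ⟨P * 4 ^ d * (1 + 2 * F ^ d * 2 ^ d), by positivity, ?_⟩
  intro a₀ ha₀ hΔ s hs
  set Nn : ℝ := (Ideal.absNorm (Ideal.span {conicDisc c a₀}) : ℝ) with hNn
  have hNn1 : 1 ≤ Nn := one_le_absNorm_span_singleton hΔ
  have hNn0 : 0 < Nn := by linarith
  have hT₀ : 0 < T a₀ := one_pos.trans_le (hS.one_le a₀ ha₀)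
  set T' := 2 * T a₀ with hT'
  have hT'0 : 0 < T' := by positivity
  obtain ⟨θ, hθ, hθ1, hθd, hθi⟩ := exists_cell_size
    (Y := T' ^ (2 * d) / (F ^ d * 2 ^ d * Nn)) (by positivity) hd0
  have hδ : ∀ w : InfinitePlace k, 0 < 2 * w ((conicDisc c a₀ : 𝓞 k) : k) := fun w => by
    have : 0 < w ((conicDisc c a₀ : 𝓞 k) : k) := InfinitePlace.pos_iff.mpr (RingOfIntegers.coe_ne_zero_iff.mpr hΔ)
    positivity
  choose ι hι f hιc hf using fun w : InfinitePlace k => exists_direction_cells w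
    (fun i j => (c i j : k)) (hD w) (show 0 < 4 * C₀ by positivity) hT'0 (hδ w) hθ hθ1 (hZ w)
  classical
  set L : (Fin 2 → 𝓞 k) → ∀ w, ι w := fun a w => f w (fun i => (a i : k)) with hL
  have hdisc : ∀ a : Fin 2 → 𝓞 k, conicDisc (fun i j => (c i j : k)) (fun i => (a i : k)) =
      ((conicDisc c a : 𝓞 k) : k) := fun a => (map_conicDisc (algebraMap (𝓞 k) k) c a).symm
  have hinj : Set.InjOn L s := by
    intro a ha b hb hab
    obtain ⟨haS, ha1, ha2, ha3⟩ := hs a ha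
    obtain ⟨hbS, hb1, hb2, hb3⟩ := hs b hb
    apply hS.eq_of_mul_eq a haS b hbS
    by_contra hne
    have hge : ∀ a : Fin 2 → 𝓞 k, a ∈ S → T a₀ ≤ 2 * T a → ∀ w : InfinitePlace k,
        ∃ i, T' ≤ 4 * C₀ * w (a i : k) := by
      intro a ha h w
      obtain ⟨i, hi⟩ := hS.ge a ha w
      exact ⟨i, by linarith⟩
    have h1 : ∀ w : InfinitePlace k, w ((a 0 * b 1 - b 0 * a 1 : 𝓞 k) : k) ≤
        (F * θ / T' ^ 2) * (2 * w ((conicDisc c a₀ : 𝓞 k) : k)) := by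
      intro w
      have := hf w (fun i => (a i : k)) (fun i => (b i : k))
        (fun i => (hS.le a haS w i).trans ha1) (hge a haS ha2 w)
        (by rw [hdisc]; exact ha3 w)
        (fun i => (hS.le b hbS w i).trans hb1) (hge b hbS hb2 w)
        (by rw [hdisc]; exact hb3 w) (congrFun hab w)
      push_cast
      refine this.trans ?_
      have hh := hδ w
      calc 2 * D w * (4 * C₀) ^ 4 * θ * (2 * w ((conicDisc c a₀ : 𝓞 k) : k)) / T' ^ 2
          ≤ 2 * E * (4 * C₀) ^ 4 * θ * (2 * w ((conicDisc c a₀ : 𝓞 k) : k)) / T' ^ 2 := by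
            gcongr; exact hDE w
        _ = _ := by rw [hF]; ring
    have h2 := absNorm_span_singleton_le h1
    have h3 : ∏ w : InfinitePlace k, (F * θ / T' ^ 2 * (2 * w ((conicDisc c a₀ : 𝓞 k) : k))) ^ w.mult =
        (F * θ / T' ^ 2 * 2) ^ d * Nn := by
      rw [hNn, absNorm_span_singleton_eq_prod, hd, ← InfinitePlace.sum_mult_eq,
        ← Finset.prod_pow_eq_pow_sum, ← Finset.prod_mul_distrib]
      congr 1; ext w
      rw [← mul_pow, mul_assoc]
    rw [h3] at h2
    have h4 : (F * θ / T' ^ 2 * 2) ^ d * Nn < 1 := by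
      calc (F * θ / T' ^ 2 * 2) ^ d * Nn = θ ^ d * (F ^ d * 2 ^ d * Nn / T' ^ (2 * d)) := by
            rw [mul_pow, div_pow, mul_pow, ← pow_mul]; ring
        _ < T' ^ (2 * d) / (F ^ d * 2 ^ d * Nn) * (F ^ d * 2 ^ d * Nn / T' ^ (2 * d)) := by gcongr
        _ = 1 := by field_simp
    have h5 := one_le_absNorm_span_singleton (sub_ne_zero.mpr hne)
    linarith
  have hcard : (s.card : ℝ) ≤ ∏ w, (Fintype.card (ι w) : ℝ) := by
    have h1 := Finset.card_le_univ (Finset.image L s)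
    rw [Finset.card_image_of_injOn hinj, Fintype.card_pi] at h1
    exact_mod_cast h1
  have hY : 1 + 2 / (T' ^ (2 * d) / (F ^ d * 2 ^ d * Nn)) ≤
      (1 + 2 * F ^ d * 2 ^ d) * (1 + Nn / T a₀ ^ (2 * d)) := by
    have h1 : 2 / (T' ^ (2 * d) / (F ^ d * 2 ^ d * Nn)) =
        2 * F ^ d * 2 ^ d * (Nn / T' ^ (2 * d)) := by
      rw [div_div_eq_mul_div]; ring
    have h2 : Nn / T' ^ (2 * d) ≤ Nn / T a₀ ^ (2 * d) := by
      gcongr; linarith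
    have h3 : 0 < 2 * F ^ d * 2 ^ d := by positivity
    have h4 : 0 ≤ Nn / T a₀ ^ (2 * d) := by positivity
    rw [h1]
    nlinarith
  calc (s.card : ℝ) ≤ ∏ w, (Fintype.card (ι w) : ℝ) := hcard
    _ ≤ ∏ w : InfinitePlace k, 2 * (((Z w).card + 1) * (4 / θ) ^ w.mult) := by
      gcongr with w; exact hιc w
    _ = P * 4 ^ d * (1 / θ) ^ d := by
      simp_rw [← mul_assoc]
      rw [Finset.prod_mul_distrib, Finset.prod_pow_eq_pow_sum, InfinitePlace.sum_mult_eq, ← hd,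
        ← hP, div_eq_mul_one_div 4 θ, mul_pow, mul_assoc]
    _ ≤ P * 4 ^ d * ((1 + 2 * F ^ d * 2 ^ d) * (1 + Nn / T a₀ ^ (2 * d))) := by
      gcongr; exact hθi.trans hY
    _ = _ := by ring

end ReducedSystem

section Dyadic

theorem exists_dyadic_labels {α ι : Type*} [Fintype ι] (f : ι → α → ℝ) {X : ℝ} (hX : 1 ≤ X) :
    ∃ (n : ℕ) (L : α → ι → Fin n), (n : ℝ) ≤ 2 * Real.logb 2 X + 5 ∧
      ∀ x y, (∀ i, X⁻¹ ≤ f i x ∧ f i x ≤ X) → (∀ i, X⁻¹ ≤ f i y ∧ f i y ≤ X) → L x = L y →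
        ∀ i, f i x ≤ 2 * f i y := by
  have hX0 : 0 < X := by linarith
  have hl : 0 ≤ Real.logb 2 X := Real.logb_nonneg one_lt_two hX
  set n : ℕ := ⌊2 * Real.logb 2 X⌋₊ + 4 with hn
  have hn1 : (n : ℝ) ≤ 2 * Real.logb 2 X + 5 := by
    have := Nat.floor_le (show 0 ≤ 2 * Real.logb 2 X by linarith)
    rw [hn]; push_cast; linarith
  refine ⟨n, fun x i => Fin.ofNat n ⌊Real.logb 2 (f i x * X)⌋₊, hn1, fun x y hx hy h i => ?_⟩
  have key : ∀ x, X⁻¹ ≤ f i x ∧ f i x ≤ X → 0 < f i x ∧ 0 ≤ Real.logb 2 (f i x * X) ∧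
      ⌊Real.logb 2 (f i x * X)⌋₊ < n := by
    rintro x ⟨h1, h2⟩
    have h0 : 0 < f i x := (inv_pos.mpr hX0).trans_le h1
    have h3 : 1 ≤ f i x * X := by
      rw [inv_le_iff_one_le_mul₀ hX0] at h1; exact h1
    refine ⟨h0, Real.logb_nonneg one_lt_two h3, ?_⟩
    have h4 : Real.logb 2 (f i x * X) ≤ 2 * Real.logb 2 X := by
      rw [Real.logb_mul h0.ne' hX0.ne']
      have := Real.logb_le_logb_of_le one_lt_two h0 h2
      linarith
    have := Nat.floor_le_floor h4
    omega
  obtain ⟨x0, x1, x2⟩ := key x (hx i)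
  obtain ⟨y0, y1, y2⟩ := key y (hy i)
  have h1 := congrArg Fin.val (congrFun h i)
  simp only [Fin.ofNat, Nat.mod_eq_of_lt x2, Nat.mod_eq_of_lt y2] at h1
  have h2 := Nat.lt_floor_add_one (Real.logb 2 (f i x * X))
  have h3 := Nat.floor_le y1
  rw [h1] at h2
  have h4 : Real.logb 2 (f i x * X) ≤ Real.logb 2 (2 * (f i y * X)) := by
    rw [Real.logb_mul two_ne_zero (by positivity), Real.logb_self_eq_one one_lt_two]
    linarith
  rw [Real.logb_le_logb one_lt_two (by positivity) (by positivity)] at h4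
  have h5 : f i x * X ≤ 2 * f i y * X := by linarith
  exact le_of_mul_le_mul_right h5 hX0

theorem exists_log_pow_le {A p ε : ℝ} (hA : 1 ≤ A) (hp : 0 ≤ p) (hε : 0 < ε) (n : ℕ) :
    ∃ C > 0, ∀ B : ℝ, 1 ≤ B → (2 * Real.logb 2 (A * B ^ p) + 5) ^ n ≤ C * B ^ ε := by
  set δ := ε / (n + 1) with hδ
  have hδ0 : 0 < δ := by positivity
  have hl2 : 0 < Real.log 2 := Real.log_pos one_lt_two
  have hA0 : 0 ≤ Real.log A := Real.log_nonneg hA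
  set D := 2 * Real.log A / Real.log 2 + 5 + 2 * p / δ / Real.log 2 with hD
  have hD0 : 0 < D := by positivity
  refine ⟨D ^ n, by positivity, fun B hB => ?_⟩
  have hB0 : 0 < B := by linarith
  have h1 : 1 ≤ B ^ δ := Real.one_le_rpow hB hδ0.le
  have h2 : Real.log B ≤ B ^ δ / δ := Real.log_le_rpow_div hB0.le hδ0
  have h3 : 2 * Real.logb 2 (A * B ^ p) + 5 ≤ D * B ^ δ := by
    rw [Real.logb, Real.log_mul (by linarith) (by positivity), Real.log_rpow hB0]
    have h4 : p * Real.log B ≤ p * (B ^ δ / δ) := by gcongr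
    have h5 : 2 * ((Real.log A + p * Real.log B) / Real.log 2) + 5 ≤
      2 * ((Real.log A + p * (B ^ δ / δ)) / Real.log 2) + 5 := by gcongr
    have h6 : 0 ≤ 2 * Real.log A / Real.log 2 := by positivity
    calc _ ≤ _ := h5
      _ = (2 * Real.log A / Real.log 2 + 5) * 1 + 2 * p / δ / Real.log 2 * B ^ δ := by
        field_simp
        ring
      _ ≤ (2 * Real.log A / Real.log 2 + 5) * B ^ δ + 2 * p / δ / Real.log 2 * B ^ δ := by gcongr
      _ = D * B ^ δ := by rw [hD]; ring
  have h0 : 0 ≤ 2 * Real.logb 2 (A * B ^ p) + 5 := by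
    have := Real.logb_nonneg one_lt_two (one_le_mul_of_one_le_of_one_le hA (Real.one_le_rpow hB hp))
    linarith
  calc _ ≤ (D * B ^ δ) ^ n := by gcongr
    _ = D ^ n * B ^ (δ * n) := by rw [mul_pow, ← Real.rpow_mul_natCast hB0.le]
    _ ≤ D ^ n * B ^ ε := by
      gcongr
      · rw [hδ, div_mul_eq_mul_div, div_le_iff₀ (by positivity)]; nlinarith

end Dyadic

section MainCount

variable {k : Type*} [Field k] [NumberField k]

theorem exists_conicCoeff_le (c : Fin 3 → Fin 3 → 𝓞 k) : ∃ K : ℝ, 1 ≤ K ∧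
    ∀ (a : Fin 2 → 𝓞 k) (w : InfinitePlace k) (T : ℝ), 0 ≤ T → (∀ i, w (a i : k) ≤ T) →
      (∀ j, w ((conicCoeff c a j : 𝓞 k) : k) ≤ K * T ^ 2) ∧
      w ((conicDisc c a : 𝓞 k) : k) ≤ K * T ^ 4 := by
  set M : ℝ := 1 + ∑ w : InfinitePlace k, ∑ j, ∑ i, w (c i j : k) with hM
  have hn : ∀ (w : InfinitePlace k) j, 0 ≤ ∑ i, w (c i j : k) := fun w j =>
    Finset.sum_nonneg fun i _ => apply_nonneg w _
  have hM1 : 1 ≤ M := by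
    have := Finset.sum_nonneg fun (w : InfinitePlace k) (_ : w ∈ Finset.univ) =>
      Finset.sum_nonneg fun j (_ : j ∈ Finset.univ) => hn w j
    linarith
  have hle : ∀ (w : InfinitePlace k) j, ∑ i, w (c i j : k) ≤ M := by
    intro w j
    have h1 := Finset.single_le_sum (f := fun j => ∑ i, w (c i j : k)) (fun j _ => hn w j)
      (Finset.mem_univ j)
    have h2 := Finset.single_le_sum (f := fun w : InfinitePlace k => ∑ j, ∑ i, w (c i j : k))
      (fun w _ => Finset.sum_nonneg fun j _ => hn w j) (Finset.mem_univ w)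
    beta_reduce at h1 h2
    linarith
  have h1 : ∀ (a : Fin 2 → 𝓞 k) (w : InfinitePlace k) (T : ℝ), 0 ≤ T → (∀ i, w (a i : k) ≤ T) →
      ∀ j, w ((conicCoeff c a j : 𝓞 k) : k) ≤ M * T ^ 2 := by
    intro a w T hT ha j
    have h0 := apply_nonneg w (a 0 : k)
    have h1 := apply_nonneg w (a 1 : k)
    have h2 := fun i => apply_nonneg w (c i j : k)
    calc w ((conicCoeff c a j : 𝓞 k) : k)
        = w (c 0 j * a 0 ^ 2 + c 1 j * a 0 * a 1 + c 2 j * a 1 ^ 2 : k) := by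
          simp [conicCoeff, binQuad]
      _ ≤ w (c 0 j : k) * w (a 0 : k) ^ 2 + w (c 1 j : k) * w (a 0 : k) * w (a 1 : k) +
          w (c 2 j : k) * w (a 1 : k) ^ 2 := by
          refine (w.1.add_le _ _).trans (add_le_add ((w.1.add_le _ _).trans_eq ?_) ?_)
          · simp only [InfinitePlace.coe_apply, map_mul, map_pow]
          · simp only [InfinitePlace.coe_apply, map_mul, map_pow, le_refl]
      _ ≤ w (c 0 j : k) * T ^ 2 + w (c 1 j : k) * T * T + w (c 2 j : k) * T ^ 2 := by
          gcongr
          · exact ha 0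
          · exact ha 0
          · exact ha 1
          · exact ha 1
      _ = (∑ i, w (c i j : k)) * T ^ 2 := by rw [Fin.sum_univ_three]; ring
      _ ≤ M * T ^ 2 := by gcongr; exact hle w j
  refine ⟨5 * M ^ 2, by nlinarith, fun a w T hT ha => ⟨fun j => (h1 a w T hT ha j).trans ?_, ?_⟩⟩
  · gcongr; nlinarith
  · have h2 := h1 a w T hT ha
    have h3 := fun j => apply_nonneg w ((conicCoeff c a j : 𝓞 k) : k)
    have h4 : w (4 : k) ≤ 4 := by
      rw [← InfinitePlace.norm_embedding_eq, map_ofNat]; norm_num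
    calc w ((conicDisc c a : 𝓞 k) : k)
        = w (((conicCoeff c a 1 : 𝓞 k) : k) ^ 2 +
          -(4 * ((conicCoeff c a 0 : 𝓞 k) : k) * ((conicCoeff c a 2 : 𝓞 k) : k))) := by
          rw [conicDisc, qdisc, ← sub_eq_add_neg]; simp [map_ofNat]
      _ ≤ w ((conicCoeff c a 1 : 𝓞 k) : k) ^ 2 + w (4 : k) * w ((conicCoeff c a 0 : 𝓞 k) : k) *
          w ((conicCoeff c a 2 : 𝓞 k) : k) := by
          refine (w.1.add_le _ _).trans (add_le_add ?_ ?_)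
          · simp only [InfinitePlace.coe_apply, map_pow, le_refl]
          · simp only [InfinitePlace.coe_apply, map_neg_eq_map, map_mul, le_refl]
      _ ≤ (M * T ^ 2) ^ 2 + 4 * (M * T ^ 2) * (M * T ^ 2) := by
          have := h3 0
          have := h3 1
          have := h3 2
          gcongr
          · exact h2 1
          · exact h2 0
          · exact h2 2
      _ = 5 * M ^ 2 * T ^ 4 := by ring

theorem exists_card_fibre_le {S : Set (Fin 2 → 𝓞 k)} {T : (Fin 2 → 𝓞 k) → ℝ} {C₀ : ℝ}
    (hC₀ : 1 ≤ C₀) (hS : IsReducedSystem S T C₀) {c : Fin 3 → Fin 3 → 𝓞 k}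
    (hc : IsSmoothFibration c) {ε : ℝ} (hε : 0 < ε) :
    ∃ C > 0, ∀ B : ℝ, 1 ≤ B → ∀ a ∈ S, conicDisc c a ≠ 0 →
      T a ^ (2 * Module.finrank ℚ k) ≤ B →
      ∀ s : Finset ((Fin 2 → 𝓞 k) × 𝓞 k),
      (∀ P ∈ s, P.1 ∈ S ∧ OnConic (conicCoeff c a 0) (conicCoeff c a 1) (conicCoeff c a 2)
        (P.1 0, P.1 1, P.2) ∧
        T a ^ Module.finrank ℚ k * T P.1 ^ Module.finrank ℚ k ≤ B) →
      (s.card : ℝ) ≤ C * B ^ ε *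
        (1 + B / √(Ideal.absNorm (Ideal.span {conicDisc c a}) : ℝ)) := by
  obtain ⟨K, hK, hKc⟩ := exists_conicCoeff_le c
  obtain ⟨m, N, hm, hmem⟩ := hc.mem_span
  obtain ⟨C, hC, H⟩ := exists_card_conic_le (k := k) (half_pos hε) hm N (K := K) (by linarith) hC₀
  have hpow : ∀ (x : 𝓞 k) (y : ℝ), (∀ w : InfinitePlace k, w (x : k) ≤ y) →
      (Ideal.absNorm (Ideal.span {x}) : ℝ) ≤ y ^ Module.finrank ℚ k :=
    fun x y h => absNorm_span_singleton_le_pow h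
  have hd0 : Module.finrank ℚ k ≠ 0 := Module.finrank_pos.ne'
  generalize Module.finrank ℚ k = d at H hd0 hpow ⊢
  refine ⟨C * (K ^ d) ^ (ε / 2), by positivity, ?_⟩
  intro B hB a ha hΔ hTB s hs
  have hB0 : 0 < B := by linarith
  have hT1 : 1 ≤ T a := hS.one_le a ha
  have hT0 : 0 < T a := by linarith
  set R := B ^ (1 / d : ℝ) / T a with hR
  have hR0 : 0 < R := by positivity
  have hTR : (T a * R) ^ d = B := by
    rw [hR, mul_div_cancel₀ _ hT0.ne', one_div, Real.rpow_inv_natCast_pow hB0.le hd0]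
  set Nn : ℝ := (Ideal.absNorm (Ideal.span {conicDisc c a}) : ℝ) with hNn
  have hN0 : 0 ≤ Nn := Nat.cast_nonneg _
  have hNB : Nn ≤ K ^ d * B ^ 2 := by
    calc Nn ≤ (K * T a ^ 4) ^ d :=
          hpow _ _ fun w => (hKc a w _ hT0.le (hS.le a ha w)).2
      _ = K ^ d * (T a ^ (2 * d)) ^ 2 := by rw [mul_pow, ← pow_mul, ← pow_mul]; ring_nf
      _ ≤ K ^ d * B ^ 2 := by gcongr
  classical
  set ψ : (Fin 2 → 𝓞 k) × 𝓞 k → 𝓞 k × 𝓞 k × 𝓞 k := fun P => (P.1 0, P.1 1, P.2) with hψ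
  have hψi : Function.Injective ψ := by
    rintro ⟨b, z⟩ ⟨b', z'⟩ h
    simp only [hψ, Prod.mk.injEq] at h
    obtain ⟨h0, h1, h2⟩ := h
    refine Prod.ext (funext fun i => ?_) h2
    fin_cases i
    · exact h0
    · exact h1
  have h1 := H (conicCoeff c a 0) (conicCoeff c a 1) (conicCoeff c a 2) hΔ a (hS.ne_zero a ha)
    (hS.absNorm_le a ha) (hmem a) (T a) hT0
    (fun w => have h := (hKc a w _ hT0.le (hS.le a ha w)).1; ⟨h 0, h 1, h 2⟩) R hR0
    (s.image ψ) (by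
      intro P hP
      obtain ⟨P, hPs, rfl⟩ := Finset.mem_image.mp hP
      obtain ⟨hb, h1, h2⟩ := hs P hPs
      have hTb : T P.1 ≤ R := by
        rw [hR, le_div_iff₀ hT0]
        apply le_of_pow_le_pow_left₀ hd0 (by positivity)
        rw [one_div, Real.rpow_inv_natCast_pow hB0.le hd0, mul_pow, mul_comm]
        exact h2
      exact ⟨h1, fun w => ⟨(hS.le _ hb w 0).trans hTb, (hS.le _ hb w 1).trans hTb⟩⟩) (by
      intro P hP P' hP' h
      obtain ⟨P, hPs, rfl⟩ := Finset.mem_image.mp hP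
      obtain ⟨P', hPs', rfl⟩ := Finset.mem_image.mp hP'
      have := hS.eq_of_mul_eq _ (hs P hPs).1 _ (hs P' hPs').1 h
      simp [hψ, this])
  rw [Finset.card_image_of_injective _ hψi, hTR] at h1
  refine h1.trans ?_
  have h2 : Nn ^ (ε / 2) ≤ (K ^ d) ^ (ε / 2) * B ^ ε := by
    calc Nn ^ (ε / 2) ≤ (K ^ d * B ^ 2) ^ (ε / 2) := by gcongr
      _ = _ := by
        rw [Real.mul_rpow (by positivity) (by positivity), ← Real.rpow_natCast B 2,
          ← Real.rpow_mul hB0.le]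
        congr 2; push_cast; ring
  calc C * Nn ^ (ε / 2) * (1 + B / √Nn) ≤ C * ((K ^ d) ^ (ε / 2) * B ^ ε) * (1 + B / √Nn) := by
        gcongr
    _ = _ := by ring

theorem inv_pow_finrank_le {x : 𝓞 k} {y : ℝ} (hy : 1 ≤ y) (hx : x ≠ 0)
    (h : ∀ w : InfinitePlace k, w (x : k) ≤ y) (w : InfinitePlace k) :
    (y ^ Module.finrank ℚ k)⁻¹ ≤ w (x : k) := by
  have hy0 : 0 < y := by linarith
  rw [inv_le_iff_one_le_mul₀ (by positivity)]
  have h1 := one_le_absNorm_span_singleton hx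
  rw [absNorm_span_singleton_eq_prod] at h1
  refine h1.trans ?_
  have hw := apply_nonneg w (x : k)
  have hm : w (x : k) ^ w.mult ≤ w (x : k) * y ^ w.mult := by
    have e : w.mult = w.mult - 1 + 1 := (Nat.sub_add_cancel InfinitePlace.mult_pos).symm
    calc w (x : k) ^ w.mult = w (x : k) * w (x : k) ^ (w.mult - 1) := by
          rw [← pow_succ', ← e]
      _ ≤ w (x : k) * y ^ (w.mult - 1) := by gcongr; exact h w
      _ ≤ w (x : k) * y ^ w.mult := by gcongr; exact Nat.sub_le _ _
  rw [← InfinitePlace.sum_mult_eq, ← Finset.prod_pow_eq_pow_sum]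
  classical
  rw [← Finset.mul_prod_erase _ _ (Finset.mem_univ w),
    ← Finset.mul_prod_erase _ (fun w : InfinitePlace k => y ^ w.mult) (Finset.mem_univ w),
    ← mul_assoc]
  have hn : 0 ≤ ∏ x_1 ∈ Finset.univ.erase w, x_1 (x : k) ^ x_1.mult :=
    Finset.prod_nonneg fun v _ => pow_nonneg (apply_nonneg v _) _
  gcongr with v
  exact h v

theorem exists_card_triples_le {S : Set (Fin 2 → 𝓞 k)} {T : (Fin 2 → 𝓞 k) → ℝ} {C₀ : ℝ}
    (hC₀ : 1 ≤ C₀) (hS : IsReducedSystem S T C₀) {c : Fin 3 → Fin 3 → 𝓞 k}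
    (hc : IsSmoothFibration c) {ε : ℝ} (hε : 0 < ε) :
    ∃ C > 0, ∀ B : ℝ, 1 ≤ B → ∀ s : Finset ((Fin 2 → 𝓞 k) × (Fin 2 → 𝓞 k) × 𝓞 k),
      (∀ P ∈ s, P.1 ∈ S ∧ P.2.1 ∈ S ∧ conicDisc c P.1 ≠ 0 ∧
        OnConic (conicCoeff c P.1 0) (conicCoeff c P.1 1) (conicCoeff c P.1 2)
          (P.2.1 0, P.2.1 1, P.2.2) ∧ T P.1 ≤ T P.2.1 ∧
        T P.1 ^ Module.finrank ℚ k * T P.2.1 ^ Module.finrank ℚ k ≤ B) →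
      (s.card : ℝ) ≤ C * B ^ (1 + ε) := by
  obtain ⟨K, hK, hKc⟩ := exists_conicCoeff_le c
  obtain ⟨C₁, hC₁, H₁⟩ := exists_card_first_le hC₀ hS hc
  obtain ⟨C₂, hC₂, H₂⟩ := exists_card_fibre_le hC₀ hS hc (half_pos hε)
  have hpow : ∀ (x : 𝓞 k) (y : ℝ), (∀ w : InfinitePlace k, w (x : k) ≤ y) →
      (Ideal.absNorm (Ideal.span {x}) : ℝ) ≤ y ^ Module.finrank ℚ k :=
    fun x y h => absNorm_span_singleton_le_pow h
  have hd0 : Module.finrank ℚ k ≠ 0 := Module.finrank_pos.ne'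
  have hprod : ∀ (x : 𝓞 k) (y : ℝ), 1 ≤ y → x ≠ 0 → (∀ w : InfinitePlace k, w (x : k) ≤ y) →
      ∀ w : InfinitePlace k, (y ^ Module.finrank ℚ k)⁻¹ ≤ w (x : k) :=
    fun x y hy hx h w => inv_pow_finrank_le hy hx h w
  obtain ⟨C₃, hC₃, H₃⟩ := exists_log_pow_le (A := K ^ Module.finrank ℚ k) (p := 2)
    (one_le_pow₀ hK) zero_le_two (half_pos hε) (Fintype.card (Option (InfinitePlace k)))
  generalize Module.finrank ℚ k = d at *
  refine ⟨C₃ * (C₁ * (C₂ * (2 + 2 * K ^ d))), by positivity, ?_⟩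
  intro B hB s hs
  have hB0 : 0 < B := by linarith
  have hKd : 1 ≤ K ^ d := one_le_pow₀ hK
  have hTB : ∀ P ∈ s, 1 ≤ T P.1 ∧ T P.1 ^ (2 * d) ≤ B := by
    intro P hP
    obtain ⟨h1, h2, h3, h4, h5, h6⟩ := hs P hP
    refine ⟨hS.one_le _ h1, le_trans ?_ h6⟩
    have := hS.one_le _ h1
    rw [two_mul, pow_add]
    gcongr
  have hdisc : ∀ P ∈ s, K * T P.1 ^ 4 ≤ K ^ d * B ^ (2 : ℝ) ∧ (K * T P.1 ^ 4) ^ d ≤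
      K ^ d * B ^ (2 : ℝ) := by
    intro P hP
    obtain ⟨h1, h2⟩ := hTB P hP
    have h3 : (K * T P.1 ^ 4) ^ d ≤ K ^ d * B ^ (2 : ℝ) := by
      calc (K * T P.1 ^ 4) ^ d = K ^ d * (T P.1 ^ (2 * d)) ^ 2 := by
            rw [mul_pow, ← pow_mul, ← pow_mul]; ring_nf
        _ ≤ K ^ d * B ^ 2 := by gcongr
        _ = _ := by norm_cast
    exact ⟨(le_self_pow₀ (one_le_mul_of_one_le_of_one_le hK (one_le_pow₀ h1)) hd0).trans h3, h3⟩
  set X := K ^ d * B ^ (2 : ℝ) with hX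
  have hX1 : 1 ≤ X := one_le_mul_of_one_le_of_one_le hKd (Real.one_le_rpow hB zero_le_two)
  obtain ⟨n, L, hn, hL⟩ := exists_dyadic_labels
    (fun (i : Option (InfinitePlace k)) (a : Fin 2 → 𝓞 k) =>
      i.elim (T a) (fun w => w ((conicDisc c a : 𝓞 k) : k))) hX1
  have hbd : ∀ P ∈ s, ∀ i : Option (InfinitePlace k),
      X⁻¹ ≤ i.elim (T P.1) (fun w => w ((conicDisc c P.1 : 𝓞 k) : k)) ∧
      i.elim (T P.1) (fun w => w ((conicDisc c P.1 : 𝓞 k) : k)) ≤ X := by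
    intro P hP i
    obtain ⟨h1, h2⟩ := hTB P hP
    obtain ⟨h3, h4⟩ := hdisc P hP
    obtain ⟨h5, -, h6, -⟩ := hs P hP
    have h0 : 0 < T P.1 := by linarith
    have hle : ∀ w : InfinitePlace k, w ((conicDisc c P.1 : 𝓞 k) : k) ≤ K * T P.1 ^ 4 :=
      fun w => (hKc P.1 w _ h0.le (hS.le _ h5 w)).2
    have h7 : 1 ≤ K * T P.1 ^ 4 := one_le_mul_of_one_le_of_one_le hK (one_le_pow₀ h1)
    cases i with
    | none =>
      refine ⟨(inv_le_one_of_one_le₀ hX1).trans h1, le_trans ?_ h3⟩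
      exact (le_self_pow₀ h1 (by norm_num)).trans (le_mul_of_one_le_left (by positivity) hK)
    | some w =>
      refine ⟨le_trans ?_ (hprod _ _ h7 h6 hle w), (hle w).trans h3⟩
      exact inv_anti₀ (by positivity) h4
  classical
  have hlabel : ∀ l ∈ Finset.univ (α := Option (InfinitePlace k) → Fin n),
      ((s.filter fun P => L P.1 = l).card : ℝ) ≤
        C₁ * (C₂ * (2 + 2 * K ^ d)) * B ^ (1 + ε / 2) := by
    intro l _
    set s' := s.filter fun P => L P.1 = l with hs'
    have hs's : ∀ P ∈ s', P ∈ s := fun P hP => (Finset.mem_filter.mp hP).1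
    rcases s'.eq_empty_or_nonempty with h0 | hne
    · rw [h0]; simp; positivity
    obtain ⟨P₀, hP₀, hmin⟩ := s'.exists_min_image
      (fun P => Ideal.absNorm (Ideal.span {conicDisc c P.1})) hne
    have hcmp : ∀ P ∈ s', ∀ P' ∈ s', T P.1 ≤ 2 * T P'.1 ∧ ∀ w : InfinitePlace k,
        w ((conicDisc c P.1 : 𝓞 k) : k) ≤ 2 * w ((conicDisc c P'.1 : 𝓞 k) : k) := by
      intro P hP P' hP'
      have h1 := hL P.1 P'.1 (hbd P (hs's P hP)) (hbd P' (hs's P' hP'))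
        ((Finset.mem_filter.mp hP).2.trans (Finset.mem_filter.mp hP').2.symm)
      exact ⟨h1 none, fun w => h1 (some w)⟩
    obtain ⟨ha₀, -, hΔ₀, -⟩ := hs P₀ (hs's P₀ hP₀)
    obtain ⟨hT₁, hTB₀⟩ := hTB P₀ (hs's P₀ hP₀)
    have hT0 : 0 < T P₀.1 := by linarith
    set Nn : ℝ := (Ideal.absNorm (Ideal.span {conicDisc c P₀.1}) : ℝ) with hNn
    have hN1 : 1 ≤ Nn := one_le_absNorm_span_singleton hΔ₀
    have hNT : Nn ≤ K ^ d * (T P₀.1 ^ (2 * d)) ^ 2 := by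
      refine (hpow _ _ fun w => (hKc P₀.1 w _ hT0.le (hS.le _ ha₀ w)).2).trans_eq ?_
      rw [mul_pow, ← pow_mul, ← pow_mul]; ring_nf
    have hfst := H₁ P₀.1 ha₀ hΔ₀ (s'.image Prod.fst) (by
      intro a ha
      obtain ⟨P, hP, rfl⟩ := Finset.mem_image.mp ha
      exact ⟨(hs P (hs's P hP)).1, (hcmp P hP P₀ hP₀).1, (hcmp P₀ hP₀ P hP).1,
        (hcmp P hP P₀ hP₀).2⟩)
    have hfib : ∀ a ∈ s'.image Prod.fst, ((s'.filter fun P => P.1 = a).card : ℝ) ≤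
        C₂ * B ^ (ε / 2) * (1 + B / √Nn) := by
      intro a ha
      obtain ⟨P, hP, rfl⟩ := Finset.mem_image.mp ha
      obtain ⟨haS, -, hΔ, -⟩ := hs P (hs's P hP)
      have h1 := H₂ B hB P.1 haS hΔ (hTB P (hs's P hP)).2
        ((s'.filter fun P' => P'.1 = P.1).image Prod.snd) (by
          intro Q hQ
          obtain ⟨P', hP', rfl⟩ := Finset.mem_image.mp hQ
          obtain ⟨h1, h2⟩ := Finset.mem_filter.mp hP'
          obtain ⟨-, h3, -, h4, -, h5⟩ := hs P' (hs's P' h1)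
          rw [h2] at h4 h5
          exact ⟨h3, h4, h5⟩)
      rw [Finset.card_image_of_injOn (by
        intro P' hP' P'' hP'' h
        have h1 := (Finset.mem_filter.mp hP').2
        have h2 := (Finset.mem_filter.mp hP'').2
        exact Prod.ext (h1.trans h2.symm) h)] at h1
      refine h1.trans ?_
      have h2 : Nn ≤ (Ideal.absNorm (Ideal.span {conicDisc c P.1}) : ℝ) := by
        rw [hNn]; exact_mod_cast hmin P hP
      gcongr
    have hcard : (s'.card : ℝ) = ∑ a ∈ s'.image Prod.fst,
        ((s'.filter fun P => P.1 = a).card : ℝ) := by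
      rw [← Nat.cast_sum, ← Finset.card_eq_sum_card_image]
    have hfin : (1 + Nn / T P₀.1 ^ (2 * d)) * (1 + B / √Nn) ≤ (2 + 2 * K ^ d) * B := by
      have ht : 1 ≤ T P₀.1 ^ (2 * d) := one_le_pow₀ hT₁
      generalize T P₀.1 ^ (2 * d) = t at ht hTB₀ hNT ⊢
      have ht0 : 0 < t := by linarith
      have hr1 : 1 ≤ √Nn := Real.one_le_sqrt.mpr hN1
      have hr2 : √Nn ^ 2 = Nn := Real.sq_sqrt (by linarith)
      have hr3 : √Nn ≤ K ^ d * t := by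
        rw [Real.sqrt_le_left (by positivity), mul_pow]
        refine hNT.trans ?_
        gcongr
        exact le_self_pow₀ hKd two_ne_zero
      have hr0 : 0 < √Nn := by linarith
      have e1 : Nn / t ≤ K ^ d * t := by
        rw [div_le_iff₀ ht0]; linarith
      have e2 : B / √Nn ≤ B := div_le_self hB0.le hr1
      have e3 : Nn / t * (B / √Nn) = √Nn * B / t := by
        nth_rewrite 1 [← hr2]; field_simp
      have e4 : √Nn * B / t ≤ K ^ d * B := by
        rw [div_le_iff₀ ht0]; nlinarith
      have e5 : K ^ d * t ≤ K ^ d * B := by gcongr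
      calc (1 + Nn / t) * (1 + B / √Nn) = 1 + Nn / t + B / √Nn + Nn / t * (B / √Nn) := by ring
        _ ≤ _ := by rw [e3]; linarith
    calc (s'.card : ℝ) ≤ ∑ a ∈ s'.image Prod.fst, C₂ * B ^ (ε / 2) * (1 + B / √Nn) := by
          rw [hcard]; exact Finset.sum_le_sum hfib
      _ = ((s'.image Prod.fst).card : ℝ) * (C₂ * B ^ (ε / 2) * (1 + B / √Nn)) := by
          rw [Finset.sum_const, nsmul_eq_mul]
      _ ≤ C₁ * (1 + Nn / T P₀.1 ^ (2 * d)) * (C₂ * B ^ (ε / 2) * (1 + B / √Nn)) := by gcongr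
      _ = C₁ * C₂ * B ^ (ε / 2) * ((1 + Nn / T P₀.1 ^ (2 * d)) * (1 + B / √Nn)) := by ring
      _ ≤ C₁ * C₂ * B ^ (ε / 2) * ((2 + 2 * K ^ d) * B) := by gcongr
      _ = _ := by rw [add_comm 1, Real.rpow_add_one hB0.ne']; ring
  calc (s.card : ℝ) = ∑ l : Option (InfinitePlace k) → Fin n,
        ((s.filter fun P => L P.1 = l).card : ℝ) := by
        rw [← Nat.cast_sum, ← Finset.card_eq_sum_card_fiberwise (fun P _ => Finset.mem_univ _)]
    _ ≤ ∑ l : Option (InfinitePlace k) → Fin n,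
        C₁ * (C₂ * (2 + 2 * K ^ d)) * B ^ (1 + ε / 2) := Finset.sum_le_sum hlabel
    _ = (n : ℝ) ^ Fintype.card (Option (InfinitePlace k)) *
        (C₁ * (C₂ * (2 + 2 * K ^ d)) * B ^ (1 + ε / 2)) := by
        rw [Finset.sum_const, nsmul_eq_mul, Finset.card_univ, Fintype.card_fun, Fintype.card_fin]
        push_cast; rfl
    _ ≤ C₃ * B ^ (ε / 2) * (C₁ * (C₂ * (2 + 2 * K ^ d)) * B ^ (1 + ε / 2)) := by
        gcongr
        refine le_trans ?_ (H₃ B hB)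
        gcongr
    _ = _ := by
        have h : B ^ (1 + ε) = B ^ (ε / 2) * B ^ (1 + ε / 2) := by
          rw [← Real.rpow_add hB0]; ring_nf
        rw [h]; ring

end MainCount

section Nonsingular

/-- The gradient of a binary quadratic form. -/
def binGrad {R : Type*} [CommRing R] (c : Fin 3 → R) (a : Fin 2 → R) : Fin 2 → R :=
  ![2 * c 0 * a 0 + c 1 * a 1, c 1 * a 0 + 2 * c 2 * a 1]

/-- The form of bidegree `(2, 2)` with coefficients `c` defines a non-singular curve. -/
def IsNonsingularForm {K : Type*} [Field K] (c : Fin 3 → Fin 3 → K) : Prop :=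
  ∀ a b : Fin 2 → K, a ≠ 0 → b ≠ 0 → binGrad (conicCoeff c a) b = 0 →
    binGrad (conicCoeff (fun i j => c j i) b) a ≠ 0

theorem IsNonsingularForm.swap {K : Type*} [Field K] {c : Fin 3 → Fin 3 → K}
    (h : IsNonsingularForm c) : IsNonsingularForm fun i j => c j i :=
  fun a b ha hb h1 h2 => h b a hb ha h2 h1

theorem exists_binQuad_eq_zero {K : Type*} [Field K] [IsAlgClosed K] (h2 : (2 : K) ≠ 0)
    (g : Fin 3 → K) : ∃ b : Fin 2 → K, b ≠ 0 ∧ binQuad g b = 0 := by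
  by_cases h0 : g 0 = 0
  · exact ⟨![1, 0], fun h => one_ne_zero (congrFun h 0), by simp [binQuad, h0]⟩
  · obtain ⟨ρ, hρ⟩ := IsAlgClosed.exists_pow_nat_eq (qdisc (g 0) (g 1) (g 2)) two_pos
    refine ⟨![-g 1 + ρ, 2 * g 0], fun h => mul_ne_zero h2 h0 (congrFun h 1), ?_⟩
    simp only [qdisc, binQuad, Matrix.cons_val_zero, Matrix.cons_val_one] at hρ ⊢
    linear_combination g 0 * hρ

theorem exists_binGrad_eq_zero {K : Type*} [Field K] [IsAlgClosed K] (h2 : (2 : K) ≠ 0)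
    {g g' : Fin 3 → K} (h : qdisc (g 0) (g 1) (g 2) = 0)
    (h' : 2 * g 1 * g' 1 - 4 * g' 0 * g 2 - 4 * g 0 * g' 2 = 0) :
    ∃ b : Fin 2 → K, b ≠ 0 ∧ binGrad g b = 0 ∧ binQuad g' b = 0 := by
  simp only [qdisc] at h
  by_cases h1 : (![g 1, -2 * g 0] : Fin 2 → K) = 0
  · have e1 : g 1 = 0 := congrFun h1 0
    have e0 : g 0 = 0 := by
      have : -2 * g 0 = 0 := congrFun h1 1
      simpa [h2] using this
    by_cases h3 : g 2 = 0
    · obtain ⟨b, hb, hb'⟩ := exists_binQuad_eq_zero h2 g'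
      exact ⟨b, hb, by ext i; fin_cases i <;> simp [binGrad, e0, e1, h3], hb'⟩
    · have e0' : g' 0 = 0 := by
        have h4 : (4 : K) ≠ 0 := by
          rw [show (4 : K) = 2 * 2 by norm_num]; exact mul_ne_zero h2 h2
        have : 4 * g' 0 * g 2 = 0 := by linear_combination -h' + 2 * g' 1 * e1 - 4 * g' 2 * e0
        simpa [h3, h4] using this
      refine ⟨![1, 0], fun h => one_ne_zero (congrFun h 0), ?_, by simp [binQuad, e0']⟩
      ext i; fin_cases i <;> simp [binGrad, e0, e1]
  · refine ⟨_, h1, ?_, ?_⟩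
    · ext i; fin_cases i
      · simp [binGrad]; ring
      · simp [binGrad]; linear_combination h
    · simp only [binQuad, Matrix.cons_val_zero, Matrix.cons_val_one]
      linear_combination g' 0 * h - g 0 * h'

theorem IsNonsingularForm.ne_zero_fst {K : Type*} [Field K] [IsAlgClosed K] (h2 : (2 : K) ≠ 0)
    {c : Fin 3 → Fin 3 → K} (h : IsNonsingularForm c) {s : K} (hs : conicDisc c ![1, s] = 0) :
    2 * conicCoeff c ![1, s] 1 * (c 1 1 + 2 * c 2 1 * s) -
      4 * (c 1 0 + 2 * c 2 0 * s) * conicCoeff c ![1, s] 2 -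
      4 * conicCoeff c ![1, s] 0 * (c 1 2 + 2 * c 2 2 * s) ≠ 0 := by
  intro h'
  obtain ⟨b, hb, hb1, hb2⟩ := exists_binGrad_eq_zero h2
    (g' := fun j => c 1 j + 2 * c 2 j * s) hs h'
  refine h ![1, s] b (fun h => one_ne_zero (congrFun h 0)) hb hb1 ?_
  have e0 := congrFun hb1 0
  have e1 := congrFun hb1 1
  simp only [binGrad, binQuad, conicCoeff, Matrix.cons_val_zero, Matrix.cons_val_one,
    Pi.zero_apply] at e0 e1 hb2 ⊢
  have hx : 2 * ((c 0 0 * b 0 ^ 2 + c 0 1 * b 0 * b 1 + c 0 2 * b 1 ^ 2) * 1) +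
      (c 1 0 * b 0 ^ 2 + c 1 1 * b 0 * b 1 + c 1 2 * b 1 ^ 2) * s = 0 := by
    linear_combination b 0 * e0 + b 1 * e1 - s * hb2
  ext i
  fin_cases i
  · simpa [mul_assoc] using hx
  · simp
    linear_combination hb2

theorem IsNonsingularForm.ne_zero_snd {K : Type*} [Field K] [IsAlgClosed K] (h2 : (2 : K) ≠ 0)
    {c : Fin 3 → Fin 3 → K} (h : IsNonsingularForm c) {s : K} (hs : conicDisc c ![s, 1] = 0) :
    2 * conicCoeff c ![s, 1] 1 * (2 * c 0 1 * s + c 1 1) -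
      4 * (2 * c 0 0 * s + c 1 0) * conicCoeff c ![s, 1] 2 -
      4 * conicCoeff c ![s, 1] 0 * (2 * c 0 2 * s + c 1 2) ≠ 0 := by
  intro h'
  obtain ⟨b, hb, hb1, hb2⟩ := exists_binGrad_eq_zero h2
    (g' := fun j => 2 * c 0 j * s + c 1 j) hs h'
  refine h ![s, 1] b (fun h => one_ne_zero (congrFun h 1)) hb hb1 ?_
  have e0 := congrFun hb1 0
  have e1 := congrFun hb1 1
  simp only [binGrad, binQuad, conicCoeff, Matrix.cons_val_zero, Matrix.cons_val_one,
    Pi.zero_apply] at e0 e1 hb2 ⊢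
  have hx : (c 1 0 * b 0 ^ 2 + c 1 1 * b 0 * b 1 + c 1 2 * b 1 ^ 2) * s +
      2 * (c 2 0 * b 0 ^ 2 + c 2 1 * b 0 * b 1 + c 2 2 * b 1 ^ 2) * 1 = 0 := by
    linear_combination b 0 * e0 + b 1 * e1 - s * hb2
  ext i
  fin_cases i
  · simp
    linear_combination hb2
  · simpa [mul_assoc] using hx

open Polynomial in
theorem IsNonsingularForm.isCoprime {k : Type*} [Field k] [CharZero k] {c : Fin 3 → Fin 3 → k}
    (h : IsNonsingularForm fun i j => algebraMap k (AlgebraicClosure k) (c i j)) :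
    IsCoprime (conicDisc (fun i j => C (c i j)) ![1, X])
      (derivative (conicDisc (fun i j => C (c i j)) ![1, X])) ∧
    IsCoprime (conicDisc (fun i j => C (c i j)) ![X, 1])
      (derivative (conicDisc (fun i j => C (c i j)) ![X, 1])) := by
  have h2 : (2 : AlgebraicClosure k) ≠ 0 := by
    have : CharZero (AlgebraicClosure k) := algebraRat.charZero _
    exact two_ne_zero
  constructor
  · rw [Polynomial.isCoprime_iff_aeval_ne_zero_of_isAlgClosed k (AlgebraicClosure k)]
    intro s
    by_contra! hs
    obtain ⟨h0, h1⟩ := hs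
    refine h.ne_zero_fst h2 (s := s) ?_ ?_
    · rw [← h0]
      simp [conicDisc, qdisc, conicCoeff, binQuad, map_ofNat]
    · rw [← h1]
      simp [conicDisc, qdisc, conicCoeff, binQuad, map_ofNat, derivative_pow]
      ring
  · rw [Polynomial.isCoprime_iff_aeval_ne_zero_of_isAlgClosed k (AlgebraicClosure k)]
    intro s
    by_contra! hs
    obtain ⟨h0, h1⟩ := hs
    refine h.ne_zero_snd h2 (s := s) ?_ ?_
    · rw [← h0]
      simp [conicDisc, qdisc, conicCoeff, binQuad, map_ofNat]
    · rw [← h1]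
      simp [conicDisc, qdisc, conicCoeff, binQuad, map_ofNat, derivative_pow]
      ring

open Polynomial in
theorem exists_mul_eval_div_isInteger {k : Type*} [Field k] [NumberField k] (u : k[X]) :
    ∃ m : 𝓞 k, m ≠ 0 ∧ ∀ n, u.natDegree ≤ n → ∀ x y : 𝓞 k, y ≠ 0 →
      ∃ z : 𝓞 k, (z : k) = m * (y : k) ^ n * u.eval ((x : k) / y) := by
  obtain ⟨m, hm⟩ := IsLocalization.exist_integer_multiples_of_finset (nonZeroDivisors (𝓞 k)) u.coeffs
  have hm' : ∀ i, ∃ z : 𝓞 k, (z : k) = (m : 𝓞 k) * u.coeff i := by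
    intro i
    by_cases hi : u.coeff i = 0
    · exact ⟨0, by simp [hi]⟩
    · obtain ⟨z, hz⟩ := hm _ (coeff_mem_coeffs hi)
      exact ⟨z, hz.trans (Algebra.smul_def _ _)⟩
  choose f hf using hm'
  refine ⟨m, nonZeroDivisors.coe_ne_zero m, fun n hn x y hy => ?_⟩
  have hy' : (y : k) ≠ 0 := RingOfIntegers.coe_ne_zero_iff.mpr hy
  refine ⟨∑ i ∈ Finset.range (n + 1), f i * x ^ i * y ^ (n - i), ?_⟩
  rw [eval_eq_sum_range' (Nat.lt_succ_of_le hn), Finset.mul_sum]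
  refine (map_sum (algebraMap (𝓞 k) k) _ _).trans (Finset.sum_congr rfl fun i hi => ?_)
  have hin : i ≤ n := Nat.lt_succ_iff.mp (Finset.mem_range.mp hi)
  have e : ((f i * x ^ i * y ^ (n - i) : 𝓞 k) : k) =
      (f i : k) * (x : k) ^ i * (y : k) ^ (n - i) := by simp
  have e' : (y : k) ^ n = (y : k) ^ (n - i) * (y : k) ^ i := by
    rw [← pow_add, Nat.sub_add_cancel hin]
  refine e.trans ?_
  rw [hf, div_pow, e']
  field_simp

theorem exists_mul_pow_mem_span {k : Type*} [Field k] [NumberField k] {c : Fin 3 → Fin 3 → 𝓞 k}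
    {u : Fin 3 → Polynomial k} (i : Fin 2)
    (h : ∀ a : Fin 2 → 𝓞 k, a i ≠ 0 → ∑ j, (u j).eval ((a (1 - i) : k) / a i) *
      ((conicCoeff c a j : 𝓞 k) : k) = (a i : k) ^ 2) :
    ∃ (m : 𝓞 k) (N : ℕ), m ≠ 0 ∧ ∀ a : Fin 2 → 𝓞 k,
      m * a i ^ N ∈ Ideal.span {conicCoeff c a 0, conicCoeff c a 1, conicCoeff c a 2} := by
  choose m hm hm' using fun j => exists_mul_eval_div_isInteger (u j)
  set n := ∑ j, (u j).natDegree with hn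
  refine ⟨∏ j, m j, n + 2, Finset.prod_ne_zero_iff.mpr fun j _ => hm j, fun a => ?_⟩
  by_cases ha : a i = 0
  · simp [ha]
  · have hd : ∀ j, (u j).natDegree ≤ n := fun j =>
      Finset.single_le_sum (f := fun j => (u j).natDegree) (fun _ _ => Nat.zero_le _)
        (Finset.mem_univ j)
    choose z hz using fun j => hm' j n (hd j) (a (1 - i)) (a i) ha
    have : (∏ j, m j) * a i ^ (n + 2) = (z 0 * m 1 * m 2) * conicCoeff c a 0 +
        ((z 1 * m 0 * m 2) * conicCoeff c a 1 + (z 2 * m 0 * m 1) * conicCoeff c a 2) := by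
      apply RingOfIntegers.coe_injective
      have h1 := h a ha
      rw [Fin.sum_univ_three] at h1
      rw [Fin.prod_univ_three]
      simp only [map_mul, map_add, map_pow, hz]
      rw [pow_add, ← h1]
      ring
    rw [this]
    refine Ideal.add_mem _ (Ideal.mul_mem_left _ _ (Ideal.subset_span (by simp)))
      (Ideal.add_mem _ (Ideal.mul_mem_left _ _ (Ideal.subset_span (by simp)))
        (Ideal.mul_mem_left _ _ (Ideal.subset_span (by simp))))

open Polynomial in
theorem exists_bezout_conicCoeff {R : Type*} [CommRing R] {c : Fin 3 → Fin 3 → R[X]}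
    {a : Fin 2 → R[X]}
    (h : IsCoprime (conicDisc c a) (derivative (conicDisc c a))) :
    ∃ u : Fin 3 → R[X], ∑ j, u j * conicCoeff c a j = 1 := by
  obtain ⟨p, q, hpq⟩ := h
  refine ⟨![-4 * p * conicCoeff c a 2 - 4 * q * derivative (conicCoeff c a 2),
    p * conicCoeff c a 1 + 2 * q * derivative (conicCoeff c a 1),
    -4 * q * derivative (conicCoeff c a 0)], ?_⟩
  rw [← hpq, Fin.sum_univ_three, conicDisc, qdisc]
  simp [derivative_pow, map_ofNat]
  ring

open Polynomial in
theorem IsNonsingularForm.isSmoothFibration {k : Type*} [Field k] [NumberField k]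
    {c : Fin 3 → Fin 3 → 𝓞 k}
    (h : IsNonsingularForm fun i j => algebraMap k (AlgebraicClosure k) (c i j)) :
    IsSmoothFibration c := by
  obtain ⟨h1, h2⟩ := h.isCoprime (c := fun i j => (c i j : k))
  constructor
  · obtain ⟨u, hu⟩ := exists_bezout_conicCoeff h1
    obtain ⟨v, hv⟩ := exists_bezout_conicCoeff h2
    obtain ⟨m, N, hm, hN⟩ := exists_mul_pow_mem_span (c := c) (u := u) 0 (by
      intro a ha
      have ha' : (a 0 : k) ≠ 0 := RingOfIntegers.coe_ne_zero_iff.mpr ha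
      have := congrArg (fun p => (a 0 : k) ^ 2 * p.eval ((a 1 : k) / a 0)) hu
      simp [Fin.sum_univ_three, conicCoeff, binQuad] at this ⊢
      refine Eq.trans ?_ this
      field_simp)
    obtain ⟨m', N', hm', hN'⟩ := exists_mul_pow_mem_span (c := c) (u := v) 1 (by
      intro a ha
      have ha' : (a 1 : k) ≠ 0 := RingOfIntegers.coe_ne_zero_iff.mpr ha
      have := congrArg (fun p => (a 1 : k) ^ 2 * p.eval ((a 0 : k) / a 1)) hv
      simp [Fin.sum_univ_three, conicCoeff, binQuad] at this ⊢
      refine Eq.trans ?_ this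
      field_simp)
    refine ⟨m * m', N + N', mul_ne_zero hm hm', fun a i => ?_⟩
    fin_cases i
    · have := Ideal.mul_mem_left _ (m' * a 0 ^ N') (hN a)
      convert this using 1
      simp only [Fin.zero_eta]; ring
    · have := Ideal.mul_mem_left _ (m * a 1 ^ N) (hN' a)
      convert this using 1
      simp only [Fin.mk_one]; ring
  · intro w
    have key : ∀ a : Fin 2 → k[X], IsCoprime (conicDisc (fun i j => C (c i j : k)) a)
        (derivative (conicDisc (fun i j => C (c i j : k)) a)) →
        ∃ (Z : Finset ℂ) (D : ℝ), 0 < D ∧ ∀ s : ℂ, ‖s‖ ≤ 1 → ∃ r ∈ Z, ‖s - r‖ ≤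
          D * ‖conicDisc (fun i j => w.embedding (c i j : k))
            (fun i => ((a i).map w.embedding).eval s)‖ := by
      intro a ha
      have := ha.map (mapRingHom w.embedding)
      rw [coe_mapRingHom, ← derivative_map] at this
      obtain ⟨Z, D, hD, H⟩ := exists_near_root this
      refine ⟨Z, D, hD, fun s hs => ?_⟩
      obtain ⟨r, hr, h⟩ := H s hs
      refine ⟨r, hr, h.trans_eq ?_⟩
      rw [← coe_mapRingHom, map_conicDisc, ← coe_evalRingHom, map_conicDisc]
      simp
    obtain ⟨Z, D, hD, H⟩ := key _ h1
    obtain ⟨Z', D', hD', H'⟩ := key _ h2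
    classical
    refine ⟨Z ∪ Z', D + D', by positivity, fun s hs => ⟨?_, ?_⟩⟩
    · obtain ⟨r, hr, h⟩ := H s hs
      refine ⟨r, Finset.mem_union_left _ hr, h.trans ?_⟩
      rw [show (fun i => ((![1, X] i : k[X]).map w.embedding).eval s) = ![1, s] by
        ext i; fin_cases i <;> simp]
      gcongr; linarith
    · obtain ⟨r, hr, h⟩ := H' s hs
      refine ⟨r, Finset.mem_union_right _ hr, h.trans ?_⟩
      rw [show (fun i => ((![X, 1] i : k[X]).map w.embedding).eval s) = ![s, 1] by
        ext i; fin_cases i <;> simp]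
      gcongr; linarith

end Nonsingular

section Height

variable {k : Type*} [Field k] [NumberField k]

theorem le_ciSup_place {k : Type*} [Field k] {m : ℕ} (y : Fin m → 𝓞 k) (w : InfinitePlace k)
    (i : Fin m) :
    w (y i : k) ≤ ⨆ i, w (y i : k) :=
  le_ciSup (f := fun i => w (y i : k)) (Set.finite_range _).bddAbove i

theorem ciSup_place_nonneg {k : Type*} [Field k] {m : ℕ} (y : Fin m → 𝓞 k) (w : InfinitePlace k) :
    0 ≤ ⨆ i, w (y i : k) :=
  Real.iSup_nonneg fun _ => apply_nonneg w _

theorem ciSup_place_pos {k : Type*} [Field k] {m : ℕ} {y : Fin m → 𝓞 k} (hy : y ≠ 0)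
    (w : InfinitePlace k) :
    0 < ⨆ i, w (y i : k) := by
  obtain ⟨i, hi⟩ := Function.ne_iff.mp hy
  exact (w.pos_iff.mpr (RingOfIntegers.coe_ne_zero_iff.mpr hi)).trans_le (le_ciSup_place y w i)

theorem heightFn_eq {m : ℕ} [NeZero m] (y : Fin m → 𝓞 k) :
    heightFn y = (Ideal.absNorm (Ideal.span (Set.range y)) : ℝ)⁻¹ *
      ∏ w : InfinitePlace k, (⨆ i, w (y i : k)) ^ w.mult := by
  unfold heightFn plNorm
  congr 1
  refine Finset.prod_congr rfl fun w _ => le_antisymm ?_ ?_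
  · refine ciSup_le fun i => ?_
    have := le_ciSup_place y w i
    gcongr
  · obtain ⟨i, hi⟩ := exists_eq_ciSup_of_finite (f := fun i => w (y i : k))
    rw [← hi]
    exact le_ciSup (f := fun i => w (y i : k) ^ w.mult) (Set.finite_range _).bddAbove i

theorem one_le_absNorm_span_range {m : ℕ} {y : Fin m → 𝓞 k} (hy : y ≠ 0) :
    (1 : ℝ) ≤ Ideal.absNorm (Ideal.span (Set.range y)) := by
  rw [Nat.one_le_cast, Nat.one_le_iff_ne_zero, Ne, Ideal.absNorm_eq_zero_iff, Ideal.span_eq_bot]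
  intro h
  exact hy (funext fun i => h _ ⟨i, rfl⟩)

theorem absNorm_le_prod_ciSup {m : ℕ} {y : Fin m → 𝓞 k} (hy : y ≠ 0) :
    (Ideal.absNorm (Ideal.span (Set.range y)) : ℝ) ≤
      ∏ w : InfinitePlace k, (⨆ i, w (y i : k)) ^ w.mult := by
  obtain ⟨i, hi⟩ := Function.ne_iff.mp hy
  refine le_trans ?_ (absNorm_span_singleton_le fun w => le_ciSup_place y w i)
  rw [Nat.cast_le]
  refine Nat.le_of_dvd ?_ (Ideal.absNorm_dvd_absNorm_of_le ?_)
  · exact_mod_cast one_le_absNorm_span_singleton hi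
  · exact Ideal.span_mono (by simp)

theorem one_le_heightFn {m : ℕ} [NeZero m] {y : Fin m → 𝓞 k} (hy : y ≠ 0) : 1 ≤ heightFn y := by
  have h1 := one_le_absNorm_span_range hy
  rw [heightFn_eq, inv_mul_eq_div, one_le_div (by linarith)]
  exact absNorm_le_prod_ciSup hy

theorem ciSup_place_smul {k : Type*} [Field k] {m : ℕ} [NeZero m] (x : 𝓞 k) (y : Fin m → 𝓞 k)
    (w : InfinitePlace k) :
    ⨆ i, w ((x * y i : 𝓞 k) : k) = w (x : k) * ⨆ i, w (y i : k) := by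
  rw [Real.mul_iSup_of_nonneg (apply_nonneg w _)]
  simp

theorem span_range_mul {k : Type*} [Field k] {m : ℕ} (x : 𝓞 k) (y : Fin m → 𝓞 k) :
    Ideal.span (Set.range fun i => x * y i) = Ideal.span {x} * Ideal.span (Set.range y) := by
  rw [Ideal.span_mul_span']
  congr 1
  ext z
  simp

theorem heightFn_smul {m : ℕ} [NeZero m] {x : 𝓞 k} (hx : x ≠ 0) (y : Fin m → 𝓞 k) :
    heightFn (fun i => x * y i) = heightFn y := by
  rw [heightFn_eq, heightFn_eq, span_range_mul, map_mul, Nat.cast_mul]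
  simp_rw [ciSup_place_smul, mul_pow]
  rw [Finset.prod_mul_distrib, ← absNorm_span_singleton_eq_prod]
  have := one_le_absNorm_span_singleton hx
  field_simp

theorem heightFn_eq_of_mul_eq {a b : Fin 2 → 𝓞 k} (ha : a ≠ 0) (hb : b ≠ 0)
    (h : a 0 * b 1 = b 0 * a 1) : heightFn a = heightFn b := by
  obtain ⟨i, hi⟩ := Function.ne_iff.mp ha
  have hbi : b i ≠ 0 := by
    intro h0
    refine hb (funext fun j => ?_)
    fin_cases i <;> fin_cases j <;> simp_all
  rw [← heightFn_smul hi b, ← heightFn_smul hbi a]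
  have h' : ∀ i j, a i * b j = b i * a j := by
    intro i j
    fin_cases i <;> fin_cases j <;>
      simp only [Fin.zero_eta, Fin.mk_one, Fin.isValue] <;>
      first | linear_combination h | linear_combination -h | ring
  exact congrArg _ (funext fun j => (h' i j).symm)

theorem ciSup_place_le_sum_mul {k : Type*} [Field k] {m n : ℕ} [NeZero n]
    (Λ : Matrix (Fin n) (Fin m) (𝓞 k)) (y : Fin m → 𝓞 k)
    (w : InfinitePlace k) :
    ⨆ j, w ((Λ.mulVec y j : 𝓞 k) : k) ≤
      (1 + ∑ j, ∑ i, w (Λ j i : k)) * ⨆ i, w (y i : k) := by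
  refine ciSup_le fun j => ?_
  have h0 := ciSup_place_nonneg y w
  have : ((Λ.mulVec y j : 𝓞 k) : k) = ∑ i, (Λ j i : k) * (y i : k) := by
    simp only [Matrix.mulVec, dotProduct]
    refine (map_sum (algebraMap (𝓞 k) k) _ _).trans ?_
    simp
  rw [this]
  calc w (∑ i, (Λ j i : k) * (y i : k)) ≤ ∑ i, w ((Λ j i : k) * (y i : k)) := by
        exact w.1.sum_le _ _
    _ ≤ ∑ i, w (Λ j i : k) * ⨆ i, w (y i : k) := by
        gcongr with i
        rw [map_mul]
        gcongr
        exact le_ciSup_place y w i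
    _ = (∑ i, w (Λ j i : k)) * ⨆ i, w (y i : k) := by rw [Finset.sum_mul]
    _ ≤ _ := by
        gcongr
        have := Finset.single_le_sum (f := fun j => ∑ i, w (Λ j i : k))
          (fun j _ => Finset.sum_nonneg fun i _ => apply_nonneg w _) (Finset.mem_univ j)
        beta_reduce at this
        linarith

theorem exists_heightFn_mulVec_le {m n : ℕ} [NeZero m] [NeZero n]
    (Λ : Matrix (Fin n) (Fin m) (𝓞 k)) :
    ∃ C > 0, ∀ y : Fin m → 𝓞 k, Λ.mulVec y ≠ 0 → heightFn (Λ.mulVec y) ≤ C * heightFn y := by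
  have hpos : ∀ w : InfinitePlace k, 0 < 1 + ∑ j, ∑ i, w (Λ j i : k) := fun w =>
    add_pos_of_pos_of_nonneg one_pos
      (Finset.sum_nonneg fun j _ => Finset.sum_nonneg fun i _ => apply_nonneg w _)
  refine ⟨∏ w : InfinitePlace k, (1 + ∑ j, ∑ i, w (Λ j i : k)) ^ w.mult,
    Finset.prod_pos fun w _ => pow_pos (hpos w) _, fun y hy => ?_⟩
  have hy0 : y ≠ 0 := by
    rintro rfl
    simp at hy
  have h1 := one_le_absNorm_span_range hy
  have h2 := one_le_absNorm_span_range hy0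
  have hN : (Ideal.absNorm (Ideal.span (Set.range y)) : ℝ) ≤
      Ideal.absNorm (Ideal.span (Set.range (Λ.mulVec y))) := by
    rw [Nat.cast_le]
    refine Nat.le_of_dvd ?_ (Ideal.absNorm_dvd_absNorm_of_le ?_)
    · exact_mod_cast h1
    · rw [Ideal.span_le]
      rintro _ ⟨j, rfl⟩
      have : ∑ i, Λ j i * y i ∈ Ideal.span (Set.range y) := Ideal.sum_mem _ fun i _ =>
        Ideal.mul_mem_left _ _ (Ideal.subset_span (Set.mem_range_self i))
      exact this
  rw [heightFn_eq, heightFn_eq, mul_left_comm, ← Finset.prod_mul_distrib]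
  have hle : ∏ w : InfinitePlace k, (⨆ j, w ((Λ.mulVec y j : 𝓞 k) : k)) ^ w.mult ≤
      ∏ w : InfinitePlace k, (1 + ∑ j, ∑ i, w (Λ j i : k)) ^ w.mult *
        (⨆ i, w (y i : k)) ^ w.mult := by
    refine Finset.prod_le_prod (fun w _ => pow_nonneg (ciSup_place_nonneg _ w) _) fun w _ => ?_
    rw [← mul_pow]
    exact pow_le_pow_left₀ (ciSup_place_nonneg _ w) (ciSup_place_le_sum_mul Λ y w) _
  have h3 : 0 ≤ ∏ w : InfinitePlace k, (⨆ j, w ((Λ.mulVec y j : 𝓞 k) : k)) ^ w.mult :=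
    Finset.prod_nonneg fun w _ => pow_nonneg (ciSup_place_nonneg _ w) _
  gcongr

theorem ciSup_place_segre {k : Type*} [Field k] (a b : Fin 2 → 𝓞 k) (w : InfinitePlace k) :
    ⨆ i, w ((![a 0 * b 0, a 0 * b 1, a 1 * b 0, a 1 * b 1] : Fin 4 → 𝓞 k) i : k) =
      (⨆ i, w (a i : k)) * ⨆ i, w (b i : k) := by
  apply le_antisymm
  · refine ciSup_le fun i => ?_
    have ha := le_ciSup_place a w
    have hb := le_ciSup_place b w
    have := ciSup_place_nonneg a w
    fin_cases i <;> simp only [Fin.zero_eta, Fin.mk_one, Fin.reduceFinMk, Matrix.cons_val, map_mul] <;>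
      exact mul_le_mul (ha _) (hb _) (apply_nonneg w _) this
  · obtain ⟨i, hi⟩ := exists_eq_ciSup_of_finite (f := fun i => w (a i : k))
    obtain ⟨j, hj⟩ := exists_eq_ciSup_of_finite (f := fun i => w (b i : k))
    rw [← hi, ← hj, ← map_mul]
    have := le_ciSup_place (![a 0 * b 0, a 0 * b 1, a 1 * b 0, a 1 * b 1] : Fin 4 → 𝓞 k) w
    fin_cases i <;> fin_cases j
    · simpa using this 0
    · simpa using this 1
    · simpa using this 2
    · simpa using this 3

theorem heightFn_segre (a b : Fin 2 → 𝓞 k) :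
    heightFn ![a 0 * b 0, a 0 * b 1, a 1 * b 0, a 1 * b 1] = heightFn a * heightFn b := by
  have hspan : Ideal.span (Set.range ![a 0 * b 0, a 0 * b 1, a 1 * b 0, a 1 * b 1]) =
      Ideal.span (Set.range a) * Ideal.span (Set.range b) := by
    rw [Ideal.span_mul_span']
    congr 1
    ext z
    simp only [Set.mem_mul, Set.mem_range, Fin.exists_fin_succ]
    simp [or_assoc]
  rw [heightFn_eq, heightFn_eq a, heightFn_eq b, hspan, map_mul, Nat.cast_mul]
  simp_rw [ciSup_place_segre, mul_pow]
  rw [Finset.prod_mul_distrib, mul_inv]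
  ring

end Height

section Reduction

variable {k : Type*} [Field k] [NumberField k]

open NumberField.mixedEmbedding nonZeroDivisors in
theorem exists_mul_integral_lt (k : Type*) [Field k] [NumberField k] :
    ∃ c : ℝ, 1 ≤ c ∧ ∀ (J : Ideal (𝓞 k)), J ≠ ⊥ → ∀ f : InfinitePlace k → ℝ, (∀ w, 0 ≤ f w) →
      c ≤ Ideal.absNorm J * ∏ w, f w ^ w.mult →
      ∃ μ : k, μ ≠ 0 ∧ (∀ w : InfinitePlace k, w μ < f w) ∧
        ∀ x ∈ J, ∃ y : 𝓞 k, (y : k) = μ * x := by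
  classical
  set V := MeasureTheory.volume (ZSpan.fundamentalDomain (latticeBasis k)) *
    2 ^ Module.finrank ℝ (mixedSpace k) with hV
  have hVtop : V ≠ ⊤ := by
    refine (ENNReal.mul_lt_top (ZSpan.fundamentalDomain_isBounded _).measure_lt_top ?_).ne
    exact ENNReal.pow_lt_top ENNReal.ofNat_lt_top
  refine ⟨V.toReal + 1, by linarith [ENNReal.toReal_nonneg (a := V)], fun J hJ f hf hle => ?_⟩
  have hJ' : (J : FractionalIdeal (𝓞 k)⁰ k) ≠ 0 := by simpa using hJ
  have hN : (0 : ℝ) < Ideal.absNorm J := by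
    rw [Nat.cast_pos, Nat.pos_iff_ne_zero, Ne, Ideal.absNorm_eq_zero_iff]
    exact hJ
  set I : (FractionalIdeal (𝓞 k)⁰ k)ˣ := (Units.mk0 _ hJ')⁻¹ with hI
  have hInorm : ((FractionalIdeal.absNorm I.1 : ℚ) : ℝ) = (Ideal.absNorm J : ℝ)⁻¹ := by
    rw [hI, Units.val_inv_eq_inv_val, Units.val_mk0, map_inv₀, FractionalIdeal.coeIdeal_absNorm]
    push_cast
    rfl
  have key : minkowskiBound k I <
      MeasureTheory.volume (convexBodyLT k fun w => (f w).toNNReal) := by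
    rw [minkowskiBound, volume_fundamentalDomain_fractionalIdealLatticeBasis, convexBodyLT_volume,
      hInorm, mul_assoc, ← hV]
    calc ENNReal.ofReal (Ideal.absNorm J : ℝ)⁻¹ * V
        < ENNReal.ofReal (Ideal.absNorm J : ℝ)⁻¹ * ENNReal.ofReal (V.toReal + 1) := by
          rw [ENNReal.mul_lt_mul_iff_right (by simpa using Nat.cast_pos.mp hN |>.ne') ENNReal.ofReal_ne_top]
          rw [← ENNReal.ofReal_toReal hVtop, ENNReal.toReal_ofReal ENNReal.toReal_nonneg]
          exact (ENNReal.ofReal_lt_ofReal_iff (by positivity)).mpr (by linarith)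
      _ = ENNReal.ofReal ((Ideal.absNorm J : ℝ)⁻¹ * (V.toReal + 1)) := by
          rw [ENNReal.ofReal_mul (by positivity)]
      _ ≤ ENNReal.ofReal (∏ w, f w ^ w.mult) := by
          refine ENNReal.ofReal_le_ofReal ?_
          rw [inv_mul_le_iff₀ hN]
          exact hle
      _ = ((∏ w : InfinitePlace k, (f w).toNNReal ^ w.mult : NNReal) : ENNReal) := by
          rw [ENNReal.ofReal, ENNReal.coe_inj, Real.toNNReal_prod_of_nonneg]
          · simp_rw [fun w => Real.toNNReal_pow (hf w)]
          · exact fun w _ => pow_nonneg (hf w) _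
      _ ≤ _ := by
          have h1 : (1 : ENNReal) ≤ (convexBodyLTFactor k : ENNReal) := by
            exact_mod_cast one_le_convexBodyLTFactor k
          push_cast
          exact le_mul_of_one_le_left zero_le h1
  obtain ⟨μ, hμ, hμ0, hμf⟩ := exists_ne_zero_mem_ideal_lt k I key
  refine ⟨μ, hμ0, fun w => by simpa [hf w] using hμf w, fun x hx => ?_⟩
  rw [hI, Units.val_inv_eq_inv_val, Units.val_mk0, FractionalIdeal.mem_inv_iff hJ'] at hμ
  obtain ⟨y, hy⟩ := (FractionalIdeal.mem_one_iff _).mp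
    (hμ x (FractionalIdeal.mem_coeIdeal_of_mem _ hx))
  exact ⟨y, hy⟩

theorem prod_le_pow_mul_of_le {d : InfinitePlace k → ℝ} {T : ℝ} (hd : ∀ w, 0 < d w)
    (hT : ∀ w, d w ≤ T) (w : InfinitePlace k) :
    T * ∏ v, d v ^ v.mult ≤ d w * T ^ Module.finrank ℚ k := by
  classical
  have hT0 : 0 < T := (hd w).trans_le (hT w)
  rw [← InfinitePlace.sum_mult_eq, ← Finset.prod_pow_eq_pow_sum,
    ← Finset.mul_prod_erase _ _ (Finset.mem_univ w),
    ← Finset.mul_prod_erase _ (fun v : InfinitePlace k => T ^ v.mult) (Finset.mem_univ w)]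
  have h1 : ∏ v ∈ Finset.univ.erase w, d v ^ v.mult ≤ ∏ v ∈ Finset.univ.erase w, T ^ v.mult :=
    Finset.prod_le_prod (fun v _ => pow_nonneg (hd v).le _)
      fun v _ => pow_le_pow_left₀ (hd v).le (hT v) _
  have h2 : T * d w ^ w.mult ≤ d w * T ^ w.mult := by
    obtain ⟨n, hn⟩ := Nat.exists_eq_succ_of_ne_zero (InfinitePlace.mult_pos (w := w)).ne'
    rw [hn, pow_succ', pow_succ']
    have := pow_le_pow_left₀ (hd w).le (hT w) n
    nlinarith [mul_pos hT0 (hd w)]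
  have h3 : 0 ≤ ∏ v ∈ Finset.univ.erase w, d v ^ v.mult :=
    Finset.prod_nonneg fun v _ => pow_nonneg (hd v).le _
  rw [← mul_assoc, ← mul_assoc]
  exact mul_le_mul h2 h1 h3 (mul_nonneg (hd w).le (pow_nonneg hT0.le _))

theorem exists_reduced_representative (k : Type*) [Field k] [NumberField k] :
    ∃ c : ℝ, 1 ≤ c ∧ ∀ a : Fin 2 → 𝓞 k, a ≠ 0 → ∃ a' : Fin 2 → 𝓞 k, a' ≠ 0 ∧
      a 0 * a' 1 = a' 0 * a 1 ∧ (Ideal.absNorm (Ideal.span (Set.range a')) : ℝ) ≤ c ∧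
      ∀ T : ℝ, 0 ≤ T → T ^ Module.finrank ℚ k = c * heightFn a →
        ∀ w : InfinitePlace k, (∀ i, w (a' i : k) ≤ T) ∧ ∃ i, T ≤ c * w (a' i : k) := by
  obtain ⟨c, hc1, hc⟩ := exists_mul_integral_lt k
  refine ⟨c, hc1, fun a ha => ?_⟩
  have hd : Module.finrank ℚ k ≠ 0 := Module.finrank_pos.ne'
  set H := heightFn a with hH
  have hH1 : 1 ≤ H := one_le_heightFn ha
  obtain ⟨T, hT0, hT⟩ : ∃ T : ℝ, 0 ≤ T ∧ T ^ Module.finrank ℚ k = c * H :=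
    ⟨(c * H) ^ ((Module.finrank ℚ k : ℝ)⁻¹), by positivity,
      Real.rpow_inv_natCast_pow (by positivity) hd⟩
  set M : InfinitePlace k → ℝ := fun w => ⨆ i, w (a i : k) with hM
  have hM0 : ∀ w, 0 < M w := ciSup_place_pos ha
  have hJ : Ideal.span (Set.range a) ≠ ⊥ := by
    rw [Ne, Ideal.span_eq_bot]
    exact fun h => ha (funext fun i => h _ ⟨i, rfl⟩)
  have hN1 := one_le_absNorm_span_range ha
  set N : ℝ := (Ideal.absNorm (Ideal.span (Set.range a)) : ℝ) with hN
  have hHeq : H = N⁻¹ * ∏ w, M w ^ w.mult := heightFn_eq a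
  have hprodM : 0 < ∏ w, M w ^ w.mult := Finset.prod_pos fun w _ => pow_pos (hM0 w) _
  have hTpos : 0 < T := by
    refine hT0.lt_of_ne fun h => ?_
    rw [← h, zero_pow hd] at hT
    nlinarith
  obtain ⟨μ, hμ0, hμ, hr_int⟩ := hc _ hJ (fun w => T / M w)
    (fun w => div_nonneg hT0 (hM0 w).le) (by
      simp_rw [div_pow]
      rw [Finset.prod_div_distrib, Finset.prod_pow_eq_pow_sum, InfinitePlace.sum_mult_eq, hT, hHeq]
      field_simp
      exact le_rfl)
  choose g hg using hr_int
  set a' : Fin 2 → 𝓞 k := fun i => g (a i) (Ideal.subset_span ⟨i, rfl⟩) with ha'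
  have haa : ∀ i, (a' i : k) = μ * a i := fun i => hg _ _
  have hmul : a 0 * a' 1 = a' 0 * a 1 := by
    apply RingOfIntegers.coe_injective
    have e : ∀ i, algebraMap (𝓞 k) k (a' i) = μ * algebraMap (𝓞 k) k (a i) := haa
    rw [map_mul, map_mul, e, e]
    ring
  have ha'0 : a' ≠ 0 := by
    obtain ⟨i, hi⟩ := Function.ne_iff.mp ha
    refine fun h => mul_ne_zero hμ0 (RingOfIntegers.coe_ne_zero_iff.mpr hi) ?_
    rw [← haa, h]
    simp
  have hsup : ∀ w : InfinitePlace k, ⨆ i, w (a' i : k) = w μ * M w := fun w => by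
    simp_rw [haa, map_mul]
    rw [← Real.mul_iSup_of_nonneg (apply_nonneg w _)]
  have hle : ∀ w : InfinitePlace k, ⨆ i, w (a' i : k) ≤ T := fun w => by
    rw [hsup, ← le_div_iff₀ (hM0 w)]
    exact (hμ w).le
  have hHa' : heightFn a' = H := (heightFn_eq_of_mul_eq ha ha'0 hmul).symm
  have hN'1 := one_le_absNorm_span_range ha'0
  set N' : ℝ := (Ideal.absNorm (Ideal.span (Set.range a')) : ℝ) with hN'
  have hprod : ∏ w : InfinitePlace k, (⨆ i, w (a' i : k)) ^ w.mult = N' * H := by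
    rw [← hHa', heightFn_eq, ← hN', mul_inv_cancel_left₀ (by linarith)]
  refine ⟨a', ha'0, hmul, ?_, fun T' hT'0 hT' w => ?_⟩
  · have h1 : N' * H ≤ c * H := by
      rw [← hprod, ← hT, ← InfinitePlace.sum_mult_eq, ← Finset.prod_pow_eq_pow_sum]
      exact Finset.prod_le_prod (fun w _ => pow_nonneg (ciSup_place_nonneg a' w) _)
        fun w _ => pow_le_pow_left₀ (ciSup_place_nonneg a' w) (hle w) _
    exact le_of_mul_le_mul_right h1 (by linarith)
  · obtain rfl : T' = T := (pow_left_inj₀ hT'0 hT0 hd).mp (hT'.trans hT.symm)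
    refine ⟨fun i => (le_ciSup_place a' w i).trans (hle w), ?_⟩
    obtain ⟨i, hi⟩ := exists_eq_ciSup_of_finite (f := fun i => w (a' i : k))
    refine ⟨i, ?_⟩
    have := prod_le_pow_mul_of_le (ciSup_place_pos ha'0) hle w
    rw [hprod, hT, ← hi] at this
    have h0 : 0 ≤ w (a' i : k) := apply_nonneg w _
    have h2 : T' * H ≤ (c * w (a' i : k)) * H := by
      have h3 : 0 ≤ T' * H * (N' - 1) :=
        mul_nonneg (mul_nonneg hT0 (by linarith)) (by linarith)
      linarith
    exact le_of_mul_le_mul_right h2 (by linarith)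

theorem exists_isReducedSystem (k : Type*) [Field k] [NumberField k] :
    ∃ (C₀ : ℝ) (S : Set (Fin 2 → 𝓞 k)) (T : (Fin 2 → 𝓞 k) → ℝ), 1 ≤ C₀ ∧
      IsReducedSystem S T C₀ ∧ (∀ a ∈ S, T a ^ Module.finrank ℚ k = C₀ * heightFn a) ∧
      ∀ a : Fin 2 → 𝓞 k, a ≠ 0 → ∃ a' ∈ S, a 0 * a' 1 = a' 0 * a 1 := by
  obtain ⟨c, hc1, hc⟩ := exists_reduced_representative k
  have hd : Module.finrank ℚ k ≠ 0 := Module.finrank_pos.ne'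
  have trans : ∀ a b e : Fin 2 → 𝓞 k, b ≠ 0 → a 0 * b 1 = b 0 * a 1 → b 0 * e 1 = e 0 * b 1 →
      a 0 * e 1 = e 0 * a 1 := by
    intro a b e hb h1 h2
    obtain ⟨i, hi⟩ := Function.ne_iff.mp hb
    refine mul_left_cancel₀ hi ?_
    fin_cases i <;> simp only [Fin.zero_eta, Fin.mk_one, Fin.isValue]
    · linear_combination a 0 * h2 + e 0 * h1
    · linear_combination a 1 * h2 + e 1 * h1
  let r : Setoid {a : Fin 2 → 𝓞 k // a ≠ 0} :=
    { r := fun a b => a.1 0 * b.1 1 = b.1 0 * a.1 1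
      iseqv := ⟨fun a => rfl, fun {a b} h => h.symm, fun {a b e} h1 h2 => trans _ _ _ b.2 h1 h2⟩ }
  choose! g hg0 hg hgN hgT using hc
  set T : (Fin 2 → 𝓞 k) → ℝ := fun a => (c * heightFn a) ^ ((Module.finrank ℚ k : ℝ)⁻¹) with hT
  have hTd : ∀ a : Fin 2 → 𝓞 k, a ≠ 0 → T a ^ Module.finrank ℚ k = c * heightFn a := fun a ha =>
    Real.rpow_inv_natCast_pow (by have := one_le_heightFn ha; positivity) hd
  have hTeq : ∀ a : Fin 2 → 𝓞 k, a ≠ 0 → T (g a) = T a := fun a ha => by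
    simp only [hT, heightFn_eq_of_mul_eq ha (hg0 a ha) (hg a ha)]
  have hT1 : ∀ a : Fin 2 → 𝓞 k, a ≠ 0 → 1 ≤ T a := fun a ha =>
    Real.one_le_rpow (by have := one_le_heightFn ha; nlinarith) (by positivity)
  refine ⟨c, Set.range fun q : Quotient r => g q.out.1, T, hc1, ?_, ?_, ?_⟩
  · refine ⟨?_, ?_, ?_, ?_, ?_, ?_⟩
    · rintro _ ⟨p, rfl⟩ _ ⟨q, rfl⟩ h
      beta_reduce at h ⊢
      suffices p = q by rw [this]
      rw [← Quotient.out_eq p, ← Quotient.out_eq q]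
      refine Quotient.sound ?_
      have h1 := hg _ p.out.2
      have h2 := hg _ q.out.2
      exact trans _ _ _ (hg0 _ q.out.2) (trans _ _ _ (hg0 _ p.out.2) h1 h) h2.symm
    · rintro _ ⟨p, rfl⟩
      exact hg0 _ p.out.2
    · rintro _ ⟨p, rfl⟩
      exact hT1 _ (hg0 _ p.out.2)
    · rintro _ ⟨p, rfl⟩ w
      beta_reduce
      rw [hTeq _ p.out.2]
      exact (hgT _ p.out.2 _ (zero_le_one.trans (hT1 _ p.out.2)) (hTd _ p.out.2) w).1
    · rintro _ ⟨p, rfl⟩ w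
      beta_reduce
      rw [hTeq _ p.out.2]
      exact (hgT _ p.out.2 _ (zero_le_one.trans (hT1 _ p.out.2)) (hTd _ p.out.2) w).2
    · rintro _ ⟨p, rfl⟩
      exact hgN _ p.out.2
  · rintro _ ⟨p, rfl⟩
    exact hTd _ (hg0 _ p.out.2)
  · intro a ha
    refine ⟨_, ⟨Quotient.mk r ⟨a, ha⟩, rfl⟩, ?_⟩
    beta_reduce
    set q := (Quotient.mk r ⟨a, ha⟩).out
    have h1 : q.1 0 * a 1 = a 0 * q.1 1 := Quotient.mk_out (s := r) ⟨a, ha⟩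
    exact trans _ _ _ q.2 h1.symm (hg _ q.2)

end Reduction

section QuadraticPairs

/-- The value at `x` of the quadratic form with matrix `S`. -/
def quadVal {R ι : Type*} [CommRing R] [Fintype ι] (S : Matrix ι ι R) (x : ι → R) : R :=
  x ⬝ᵥ S.mulVec x

/-- The projective scheme defined by two quadratic forms is a non-singular complete
intersection. -/
def IsSmoothPair {K V : Type*} [Field K] [AddCommGroup V] (F : Fin 2 → V → K) : Prop :=
  ∀ x : V, x ≠ 0 → (∀ a, F a x = 0) → ∀ μ : Fin 2 → K,
    (∀ v, ∑ a, μ a * QuadraticMap.polar (F a) x v = 0) → μ = 0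

theorem dotProduct_mulVec_comm {R ι : Type*} [CommRing R] [Fintype ι] {S : Matrix ι ι R}
    (hS : S.IsSymm) (x y : ι → R) : x ⬝ᵥ S.mulVec y = y ⬝ᵥ S.mulVec x := by
  rw [Matrix.dotProduct_mulVec, ← Matrix.mulVec_transpose, hS.eq, dotProduct_comm]

theorem quadVal_add {R ι : Type*} [CommRing R] [Fintype ι] {S : Matrix ι ι R} (hS : S.IsSymm)
    (x y : ι → R) : quadVal S (x + y) = quadVal S x + 2 * (x ⬝ᵥ S.mulVec y) + quadVal S y := by
  simp only [quadVal, Matrix.mulVec_add, dotProduct_add, add_dotProduct]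
  rw [dotProduct_mulVec_comm hS y x]
  ring

theorem quadVal_smul {R ι : Type*} [CommRing R] [Fintype ι] (S : Matrix ι ι R) (t : R)
    (x : ι → R) : quadVal S (t • x) = t ^ 2 * quadVal S x := by
  simp only [quadVal, Matrix.mulVec_smul, dotProduct_smul, smul_dotProduct, smul_eq_mul]
  ring

theorem polar_quadVal {R ι : Type*} [CommRing R] [Fintype ι] {S : Matrix ι ι R} (hS : S.IsSymm)
    (x y : ι → R) : QuadraticMap.polar (quadVal S) x y = 2 * (x ⬝ᵥ S.mulVec y) := by
  rw [QuadraticMap.polar, quadVal_add hS]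
  ring

theorem pderiv_comm' {R σ : Type*} [CommRing R] (i j : σ) (p : MvPolynomial σ R) :
    MvPolynomial.pderiv i (MvPolynomial.pderiv j p) =
      MvPolynomial.pderiv j (MvPolynomial.pderiv i p) := by
  classical
  have : ⁅MvPolynomial.pderiv (R := R) i, MvPolynomial.pderiv (R := R) j⁆ = 0 := by
    refine MvPolynomial.derivation_ext fun l => ?_
    rw [Derivation.commutator_apply, MvPolynomial.pderiv_X, MvPolynomial.pderiv_X]
    simp [Pi.single_apply, apply_ite]
  have h := congrArg (fun D => D p) this
  beta_reduce at h
  rw [Derivation.commutator_apply] at h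
  exact sub_eq_zero.mp h

theorem exists_matrix_of_isHomogeneous {k : Type u} [Field k] [CharZero k] {n : ℕ}
    {Q : MvPolynomial (Fin n) k} (hQ : Q.IsHomogeneous 2) :
    ∃ S : Matrix (Fin n) (Fin n) k, S.IsSymm ∧ ∀ (K : Type u) [Field K] [Algebra k K]
      (x : Fin n → K),
      MvPolynomial.eval x (MvPolynomial.map (algebraMap k K) Q) =
        quadVal (S.map (algebraMap k K)) x ∧
      ∀ i, MvPolynomial.eval x (MvPolynomial.pderiv i (MvPolynomial.map (algebraMap k K) Q)) =
        2 * (S.map (algebraMap k K)).mulVec x i := by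
  have h1 : ∀ i, (MvPolynomial.pderiv i Q).IsHomogeneous 1 := fun i => hQ.pderiv
  have h0 : ∀ i j, ∃ s : k, MvPolynomial.pderiv j (MvPolynomial.pderiv i Q) = MvPolynomial.C (2 * s) := by
    intro i j
    have : (MvPolynomial.pderiv j (MvPolynomial.pderiv i Q)).IsHomogeneous 0 := (h1 i).pderiv
    rw [← MvPolynomial.totalDegree_zero_iff_isHomogeneous,
      MvPolynomial.totalDegree_eq_zero_iff_eq_C] at this
    exact ⟨2⁻¹ * _, by rw [mul_inv_cancel_left₀ two_ne_zero]; exact this⟩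
  choose s hs using h0
  refine ⟨Matrix.of s, ?_, fun K _ _ x => ?_⟩
  · ext i j
    have := (hs j i).symm.trans ((pderiv_comm' _ _ _).trans (hs i j))
    rw [MvPolynomial.C_inj] at this
    exact mul_left_cancel₀ two_ne_zero this
  · have hK : (2 : K) ≠ 0 := by
      rw [← map_ofNat (algebraMap k K) 2]
      exact (map_ne_zero _).mpr two_ne_zero
    have hd : ∀ i, MvPolynomial.eval x
        (MvPolynomial.pderiv i (MvPolynomial.map (algebraMap k K) Q)) =
        2 * ((Matrix.of s).map (algebraMap k K)).mulVec x i := by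
      intro i
      have := (h1 i).sum_X_mul_pderiv
      rw [one_smul] at this
      rw [MvPolynomial.pderiv_map, ← this]
      simp only [hs, Matrix.mulVec, dotProduct, map_sum, map_mul, MvPolynomial.map_C,
        MvPolynomial.map_X, MvPolynomial.eval_X, MvPolynomial.eval_C, Matrix.map_apply,
        Matrix.of_apply, map_ofNat, Finset.mul_sum]
      refine Finset.sum_congr rfl fun j _ => by ring
    refine ⟨?_, hd⟩
    have := (hQ.map (algebraMap k K)).sum_X_mul_pderiv
    have h2 := congrArg (MvPolynomial.eval x) this
    simp only [map_sum, map_mul, MvPolynomial.eval_X, hd, two_smul, map_add] at h2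
    refine mul_left_cancel₀ hK ?_
    rw [two_mul, ← h2]
    simp only [quadVal, dotProduct, Finset.mul_sum]
    exact Finset.sum_congr rfl fun j _ => by ring

theorem exists_matrix_pair {k : Type u} [Field k] [CharZero k] {n : ℕ}
    {Q : Fin 2 → MvPolynomial (Fin n) k}
    (hdeg : ∀ a, (Q a).IsHomogeneous 2)
    (hsmooth : ∀ z : Fin n → AlgebraicClosure k, z ≠ 0 →
      (∀ a, MvPolynomial.eval z
        (MvPolynomial.map (algebraMap k (AlgebraicClosure k)) (Q a)) = 0) →
      Matrix.rank (Matrix.of fun (a : Fin 2) (i : Fin n) =>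
        MvPolynomial.eval z (MvPolynomial.pderiv i
          (MvPolynomial.map (algebraMap k (AlgebraicClosure k)) (Q a)))) = 2) :
    ∃ S : Fin 2 → Matrix (Fin n) (Fin n) k, (∀ a, (S a).IsSymm) ∧
      (∀ a (x : Fin n → k), MvPolynomial.eval x (Q a) = quadVal (S a) x) ∧
      (∀ a (x : Fin n → AlgebraicClosure k),
        MvPolynomial.eval x (MvPolynomial.map (algebraMap k (AlgebraicClosure k)) (Q a)) =
          quadVal ((S a).map (algebraMap k (AlgebraicClosure k))) x) ∧
      IsSmoothPair fun a => quadVal ((S a).map (algebraMap k (AlgebraicClosure k))) := by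
  choose S hS hQ using fun a => exists_matrix_of_isHomogeneous (hdeg a)
  refine ⟨S, hS, fun a x => ?_, fun a x => (hQ a _ x).1, fun x hx hx0 μ hμ => ?_⟩
  · have := (hQ a k x).1
    rw [Algebra.algebraMap_self, MvPolynomial.map_id] at this
    simpa using this
  · have hr := hsmooth x hx fun a => ((hQ a _ x).1).trans (hx0 a)
    rw [Matrix.rank_eq_finrank_span_row] at hr
    have hli := linearIndependent_iff_card_eq_finrank_span.mpr
      ((Fintype.card_fin 2).trans hr.symm)
    rw [Fintype.linearIndependent_iff] at hli
    refine funext (hli μ (funext fun i => ?_))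
    have := hμ (Pi.single i 1)
    simp_rw [polar_quadVal ((hS _).map _), dotProduct_mulVec_comm ((hS _).map _)] at this
    simp only [single_dotProduct, one_mul] at this
    simp only [Finset.sum_apply, Pi.smul_apply, smul_eq_mul, Pi.zero_apply, Matrix.row]
    rw [← this]
    refine Finset.sum_congr rfl fun a _ => ?_
    rw [Matrix.of_apply, (hQ a _ x).2]

end QuadraticPairs

section ConicPlane

theorem eq_zero_of_quadVal_eq_zero {K ι : Type*} [Field K] [Fintype ι] (h2 : (2 : K) ≠ 0)
    {S : Matrix ι ι K} (hS : S.IsSymm) (h : ∀ x, quadVal S x = 0) : S = 0 := by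
  classical
  ext i j
  have h1 := quadVal_add hS (Pi.single i 1) (Pi.single j 1)
  simp only [h] at h1
  have : (Pi.single i 1 : ι → K) ⬝ᵥ S.mulVec (Pi.single j 1) = S i j := by simp
  rw [this] at h1
  simpa [h2] using h1.symm

theorem eq_zero_or_eq_zero_of_quadVal_mul {K ι : Type*} [Field K] [Infinite K] [Fintype ι]
    (h2 : (2 : K) ≠ 0) {A B : Matrix ι ι K} (hA : A.IsSymm) (hB : B.IsSymm)
    (h : ∀ x, quadVal A x * quadVal B x = 0) : A = 0 ∨ B = 0 := by
  let P : Matrix ι ι K → MvPolynomial ι K := fun S =>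
    quadVal (S.map MvPolynomial.C) MvPolynomial.X
  have hP : ∀ S x, MvPolynomial.eval x (P S) = quadVal S x := fun S x => by
    simp [P, quadVal, dotProduct, Matrix.mulVec]
  have hmul : P A * P B = 0 := MvPolynomial.funext fun x => by
    rw [map_mul, hP, hP, h, map_zero]
  rcases mul_eq_zero.mp hmul with h0 | h0
  · exact Or.inl (eq_zero_of_quadVal_eq_zero h2 hA fun x => by rw [← hP, h0, map_zero])
  · exact Or.inr (eq_zero_of_quadVal_eq_zero h2 hB fun x => by rw [← hP, h0, map_zero])

theorem quadVal_mul_disc_eq_zero {K ι : Type*} [Field K] [IsAlgClosed K] [Fintype ι]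
    (h2 : (2 : K) ≠ 0) {s A : Matrix ι ι K} (hs : s.IsSymm) (hA : A.IsSymm) {p : ι → K}
    (hp : quadVal s p ≠ 0) (hAp : quadVal A p = 0)
    (h : ∀ y, quadVal s y = 0 → quadVal A y = 0) (v : ι → K) :
    quadVal A v * ((v ⬝ᵥ s.mulVec p) ^ 2 - quadVal s p * quadVal s v) = 0 := by
  set b := v ⬝ᵥ s.mulVec p with hb
  obtain ⟨ρ, hρ⟩ := IsAlgClosed.exists_pow_nat_eq (b ^ 2 - quadVal s p * quadVal s v) two_pos
  have key : ∀ r : K, r ^ 2 = ρ ^ 2 →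
      quadVal s p * quadVal A v + 2 * (-b + r) * (v ⬝ᵥ A.mulVec p) = 0 := by
    intro r hr
    have := h (v + ((-b + r) / quadVal s p) • p) (by
      rw [quadVal_add hs, quadVal_smul, Matrix.mulVec_smul, dotProduct_smul, ← hb, smul_eq_mul]
      field_simp
      linear_combination hr + hρ)
    rw [quadVal_add hA, quadVal_smul, Matrix.mulVec_smul, dotProduct_smul, hAp, smul_eq_mul] at this
    field_simp at this
    refine mul_left_cancel₀ hp ?_
    linear_combination this
  have h1 := key ρ rfl
  have h3 := key (-ρ) (by ring)
  have h4 : ρ * (v ⬝ᵥ A.mulVec p) = 0 := by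
    have : (2 * 2) * (ρ * (v ⬝ᵥ A.mulVec p)) = 0 := by linear_combination h1 - h3
    simpa [h2] using this
  have h5 : quadVal s p * (ρ * quadVal A v) = 0 := by
    linear_combination ρ * h1 - 2 * (-b + ρ) * h4
  have h6 : ρ * quadVal A v = 0 := by simpa [hp] using h5
  rw [← hρ]
  linear_combination ρ * h6

theorem exists_eq_smul_of_forall_quadVal {k K : Type*} [Field k] [CharZero k] [Field K]
    [IsAlgClosed K] [Algebra k K] {s A : Matrix (Fin 3) (Fin 3) k} (hs : s.IsSymm) (hA : A.IsSymm)
    (hdet : s.det ≠ 0) (h : ∀ y : Fin 3 → K, quadVal (s.map (algebraMap k K)) y = 0 →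
      quadVal (A.map (algebraMap k K)) y = 0) : ∃ c : k, A = c • s := by
  have h2 : (2 : k) ≠ 0 := two_ne_zero
  have h2K : (2 : K) ≠ 0 := by
    rw [← map_ofNat (algebraMap k K) 2]
    exact (map_ne_zero _).mpr h2
  obtain ⟨p, hp⟩ : ∃ p, quadVal s p ≠ 0 := by
    by_contra! h0
    apply hdet
    rw [eq_zero_of_quadVal_eq_zero h2 hs h0]
    exact Matrix.det_zero
  set φ := algebraMap k K with hφ
  have hmap : ∀ (S : Matrix (Fin 3) (Fin 3) k) (x : Fin 3 → k),
      quadVal (S.map φ) (fun i => φ (x i)) = φ (quadVal S x) := fun S x => by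
    simp [quadVal, dotProduct, Matrix.mulVec]
  refine ⟨quadVal A p / quadVal s p, ?_⟩
  set c := quadVal A p / quadVal s p with hc
  set A' := A - c • s with hA'
  have hA's : A'.IsSymm := hA.sub (hs.smul c)
  have hA'v : ∀ y : Fin 3 → K,
      quadVal (A'.map φ) y = quadVal (A.map φ) y - φ c * quadVal (s.map φ) y := fun y => by
    have : A'.map φ = A.map φ - φ c • s.map φ := by
      ext i j
      simp [hA']
    rw [this, quadVal, Matrix.sub_mulVec, dotProduct_sub, Matrix.smul_mulVec, dotProduct_smul]
    rfl
  have hA'p : quadVal (A'.map φ) (fun i => φ (p i)) = 0 := by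
    rw [hA'v, hmap, hmap, ← map_mul, hc, div_mul_cancel₀ _ hp, sub_self]
  have hp' : quadVal (s.map φ) (fun i => φ (p i)) ≠ 0 := by
    rw [hmap]
    exact (map_ne_zero _).mpr hp
  have hprod := quadVal_mul_disc_eq_zero h2K (hs.map φ) (hA's.map φ) hp' hA'p
    fun y hy => by rw [hA'v, h y hy, hy, mul_zero, sub_zero]
  set u := (s.map φ).mulVec (fun i => φ (p i)) with hu
  have hDs : (Matrix.vecMulVec u u - quadVal (s.map φ) (fun i => φ (p i)) • s.map φ).IsSymm := by
    refine Matrix.IsSymm.sub ?_ ((hs.map φ).smul _)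
    ext i j
    simp [Matrix.vecMulVec_apply, mul_comm]
  have hDv : ∀ v, quadVal (Matrix.vecMulVec u u - quadVal (s.map φ) (fun i => φ (p i)) • s.map φ) v
      = (v ⬝ᵥ u) ^ 2 - quadVal (s.map φ) (fun i => φ (p i)) * quadVal (s.map φ) v := fun v => by
    rw [quadVal, Matrix.sub_mulVec, dotProduct_sub, Matrix.smul_mulVec, dotProduct_smul,
      Matrix.vecMulVec_mulVec, op_smul_eq_smul, dotProduct_smul, smul_eq_mul, smul_eq_mul, dotProduct_comm u v]
    simp only [quadVal]
    ring
  have : Infinite K := IsAlgClosed.instInfinite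
  rcases eq_zero_or_eq_zero_of_quadVal_mul h2K (hA's.map φ) hDs
    (fun x => by rw [hDv]; exact hprod x) with h0 | h0
  · rw [← sub_eq_zero, ← hA']
    ext i j
    have := congrFun (congrFun h0 i) j
    simpa using this
  · exfalso
    have h1 := congrArg Matrix.det (sub_eq_zero.mp h0)
    rw [Matrix.det_smul, ← RingHom.mapMatrix_apply, ← RingHom.map_det] at h1
    rw [Matrix.det_vecMulVec] at h1
    exact mul_ne_zero (pow_ne_zero _ hp') ((map_ne_zero φ).mpr hdet) h1.symm

end ConicPlane

section Pencil

theorem quadVal_mulVec {R ι κ : Type*} [CommRing R] [Fintype ι] [Fintype κ] (S : Matrix ι ι R)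
    (N : Matrix ι κ R) (x : κ → R) : quadVal S (N.mulVec x) = quadVal (N.transpose * S * N) x := by
  rw [quadVal, quadVal, ← Matrix.mulVec_mulVec, ← Matrix.mulVec_mulVec,
    Matrix.dotProduct_mulVec x N.transpose, Matrix.vecMul_transpose]

theorem quadVal_map_mulVec {R A ι κ : Type*} [CommRing R] [CommRing A] [Fintype ι] [Fintype κ]
    (φ : R →+* A) (S : Matrix ι ι R) (N : Matrix ι κ R) (x : κ → A) :
    quadVal (S.map φ) ((N.map φ).mulVec x) = quadVal ((N.transpose * S * N).map φ) x := by
  rw [quadVal_mulVec, Matrix.map_mul, Matrix.map_mul, Matrix.transpose_map]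

theorem IsSmoothPair.comp {K V V' : Type*} [Field K] [AddCommGroup V] [AddCommGroup V']
    {F : Fin 2 → V → K} (hF : IsSmoothPair F) (f : V' ≃+ V) :
    IsSmoothPair fun a x => F a (f x) := by
  intro x hx h0 μ hμ
  refine hF (f x) (by simpa using hx) h0 μ fun v => ?_
  have := hμ (f.symm v)
  simpa [QuadraticMap.polar] using this

theorem IsSmoothPair.of_lin_comb {K V : Type*} [Field K] [AddCommGroup V]
    {F F' : Fin 2 → V → K} (hF : IsSmoothPair F) {g : Matrix (Fin 2) (Fin 2) K} (hg : g.det ≠ 0)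
    (h : ∀ a x, F' a x = ∑ b, g a b * F b x) :
    IsSmoothPair F' ∧ ∀ x, (∀ a, F' a x = 0) ↔ ∀ a, F a x = 0 := by
  have hiff : ∀ x, (∀ a, F' a x = 0) ↔ ∀ a, F a x = 0 := by
    intro x
    constructor
    · intro h0
      refine congrFun (Matrix.eq_zero_of_mulVec_eq_zero hg (funext fun a => ?_))
      exact (h a x).symm.trans (h0 a)
    · intro h0 a
      rw [h]
      simp [h0]
  refine ⟨fun x hx h0 μ hμ => ?_, hiff⟩
  refine Matrix.eq_zero_of_vecMul_eq_zero hg (hF x hx ((hiff x).mp h0) _ fun v => ?_)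
  rw [← hμ v]
  simp only [QuadraticMap.polar, h, Matrix.vecMul, dotProduct, Fin.sum_univ_two]
  ring

theorem exists_pencil_adapted {k K : Type*} [Field k] [CharZero k] [Field K] [IsAlgClosed K]
    [Algebra k K] {n : ℕ} {S : Fin 2 → Matrix (Fin n) (Fin n) k} (hS : ∀ a, (S a).IsSymm)
    (hsm : IsSmoothPair fun a => quadVal ((S a).map (algebraMap k K)))
    {s : Matrix (Fin 3) (Fin 3) k} (hs : s.IsSymm) (hdet : s.det ≠ 0) {L : Matrix (Fin n) (Fin 3) k}
    (h : ∀ y : Fin 3 → K, quadVal (s.map (algebraMap k K)) y = 0 →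
      ∀ a, quadVal ((S a).map (algebraMap k K)) ((L.map (algebraMap k K)).mulVec y) = 0) :
    ∃ T : Fin 2 → Matrix (Fin n) (Fin n) k, (∀ a, (T a).IsSymm) ∧
      L.transpose * T 0 * L = 0 ∧
      (IsSmoothPair fun a => quadVal ((T a).map (algebraMap k K))) ∧
      ∀ x : Fin n → K, (∀ a, quadVal ((T a).map (algebraMap k K)) x = 0) ↔
        ∀ a, quadVal ((S a).map (algebraMap k K)) x = 0 := by
  have hA : ∀ a, ∃ c : k, L.transpose * S a * L = c • s := fun a => by
    refine exists_eq_smul_of_forall_quadVal (K := K) hs ?_ hdet fun y hy => ?_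
    · simp [Matrix.IsSymm, Matrix.transpose_mul, (hS a).eq, Matrix.mul_assoc]
    · rw [← quadVal_map_mulVec]
      exact h y hy a
  choose c hc using hA
  obtain ⟨g, hg, hgc⟩ : ∃ g : Matrix (Fin 2) (Fin 2) k, g.det ≠ 0 ∧
      g 0 0 * c 0 + g 0 1 * c 1 = 0 := by
    by_cases h1 : c 1 = 0
    · exact ⟨!![0, 1; 1, 0], by simp, by simp [h1]⟩
    · exact ⟨!![c 1, -c 0; 0, 1], by simp [h1], by simp; ring⟩
  refine ⟨fun a => g a 0 • S 0 + g a 1 • S 1,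
    fun a => ((hS 0).smul _).add ((hS 1).smul _), ?_, ?_⟩
  · rw [Matrix.mul_add, Matrix.add_mul, Matrix.mul_smul, Matrix.mul_smul, Matrix.smul_mul,
      Matrix.smul_mul, hc, hc, smul_smul, smul_smul, ← add_smul, hgc, zero_smul]
  · refine hsm.of_lin_comb (g := g.map (algebraMap k K)) ?_ fun a x => ?_
    · rw [← RingHom.mapMatrix_apply, ← RingHom.map_det]
      exact (map_ne_zero _).mpr hg
    · have : (g a 0 • S 0 + g a 1 • S 1).map (algebraMap k K) =
          algebraMap k K (g a 0) • (S 0).map (algebraMap k K) +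
          algebraMap k K (g a 1) • (S 1).map (algebraMap k K) := by
        ext i j
        simp only [Matrix.map_apply, Matrix.add_apply, Matrix.smul_apply, smul_eq_mul, map_add,
          map_mul]
      rw [this, Fin.sum_univ_two, quadVal, Matrix.add_mulVec, Matrix.smul_mulVec,
        Matrix.smul_mulVec, dotProduct_add, dotProduct_smul, dotProduct_smul]
      rfl

end Pencil

section NormalForm

/-- The quadratic form in four of the five variables which induces the form of bidegree `(2, 2)`
with coefficients `c` through the Segre embedding. -/
def segreForm {R : Type*} [CommRing R] (c : Fin 3 → Fin 3 → R) (x : Fin 5 → R) : R :=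
  c 0 0 * x 0 ^ 2 + c 0 1 * x 0 * x 1 + c 0 2 * x 1 ^ 2 + c 1 0 * x 0 * x 2 + c 1 1 * x 0 * x 3 +
    c 1 2 * x 1 * x 3 + c 2 0 * x 2 ^ 2 + c 2 1 * x 2 * x 3 + c 2 2 * x 3 ^ 2

theorem eq_zero_of_smul_map_add {k K ι : Type*} [Field k] [Field K] (φ : k →+* K) {u v : ι → k}
    (huv : LinearIndependent k ![u, v]) {α β : K}
    (h : ∀ i, α * φ (u i) + β * φ (v i) = 0) : α = 0 ∧ β = 0 := by
  rw [LinearIndependent.pair_iff] at huv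
  obtain ⟨i, j, hij⟩ : ∃ i j, u i * v j - u j * v i ≠ 0 := by
    by_contra! h0
    have hu : ∃ i, u i ≠ 0 := by
      by_contra! hu
      exact one_ne_zero (huv 1 0 (funext fun i => by simp [hu])).1
    obtain ⟨i, hi⟩ := hu
    refine hi (neg_eq_zero.mp (neg_eq_zero.mp ?_))
    rw [neg_neg]
    refine (huv (-v i) (u i) (funext fun j => ?_)).2
    simp only [Pi.add_apply, Pi.smul_apply, smul_eq_mul, Pi.zero_apply]
    linear_combination h0 i j
  have hφ : φ (u i) * φ (v j) - φ (u j) * φ (v i) ≠ 0 := by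
    rw [← map_mul, ← map_mul, ← map_sub]
    exact (map_ne_zero φ).mpr hij
  constructor
  · refine (mul_eq_zero.mp ?_).resolve_right hφ
    linear_combination φ (v j) * h i - φ (v i) * h j
  · refine (mul_eq_zero.mp ?_).resolve_right hφ
    linear_combination φ (u i) * h j - φ (u j) * h i

variable {k K : Type*} [Field k] [CharZero k] [Field K] [IsAlgClosed K] [Algebra k K]

theorem map_mulVec_algebraMap {k K : Type*} [Field k] [Field K] [Algebra k K] {ι κ : Type*}
    [Fintype κ] (S : Matrix ι κ k)
    (x : κ → k) : (S.map (algebraMap k K)).mulVec (fun i => algebraMap k K (x i)) =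
      fun i => algebraMap k K (S.mulVec x i) := by
  ext i
  simp [Matrix.mulVec, dotProduct]

theorem not_isSmoothPair_of_mulVec_eq_zero {K : Type*} [Field K] {n : ℕ}
    {T : Fin 2 → Matrix (Fin n) (Fin n) K}
    (hT : ∀ a, (T a).IsSymm) (hsm : IsSmoothPair fun a => quadVal (T a)) {x : Fin n → K}
    (hx : x ≠ 0) (h0 : (T 0).mulVec x = 0) : quadVal (T 1) x ≠ 0 := by
  intro h1
  have : (![1, 0] : Fin 2 → K) = 0 := by
    refine hsm x hx (fun a => ?_) _ fun v => ?_
    · fin_cases a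
      · simp [quadVal, h0]
      · exact h1
    · simp only [Fin.sum_univ_two, polar_quadVal (hT _), dotProduct_mulVec_comm (hT 0) x]
      simp [h0]
  exact one_ne_zero (congrFun this 0)

theorem quadVal_ne_zero_of_mulVec_eq_zero {k K : Type*} [Field k] [Field K]
    [Algebra k K] {n : ℕ} {T : Fin 2 → Matrix (Fin n) (Fin n) k}
    (hT : ∀ a, (T a).IsSymm) (hsm : IsSmoothPair fun a => quadVal ((T a).map (algebraMap k K)))
    {x : Fin n → k} (hx : x ≠ 0) (h0 : (T 0).mulVec x = 0) : quadVal (T 1) x ≠ 0 := by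
  intro h1
  refine not_isSmoothPair_of_mulVec_eq_zero (fun a => (hT a).map _) hsm
    (x := fun i => algebraMap k K (x i)) ?_ ?_ ?_
  · intro h
    exact hx (funext fun i => by simpa using congrFun h i)
  · rw [map_mulVec_algebraMap, h0]
    ext
    simp
  · rw [quadVal, map_mulVec_algebraMap]
    have := congrArg (algebraMap k K) h1
    simpa [quadVal, dotProduct] using this

theorem not_linearIndependent_of_mulVec_eq_zero {n : ℕ} {T : Fin 2 → Matrix (Fin n) (Fin n) k}
    (hT : ∀ a, (T a).IsSymm) (hsm : IsSmoothPair fun a => quadVal ((T a).map (algebraMap k K)))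
    {u v : Fin n → k} (hu : (T 0).mulVec u = 0) (hv : (T 0).mulVec v = 0) :
    ¬ LinearIndependent k ![u, v] := by
  intro huv
  have h2K : (2 : K) ≠ 0 := by
    rw [← map_ofNat (algebraMap k K) 2]
    exact (map_ne_zero _).mpr two_ne_zero
  set u' : Fin n → K := fun i => algebraMap k K (u i) with hu'
  set v' : Fin n → K := fun i => algebraMap k K (v i) with hv'
  set T' := (T 1).map (algebraMap k K) with hT'
  obtain ⟨b, hb, hb0⟩ := exists_binQuad_eq_zero h2K
    ![quadVal T' u', 2 * (u' ⬝ᵥ T'.mulVec v'), quadVal T' v']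
  refine not_isSmoothPair_of_mulVec_eq_zero (fun a => (hT a).map _) hsm
    (x := b 0 • u' + b 1 • v') ?_ ?_ ?_
  · intro h
    have := eq_zero_of_smul_map_add (algebraMap k K) huv fun i => congrFun h i
    refine hb (funext fun i => ?_)
    fin_cases i
    exacts [this.1, this.2]
  · rw [Matrix.mulVec_add, Matrix.mulVec_smul, Matrix.mulVec_smul, map_mulVec_algebraMap,
      map_mulVec_algebraMap, hu, hv]
    ext
    simp
  · rw [quadVal_add ((hT 1).map _), quadVal_smul, quadVal_smul, Matrix.mulVec_smul,
      dotProduct_smul, smul_dotProduct, ← hT']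
    simp only [binQuad, Matrix.cons_val, smul_eq_mul] at hb0 ⊢
    linear_combination hb0

theorem exists_dual_pair {k : Type*} [Field k] {n : ℕ} {u v : Fin n → k}
    (huv : LinearIndependent k ![u, v]) (α β : k) :
    ∃ w : Fin n → k, u ⬝ᵥ w = α ∧ v ⬝ᵥ w = β := by
  have hr := LinearIndependent.rank_matrix (M := Matrix.of ![u, v]) huv
  have : LinearMap.range (Matrix.of ![u, v]).mulVecLin = ⊤ := by
    refine Submodule.eq_top_of_finrank_eq ?_
    rw [← Matrix.rank, hr]
    simp
  obtain ⟨w, hw⟩ := (LinearMap.range_eq_top.mp this) ![α, β]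
  exact ⟨w, congrFun hw 0, congrFun hw 1⟩

theorem exists_isotropic_vectors {T : Fin 2 → Matrix (Fin 5) (Fin 5) k}
    (hT : ∀ a, (T a).IsSymm) (hsm : IsSmoothPair fun a => quadVal ((T a).map (algebraMap k K)))
    {L : Matrix (Fin 5) (Fin 3) k} (hL : L.rank = 3) (hL0 : L.transpose * T 0 * L = 0) :
    ∃ e u v : Fin 5 → k, e ≠ 0 ∧ (T 0).mulVec e = 0 ∧
      LinearIndependent k ![(T 0).mulVec u, (T 0).mulVec v] ∧
      u ⬝ᵥ (T 0).mulVec u = 0 ∧ u ⬝ᵥ (T 0).mulVec v = 0 ∧ v ⬝ᵥ (T 0).mulVec v = 0 := by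
  have hLinj : Function.Injective L.mulVec := by
    rw [← Matrix.coe_mulVecLin, ← LinearMap.ker_eq_bot, ← Submodule.finrank_eq_zero (R := k)]
    have h1 := L.mulVecLin.finrank_range_add_finrank_ker
    rw [← Matrix.rank, hL] at h1
    simpa using h1
  have hiso : ∀ p q : Fin 3 → k, L.mulVec p ⬝ᵥ (T 0).mulVec (L.mulVec q) = 0 := by
    intro p q
    rw [← Matrix.vecMul_transpose, ← Matrix.dotProduct_mulVec, Matrix.mulVec_mulVec,
      Matrix.mulVec_mulVec, hL0]
    simp
  have hle : (T 0 * L).rank ≤ 2 := by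
    have h1 : LinearMap.range (T 0 * L).mulVecLin ≤ LinearMap.ker L.transpose.mulVecLin := by
      rintro _ ⟨p, rfl⟩
      rw [LinearMap.mem_ker, Matrix.mulVecLin_apply, Matrix.mulVecLin_apply, Matrix.mulVec_mulVec,
        ← Matrix.mul_assoc, hL0]
      simp
    have h2 := Submodule.finrank_mono h1
    have h3 := L.transpose.mulVecLin.finrank_range_add_finrank_ker
    rw [← Matrix.rank, Matrix.rank_transpose, hL] at h3
    simp only [Module.finrank_fintype_fun_eq_card, Fintype.card_fin] at h3
    rw [← Matrix.rank] at h2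
    omega
  have hrk := (T 0 * L).mulVecLin.finrank_range_add_finrank_ker
  rw [← Matrix.rank] at hrk
  simp only [Module.finrank_fintype_fun_eq_card, Fintype.card_fin] at hrk
  have hker : ∀ p, p ∈ LinearMap.ker (T 0 * L).mulVecLin ↔ (T 0).mulVec (L.mulVec p) = 0 := by
    intro p
    rw [LinearMap.mem_ker, Matrix.mulVecLin_apply, Matrix.mulVec_mulVec]
  have hker1 : Module.finrank k (LinearMap.ker (T 0 * L).mulVecLin) ≤ 1 := by
    by_contra! h
    obtain ⟨x, hx⟩ := Module.finrank_pos_iff_exists_ne_zero.mp (zero_lt_one.trans h)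
    obtain ⟨y, hxy⟩ := exists_linearIndependent_pair_of_one_lt_finrank h hx
    refine not_linearIndependent_of_mulVec_eq_zero hT hsm ((hker _).mp x.2) ((hker _).mp y.2) ?_
    rw [LinearIndependent.pair_iff] at hxy ⊢
    intro s t hst
    refine hxy s t (Subtype.ext (hLinj ?_))
    simp only [Submodule.coe_add, Submodule.coe_smul, Matrix.mulVec_add, Matrix.mulVec_smul,
      Submodule.coe_zero, Matrix.mulVec_zero]
    exact hst
  obtain ⟨⟨p, hp⟩, hp0⟩ := Module.finrank_pos_iff_exists_ne_zero.mp
    (show 0 < Module.finrank k (LinearMap.ker (T 0 * L).mulVecLin) by omega)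
  have hrange : 1 < Module.finrank k (LinearMap.range (T 0 * L).mulVecLin) := by
    rw [← Matrix.rank]
    omega
  obtain ⟨x, hx⟩ := Module.finrank_pos_iff_exists_ne_zero.mp (zero_lt_one.trans hrange)
  obtain ⟨y, hxy⟩ := exists_linearIndependent_pair_of_one_lt_finrank hrange hx
  obtain ⟨_, q, rfl⟩ := x
  obtain ⟨_, r, rfl⟩ := y
  refine ⟨L.mulVec p, L.mulVec q, L.mulVec r, ?_, (hker p).mp hp, ?_, hiso q q, hiso q r, hiso r r⟩
  · intro h
    refine hp0 (Subtype.ext (hLinj ?_))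
    rw [h]
    simp
  · rw [LinearIndependent.pair_iff] at hxy ⊢
    intro s t hst
    refine hxy s t (Subtype.ext ?_)
    rw [Matrix.mulVec_mulVec, Matrix.mulVec_mulVec] at hst
    exact hst

end NormalForm

section AdaptedBasis

theorem exists_adapted_family {k V : Type*} [Field k] [CharZero k] [AddCommGroup V] [Module k V]
    {B B' : LinearMap.BilinForm k V} (hB : B.IsSymm) {e u v p q : V}
    (he : ∀ x, B e x = 0) (he' : B' e e ≠ 0) (huu : B u u = 0) (huv : B u v = 0) (hvv : B v v = 0)
    (hup : B u p = 2⁻¹) (hvp : B v p = 0) (huq : B u q = 0) (hvq : B v q = -2⁻¹) :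
    ∃ n : Fin 5 → V, n 4 = e ∧ (∀ i, i ≠ 4 → B' e (n i) = 0) ∧ B (n 0) (n 0) = 0 ∧
      B (n 0) (n 1) = 0 ∧ B (n 0) (n 2) = 0 ∧ B (n 0) (n 3) = 2⁻¹ ∧ B (n 1) (n 1) = 0 ∧
      B (n 1) (n 2) = -2⁻¹ ∧ B (n 1) (n 3) = 0 ∧ B (n 2) (n 2) = 0 ∧ B (n 2) (n 3) = 0 ∧
      B (n 3) (n 3) = 0 := by
  have hs : ∀ x y, B x y = B y x := fun x y => hB.eq x y
  have he2 : ∀ x, B x e = 0 := fun x => by rw [hs, he]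
  have hpu : B p u = 2⁻¹ := by rw [hs, hup]
  have hpv : B p v = 0 := by rw [hs, hvp]
  have hqu : B q u = 0 := by rw [hs, huq]
  have hqv : B q v = -2⁻¹ := by rw [hs, hvq]
  have hvu : B v u = 0 := by rw [hs, huv]
  let n' : Fin 5 → V :=
    ![p - B p p • u, q + B q q • v - (2 * B p q) • u, v, u, e]
  refine ⟨fun i => if i = 4 then e else n' i - (B' e (n' i) / B' e e) • e, by simp, ?_, ?_⟩
  · intro i hi
    simp only [hi, if_false, map_sub, map_smul, smul_eq_mul]
    field_simp
    ring
  · simp only [Fin.isValue, show (0 : Fin 5) ≠ 4 by decide, show (1 : Fin 5) ≠ 4 by decide,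
      show (2 : Fin 5) ≠ 4 by decide, show (3 : Fin 5) ≠ 4 by decide, if_false, map_sub, map_smul,
      LinearMap.sub_apply, LinearMap.smul_apply, he, he2, smul_zero, sub_zero]
    simp only [n', Matrix.cons_val, map_sub, map_add, map_smul, LinearMap.sub_apply,
      LinearMap.add_apply, LinearMap.smul_apply, smul_eq_mul, huu, huv, hvv, hup, huq, hvq, hpu,
      hpv, hqu, hqv, hvu]
    refine ⟨?_, ?_, ?_, ?_, ?_, ?_, ?_, ?_, ?_, ?_⟩ <;> first | trivial | ring

theorem exists_gram_eq {k K : Type*} [Field k] [CharZero k] [Field K] [IsAlgClosed K] [Algebra k K]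
    {T : Fin 2 → Matrix (Fin 5) (Fin 5) k}
    (hT : ∀ a, (T a).IsSymm) (hsm : IsSmoothPair fun a => quadVal ((T a).map (algebraMap k K)))
    {L : Matrix (Fin 5) (Fin 3) k} (hL : L.rank = 3) (hL0 : L.transpose * T 0 * L = 0) :
    ∃ N : Matrix (Fin 5) (Fin 5) k, N.det ≠ 0 ∧
      N.transpose * T 0 * N = !![0, 0, 0, 2⁻¹, 0; 0, 0, -2⁻¹, 0, 0; 0, -2⁻¹, 0, 0, 0;
        2⁻¹, 0, 0, 0, 0; 0, 0, 0, 0, 0] ∧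
      (∀ i, i ≠ 4 → (N.transpose * T 1 * N) 4 i = 0) ∧ (N.transpose * T 1 * N) 4 4 ≠ 0 := by
  obtain ⟨e, u, v, he0, he, hli, huu, huv, hvv⟩ := exists_isotropic_vectors hT hsm hL hL0
  obtain ⟨p, hup, hvp⟩ := exists_dual_pair hli 2⁻¹ 0
  obtain ⟨q, huq, hvq⟩ := exists_dual_pair hli 0 (-2⁻¹)
  have hB : ∀ a x y, Matrix.toBilin' (T a) x y = x ⬝ᵥ (T a).mulVec y := fun a x y =>
    Matrix.toBilin'_apply' _ _ _
  have hsym : ∀ a, (Matrix.toBilin' (T a)).IsSymm := fun a => ⟨fun x y => by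
    rw [hB, hB]
    exact (dotProduct_mulVec_comm (hT a) _ _).symm⟩
  have hs : ∀ a x y, (T a).mulVec x ⬝ᵥ y = Matrix.toBilin' (T a) x y := fun a x y => by
    rw [hB, dotProduct_comm, dotProduct_mulVec_comm (hT a)]
  rw [hs] at hup hvp huq hvq
  rw [← hB] at huu huv hvv
  obtain ⟨n, hn4, hn', h00, h01, h02, h03, h11, h12, h13, h22, h23, h33⟩ :=
    exists_adapted_family (hsym 0) (fun x => by rw [← hs, he, zero_dotProduct])
      (by rw [hB]; exact quadVal_ne_zero_of_mulVec_eq_zero hT hsm he0 he)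
      huu huv hvv hup hvp huq hvq
  set N : Matrix (Fin 5) (Fin 5) k := Matrix.of fun i j => n j i with hN
  have hgram : ∀ a i j, (N.transpose * T a * N) i j = Matrix.toBilin' (T a) (n i) (n j) := by
    intro a i j
    rw [hB, Matrix.mul_assoc]
    rfl
  have he0' : ∀ x, Matrix.toBilin' (T 0) e x = 0 := fun x => by rw [← hs, he, zero_dotProduct]
  have hsy : ∀ a x y, Matrix.toBilin' (T a) x y = Matrix.toBilin' (T a) y x :=
    fun a x y => (hsym a).eq x y
  have hG0 : N.transpose * T 0 * N = !![0, 0, 0, 2⁻¹, 0; 0, 0, -2⁻¹, 0, 0; 0, -2⁻¹, 0, 0, 0;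
      2⁻¹, 0, 0, 0, 0; 0, 0, 0, 0, 0] := by
    have h4 : ∀ i, Matrix.toBilin' (T 0) (n i) (n 4) = 0 := fun i => by rw [hsy, hn4, he0']
    have h4' : ∀ i, Matrix.toBilin' (T 0) (n 4) (n i) = 0 := fun i => by rw [hn4, he0']
    have h10 := (hsy 0 _ _).trans h01
    have h20 := (hsy 0 _ _).trans h02
    have h30 := (hsy 0 _ _).trans h03
    have h21 := (hsy 0 _ _).trans h12
    have h31 := (hsy 0 _ _).trans h13
    have h32 := (hsy 0 _ _).trans h23
    ext i j
    rw [hgram]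
    clear hsy hgram hsym hs hB hup hvp huq hvq huu huv hvv hn' he0'
    generalize Matrix.toBilin' (T 0) = b at *
    generalize (2⁻¹ : k) = r at *
    fin_cases i <;> fin_cases j <;> simp only [Fin.zero_eta, Fin.mk_one, Fin.reduceFinMk,
      Matrix.of_apply, Matrix.cons_val, h4, h4', h00, h01, h02, h03, h11, h12, h13, h22, h23, h33,
      h10, h20, h30, h21, h31, h32, Matrix.cons_val_zero, Matrix.cons_val_one]
  have hG1 : ∀ i, i ≠ 4 → (N.transpose * T 1 * N) 4 i = 0 := fun i hi => by
    rw [hgram, hn4, hn' i hi]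
  have hG14 : (N.transpose * T 1 * N) 4 4 ≠ 0 := by
    rw [hgram, hn4, hB]
    exact quadVal_ne_zero_of_mulVec_eq_zero hT hsm he0 he
  refine ⟨N, fun hdet => ?_, hG0, hG1, hG14⟩
  obtain ⟨x, hx, hx0⟩ := Matrix.exists_mulVec_eq_zero_iff.mpr hdet
  have h0 : (N.transpose * T 0 * N).mulVec x = 0 := by
    rw [← Matrix.mulVec_mulVec, hx0, Matrix.mulVec_zero]
  have h1 : (N.transpose * T 1 * N).mulVec x 4 = 0 := by
    rw [← Matrix.mulVec_mulVec, hx0, Matrix.mulVec_zero, Pi.zero_apply]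
  have h2 : (2⁻¹ : k) ≠ 0 := inv_ne_zero two_ne_zero
  rw [hG0] at h0
  have hx3 := congrFun h0 0
  have hx2 := congrFun h0 1
  have hx1 := congrFun h0 2
  have hx00 := congrFun h0 3
  simp only [Matrix.mulVec, dotProduct, Fin.sum_univ_five, Matrix.of_apply, Matrix.cons_val,
    zero_mul, zero_add, add_zero, Pi.zero_apply, mul_eq_zero, neg_eq_zero, h2, false_or]
    at hx3 hx2 hx1 hx00
  simp only [Matrix.mulVec, dotProduct, Fin.sum_univ_five] at h1
  rw [hx00, hx1, hx2, hx3] at h1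
  simp only [mul_zero, zero_add, mul_eq_zero, hG14, false_or] at h1
  refine hx (funext fun i => ?_)
  fin_cases i
  exacts [hx00, hx1, hx2, hx3, h1]

theorem quadVal_hyperbolic {k R : Type*} [Field k] [CharZero k] [CommRing R] (φ : k →+* R)
    (x : Fin 5 → R) :
    quadVal ((!![0, 0, 0, 2⁻¹, 0; 0, 0, -2⁻¹, 0, 0; 0, -2⁻¹, 0, 0, 0; 2⁻¹, 0, 0, 0, 0;
      0, 0, 0, 0, 0] : Matrix (Fin 5) (Fin 5) k).map φ) x = x 0 * x 3 - x 1 * x 2 := by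
  have h : φ 2⁻¹ + φ 2⁻¹ = 1 := by
    rw [← map_add, ← map_one φ]
    congr 1
    norm_num
  simp only [quadVal, Matrix.mulVec, dotProduct, Fin.sum_univ_five, Matrix.map_apply,
    Matrix.of_apply, Matrix.cons_val, map_zero, map_neg]
  linear_combination (x 0 * x 3 - x 1 * x 2) * h

theorem exists_quadVal_eq_segreForm {k : Type*} [Field k] {G : Matrix (Fin 5) (Fin 5) k}
    (hG : G.IsSymm) (h4 : ∀ i, i ≠ 4 → G 4 i = 0) (h44 : G 4 4 ≠ 0) :
    ∃ (κ : k) (c : Fin 3 → Fin 3 → k), ∀ {R : Type*} [CommRing R] (φ : k →+* R) (x : Fin 5 → R),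
      quadVal (G.map φ) x = φ (G 4 4) * (x 4 ^ 2 - segreForm (fun i j => φ (c i j)) x) +
        φ κ * (x 0 * x 3 - x 1 * x 2) := by
  have hs : ∀ i j, G j i = G i j := fun i j => hG.apply i j
  refine ⟨-2 * G 1 2, fun i j => -(!![G 0 0, 2 * G 0 1, G 1 1; 2 * G 0 2, 2 * G 0 3 + 2 * G 1 2,
    2 * G 1 3; G 2 2, 2 * G 2 3, G 3 3] i j) / G 4 4, fun φ x => ?_⟩
  have hτ : ∀ a, φ (G 4 4) * φ (-a / G 4 4) = -φ a := fun a => by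
    rw [← map_mul, ← map_neg]
    congr 1
    field_simp
  have h14 := h4 1 (by decide)
  have h04 := h4 0 (by decide)
  have h24 := h4 2 (by decide)
  have h34 := h4 3 (by decide)
  simp only [quadVal, segreForm, Matrix.mulVec, dotProduct, Fin.sum_univ_five, Matrix.map_apply,
    Matrix.of_apply, Matrix.cons_val, hs 0 1, hs 0 2, hs 0 3, hs 1 2, hs 1 3, hs 2 3, hs 4 0,
    hs 4 1, hs 4 2, hs 4 3, h04, h14, h24, h34, map_zero]
  have e2 : φ 2 = 2 := map_ofNat φ 2
  have e01 := hτ (2 * G 0 1)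
  have e02 := hτ (2 * G 0 2)
  have e03 := hτ (2 * G 0 3 + 2 * G 1 2)
  have e13 := hτ (2 * G 1 3)
  have e23 := hτ (2 * G 2 3)
  have e12 : φ (-2 * G 1 2) = -2 * φ (G 1 2) := by rw [map_mul, map_neg, e2]
  rw [map_mul φ 2, e2] at e01 e02 e13 e23
  rw [map_add, map_mul φ 2, map_mul φ 2, e2] at e03
  rw [e12]
  linear_combination x 0 ^ 2 * hτ (G 0 0) + x 0 * x 1 * e01 + x 1 ^ 2 * hτ (G 1 1) +
    x 0 * x 2 * e02 + x 0 * x 3 * e03 + x 1 * x 3 * e13 + x 2 ^ 2 * hτ (G 2 2) +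
    x 2 * x 3 * e23 + x 3 ^ 2 * hτ (G 3 3)

end AdaptedBasis

section SegreModel

/-- The two quadratic forms cutting out a double cover of a quadric surface. -/
def segrePair {R : Type*} [CommRing R] (c : Fin 3 → Fin 3 → R) : Fin 2 → (Fin 5 → R) → R :=
  ![fun x => x 0 * x 3 - x 1 * x 2, fun x => x 4 ^ 2 - segreForm c x]

/-- The point of four-space above the image of a pair of points under the Segre embedding. -/
def segrePoint {R : Type*} [CommRing R] (a b : Fin 2 → R) (z : R) : Fin 5 → R :=
  ![a 0 * b 0, a 0 * b 1, a 1 * b 0, a 1 * b 1, z]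

theorem segreForm_segrePoint {R : Type*} [CommRing R] (c : Fin 3 → Fin 3 → R) (a b : Fin 2 → R)
    (z : R) : segreForm c (segrePoint a b z) = binQuad (conicCoeff c a) b := by
  simp only [segreForm, segrePoint, binQuad, conicCoeff, Matrix.cons_val]
  ring

theorem binQuad_conicCoeff_swap {R : Type*} [CommRing R] (c : Fin 3 → Fin 3 → R)
    (a b : Fin 2 → R) :
    binQuad (conicCoeff (fun i j => c j i) b) a = binQuad (conicCoeff c a) b := by
  simp only [binQuad, conicCoeff]
  ring

theorem exists_eq_mul_of_add_eq_zero {K : Type*} [Field K] {a : Fin 2 → K} (ha : a ≠ 0) {s t : K}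
    (h : a 0 * s + a 1 * t = 0) : ∃ r, s = r * a 1 ∧ t = -(r * a 0) := by
  by_cases h0 : a 0 = 0
  · have h1 : a 1 ≠ 0 := fun h1 => ha (funext fun i => by fin_cases i; exacts [h0, h1])
    refine ⟨s / a 1, by field_simp, ?_⟩
    rw [h0, zero_mul, zero_add, mul_eq_zero] at h
    simp [h.resolve_left h1, h0]
  · refine ⟨-t / a 0, ?_, by field_simp⟩
    field_simp
    linear_combination h

theorem IsSmoothPair.isNonsingularForm {K : Type*} [Field K] (h2 : (2 : K) ≠ 0)
    {c : Fin 3 → Fin 3 → K} (h : IsSmoothPair (segrePair c)) : IsNonsingularForm c := by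
  intro a b ha hb hGb hGa
  set x := segrePoint a b 0 with hx
  let g : Fin 4 → K := ![2 * c 0 0 * x 0 + c 0 1 * x 1 + c 1 0 * x 2 + c 1 1 * x 3,
    c 0 1 * x 0 + 2 * c 0 2 * x 1 + c 1 2 * x 3, c 1 0 * x 0 + 2 * c 2 0 * x 2 + c 2 1 * x 3,
    c 1 1 * x 0 + c 1 2 * x 1 + c 2 1 * x 2 + 2 * c 2 2 * x 3]
  have hx0 : x 0 = a 0 * b 0 := rfl
  have hx1 : x 1 = a 0 * b 1 := rfl
  have hx2 : x 2 = a 1 * b 0 := rfl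
  have hx3 : x 3 = a 1 * b 1 := rfl
  have hx4 : x 4 = 0 := rfl
  have hG0 := congrFun hGb 0
  have hG1 := congrFun hGb 1
  have hG2 := congrFun hGa 0
  have hG3 := congrFun hGa 1
  simp only [binGrad, conicCoeff, binQuad, Matrix.cons_val_zero, Matrix.cons_val_one,
    Pi.zero_apply] at hG0 hG1 hG2 hG3
  have hg0 : a 0 * g 0 + a 1 * g 2 = 0 := by
    simp only [g, Matrix.cons_val, hx0, hx1, hx2, hx3]
    linear_combination hG0
  have hg1 : a 0 * g 1 + a 1 * g 3 = 0 := by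
    simp only [g, Matrix.cons_val, hx0, hx1, hx2, hx3]
    linear_combination hG1
  have hg2 : b 0 * g 0 + b 1 * g 1 = 0 := by
    simp only [g, Matrix.cons_val, hx0, hx1, hx2, hx3]
    linear_combination hG2
  have hg3 : b 0 * g 2 + b 1 * g 3 = 0 := by
    simp only [g, Matrix.cons_val, hx0, hx1, hx2, hx3]
    linear_combination hG3
  obtain ⟨r, hr0, hr2⟩ := exists_eq_mul_of_add_eq_zero ha hg0
  obtain ⟨r', hr1, hr3⟩ := exists_eq_mul_of_add_eq_zero ha hg1
  have hrr : b 0 * r + b 1 * r' = 0 := by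
    rw [hr0, hr1] at hg2
    rw [hr2, hr3] at hg3
    by_contra hne
    refine ha (funext fun i => ?_)
    fin_cases i
    · exact (mul_eq_zero.mp (show (b 0 * r + b 1 * r') * a 0 = 0 by
        linear_combination -hg3)).resolve_left hne
    · exact (mul_eq_zero.mp (show (b 0 * r + b 1 * r') * a 1 = 0 by
        linear_combination hg2)).resolve_left hne
  obtain ⟨l, hl, hl'⟩ := exists_eq_mul_of_add_eq_zero hb hrr
  have hxne : x ≠ 0 := by
    intro h0
    obtain ⟨i, hi⟩ := Function.ne_iff.mp ha
    obtain ⟨j, hj⟩ := Function.ne_iff.mp hb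
    refine mul_ne_zero hi hj ?_
    fin_cases i <;> fin_cases j
    exacts [congrFun h0 0, congrFun h0 1, congrFun h0 2, congrFun h0 3]
  have hzero : ∀ i, segrePair c i x = 0 := by
    intro i
    fin_cases i
    · simp only [segrePair, Fin.zero_eta, Matrix.cons_val_zero, hx0, hx1, hx2, hx3]
      ring
    · have : 2 * binQuad (conicCoeff c a) b = 0 := by
        simp only [binQuad, conicCoeff]
        linear_combination b 0 * hG0 + b 1 * hG1
      simp only [segrePair, Fin.mk_one, Matrix.cons_val_one, Matrix.cons_val_fin_one]
      rw [hx4, hx, segreForm_segrePoint, (mul_eq_zero.mp this).resolve_left h2]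
      ring
  have := h x hxne hzero ![l, 1] fun v => by
    have e : ∑ i, (![l, 1] : Fin 2 → K) i * QuadraticMap.polar (segrePair c i) x v =
        l * (x 3 * v 0 - x 2 * v 1 - x 1 * v 2 + x 0 * v 3) -
          (g 0 * v 0 + g 1 * v 1 + g 2 * v 2 + g 3 * v 3) := by
      simp only [Fin.sum_univ_two, QuadraticMap.polar, segrePair, segreForm, Pi.add_apply, g,
        Matrix.cons_val, hx4, Matrix.cons_val_zero, Matrix.cons_val_one]
      ring
    rw [e, hr0, hr1, hr2, hr3, hl, hl', hx0, hx1, hx2, hx3]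
    ring
  exact one_ne_zero (congrFun this 1)

theorem exists_not_smul {K : Type*} [Field K] (b : Fin 2 → K) :
    ∃ b' : Fin 2 → K, ∀ c : K, b' ≠ c • b := by
  by_contra! h
  obtain ⟨r, hr⟩ := h ![1, 0]
  obtain ⟨r', hr'⟩ := h ![0, 1]
  have h0 : 1 = r * b 0 := congrFun hr 0
  have h1 : 0 = r * b 1 := congrFun hr 1
  have h3 : 1 = r' * b 1 := congrFun hr' 1
  refine one_ne_zero (α := K) ?_
  linear_combination h0 + b 0 * r * h3 - r' * b 0 * h1

theorem exists_line_of_conicDisc_eq_zero {K : Type*} [Field K] [IsAlgClosed K]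
    {c : Fin 3 → Fin 3 → K} {a b : Fin 2 → K} {z : K} (ha : a ≠ 0) (hdisc : conicDisc c a = 0)
    (hz : z ^ 2 = binQuad (conicCoeff c a) b) :
    ∃ w : Fin 5 → K, (∀ r : K, w ≠ r • segrePoint a b z) ∧
      ∀ s t : K, ∀ i, segrePair c i (s • segrePoint a b z + t • w) = 0 := by
  obtain ⟨l, hl⟩ : ∃ l : Fin 2 → K, ∀ b, binQuad (conicCoeff c a) b = (l 0 * b 0 + l 1 * b 1) ^ 2 := by
    obtain ⟨l₀, h₀⟩ := IsAlgClosed.exists_pow_nat_eq (conicCoeff c a 0) two_pos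
    obtain ⟨l₁, h₁⟩ := IsAlgClosed.exists_pow_nat_eq (conicCoeff c a 2) two_pos
    have : (conicCoeff c a 1 - 2 * l₀ * l₁) * (conicCoeff c a 1 + 2 * l₀ * l₁) = 0 := by
      rw [conicDisc, qdisc, ← h₀, ← h₁] at hdisc
      linear_combination hdisc
    rcases mul_eq_zero.mp this with h | h
    · refine ⟨![l₀, l₁], fun b => ?_⟩
      simp only [binQuad, Matrix.cons_val_zero, Matrix.cons_val_one]
      linear_combination b 0 * b 1 * h - b 0 ^ 2 * h₀ - b 1 ^ 2 * h₁
    · refine ⟨![l₀, -l₁], fun b => ?_⟩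
      simp only [binQuad, Matrix.cons_val_zero, Matrix.cons_val_one]
      linear_combination b 0 * b 1 * h - b 0 ^ 2 * h₀ - b 1 ^ 2 * h₁
  obtain ⟨l, hl, hlz⟩ : ∃ l : Fin 2 → K,
      (∀ b, binQuad (conicCoeff c a) b = (l 0 * b 0 + l 1 * b 1) ^ 2) ∧
        z = l 0 * b 0 + l 1 * b 1 := by
    rcases sq_eq_sq_iff_eq_or_eq_neg.mp (hz.trans (hl b)) with h | h
    · exact ⟨l, hl, h⟩
    · refine ⟨-l, fun b => (hl b).trans ?_, h.trans ?_⟩ <;> simp only [Pi.neg_apply] <;> ring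
  obtain ⟨b', hb'⟩ := exists_not_smul b
  refine ⟨segrePoint a b' (l 0 * b' 0 + l 1 * b' 1), fun r hr => ?_, fun s t i => ?_⟩
  · obtain ⟨i, hi⟩ := Function.ne_iff.mp ha
    refine hb' r (funext fun j => mul_left_cancel₀ hi ?_)
    have h0 : a 0 * b' 0 = r * (a 0 * b 0) := congrFun hr 0
    have h1 : a 0 * b' 1 = r * (a 0 * b 1) := congrFun hr 1
    have h2 : a 1 * b' 0 = r * (a 1 * b 0) := congrFun hr 2
    have h3 : a 1 * b' 1 = r * (a 1 * b 1) := congrFun hr 3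
    simp only [Pi.smul_apply, smul_eq_mul]
    fin_cases i <;> fin_cases j
    · exact h0.trans (mul_left_comm _ _ _)
    · exact h1.trans (mul_left_comm _ _ _)
    · exact h2.trans (mul_left_comm _ _ _)
    · exact h3.trans (mul_left_comm _ _ _)
  · have e : s • segrePoint a b z + t • segrePoint a b' (l 0 * b' 0 + l 1 * b' 1) =
        segrePoint a (s • b + t • b') (l 0 * (s • b + t • b') 0 + l 1 * (s • b + t • b') 1) := by
      ext i
      rw [hlz]
      fin_cases i <;> simp [segrePoint] <;> ring
    rw [e]
    fin_cases i
    · simp only [segrePair, Fin.zero_eta, Matrix.cons_val_zero, segrePoint, Matrix.cons_val]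
      ring
    · simp only [segrePair, Fin.mk_one, Matrix.cons_val_one, Matrix.cons_val_fin_one]
      rw [segreForm_segrePoint, hl, segrePoint]
      simp

theorem exists_line_of_conicDisc_swap_eq_zero {K : Type*} [Field K] [IsAlgClosed K]
    {c : Fin 3 → Fin 3 → K} {a b : Fin 2 → K} {z : K} (hb : b ≠ 0)
    (hdisc : conicDisc (fun i j => c j i) b = 0) (hz : z ^ 2 = binQuad (conicCoeff c a) b) :
    ∃ w : Fin 5 → K, (∀ r : K, w ≠ r • segrePoint a b z) ∧
      ∀ s t : K, ∀ i, segrePair c i (s • segrePoint a b z + t • w) = 0 := by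
  obtain ⟨w, hw, hw'⟩ := exists_line_of_conicDisc_eq_zero hb hdisc
    (hz.trans (binQuad_conicCoeff_swap c a b).symm)
  refine ⟨![w 0, w 2, w 1, w 3, w 4], fun r hr => hw r (funext fun i => ?_), fun s t i => ?_⟩
  · have h0 : w 0 = r * (a 0 * b 0) := congrFun hr 0
    have h1 : w 2 = r * (a 0 * b 1) := congrFun hr 1
    have h2 : w 1 = r * (a 1 * b 0) := congrFun hr 2
    have h3 : w 3 = r * (a 1 * b 1) := congrFun hr 3
    have h4 : w 4 = r * z := congrFun hr 4
    simp only [Pi.smul_apply, smul_eq_mul, segrePoint]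
    fin_cases i
    · exact h0.trans (congrArg _ (mul_comm _ _))
    · exact h2.trans (congrArg _ (mul_comm _ _))
    · exact h1.trans (congrArg _ (mul_comm _ _))
    · exact h3.trans (congrArg _ (mul_comm _ _))
    · exact h4
  · have h := hw' s t i
    fin_cases i
    · simp only [segrePair, segrePoint, Fin.zero_eta, Pi.add_apply, Pi.smul_apply, smul_eq_mul,
        Matrix.cons_val] at h ⊢
      linear_combination h
    · simp only [segrePair, segrePoint, segreForm, Fin.mk_one, Pi.add_apply, Pi.smul_apply,
        smul_eq_mul, Matrix.cons_val] at h ⊢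
      linear_combination h

end SegreModel

section ExistsSegreModel

/-- The coordinate change `N` identifies the intersection of two quadrics with the double cover
of a quadric surface given by a form of bidegree `(2, 2)` with integral coefficients `c`. -/
structure IsSegreModel {k : Type*} [Field k] [NumberField k]
    (Q : Fin 2 → MvPolynomial (Fin 5) k) (N : Matrix (Fin 5) (Fin 5) k)
    (c : Fin 3 → Fin 3 → 𝓞 k) : Prop where
  det_ne_zero : N.det ≠ 0
  isNonsingularForm : IsNonsingularForm fun i j => algebraMap k (AlgebraicClosure k) (c i j)
  eval_eq_zero_iff : ∀ x : Fin 5 → AlgebraicClosure k,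
    (∀ a, MvPolynomial.eval ((N.map (algebraMap k (AlgebraicClosure k))).mulVec x)
      (MvPolynomial.map (algebraMap k (AlgebraicClosure k)) (Q a)) = 0) ↔
    ∀ i, segrePair (fun i j => algebraMap k (AlgebraicClosure k) (c i j)) i x = 0

theorem exists_isSegreModel {k : Type*} [Field k] [NumberField k]
    {Q : Fin 2 → MvPolynomial (Fin 5) k} (hdeg : ∀ a, (Q a).IsHomogeneous 2)
    (hsmooth : ∀ z : Fin 5 → AlgebraicClosure k, z ≠ 0 →
      (∀ a, MvPolynomial.eval z
        (MvPolynomial.map (algebraMap k (AlgebraicClosure k)) (Q a)) = 0) →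
      Matrix.rank (Matrix.of fun (a : Fin 2) (i : Fin 5) =>
        MvPolynomial.eval z (MvPolynomial.pderiv i
          (MvPolynomial.map (algebraMap k (AlgebraicClosure k)) (Q a)))) = 2)
    (hconic : ∃ (q : MvPolynomial (Fin 3) k) (L : Matrix (Fin 5) (Fin 3) k),
      q.IsHomogeneous 2 ∧ L.rank = 3 ∧
      (∀ y : Fin 3 → AlgebraicClosure k, y ≠ 0 →
        MvPolynomial.eval y (MvPolynomial.map (algebraMap k (AlgebraicClosure k)) q) = 0 →
        (fun i => MvPolynomial.eval y (MvPolynomial.pderiv i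
          (MvPolynomial.map (algebraMap k (AlgebraicClosure k)) q))) ≠ 0) ∧
      (∀ y : Fin 3 → AlgebraicClosure k,
        MvPolynomial.eval y (MvPolynomial.map (algebraMap k (AlgebraicClosure k)) q) = 0 →
        ∀ a, MvPolynomial.eval ((L.map (algebraMap k (AlgebraicClosure k))).mulVec y)
          (MvPolynomial.map (algebraMap k (AlgebraicClosure k)) (Q a)) = 0)) :
    ∃ N c, IsSegreModel Q N c := by
  obtain ⟨S, hS, hQ, hQ', hsm⟩ := exists_matrix_pair hdeg hsmooth
  obtain ⟨q, L, hq, hL, hns, hX⟩ := hconic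
  obtain ⟨s, hs, hsq⟩ := exists_matrix_of_isHomogeneous hq
  set φ := algebraMap k (AlgebraicClosure k) with hφ
  have hdet : s.det ≠ 0 := by
    intro h
    obtain ⟨y, hy, hy0⟩ := Matrix.exists_mulVec_eq_zero_iff.mpr h
    have h0 : (s.map φ).mulVec (fun i => φ (y i)) = 0 := by
      rw [hφ, map_mulVec_algebraMap, hy0]
      ext
      simp
    refine hns (fun i => φ (y i)) (fun h => hy (funext fun i => ?_)) ?_ (funext fun i => ?_)
    · simpa using congrFun h i
    · rw [(hsq _ _).1, quadVal, ← hφ, h0, dotProduct_zero]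
    · rw [(hsq _ _).2, ← hφ, h0, Pi.zero_apply, mul_zero]
  obtain ⟨T, hT, hL0, hsmT, hiff⟩ := exists_pencil_adapted hS hsm hs hdet (L := L)
    fun y hy a => by rw [← hQ']; exact hX y (by rw [(hsq _ _).1]; exact hy) a
  obtain ⟨N, hN, hG0, hG1, hG4⟩ := exists_gram_eq hT hsmT hL hL0
  have hsym : (N.transpose * T 1 * N).IsSymm := by
    simp [Matrix.IsSymm, Matrix.transpose_mul, (hT 1).eq, Matrix.mul_assoc]
  obtain ⟨κ, c₀, hc₀⟩ := exists_quadVal_eq_segreForm hsym hG1 hG4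
  set τ := (N.transpose * T 1 * N) 4 4
  obtain ⟨⟨m, hm⟩, hmc⟩ := IsLocalization.exist_integer_multiples_of_finite
    (nonZeroDivisors (𝓞 k)) fun p : Fin 3 × Fin 3 => c₀ p.1 p.2
  choose c₁ hc₁ using hmc
  have hm0 : (m : k) ≠ 0 := RingOfIntegers.coe_ne_zero_iff.mpr (nonZeroDivisors.ne_zero hm)
  have hc₁' : ∀ i j, (c₁ (i, j) : k) = m * c₀ i j := fun i j => by
    have := hc₁ (i, j)
    simp only [Algebra.smul_def] at this
    exact this
  set c : Fin 3 → Fin 3 → 𝓞 k := fun i j => m * c₁ (i, j) with hc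
  have hcc : ∀ i j, φ (c i j) = φ m ^ 2 * φ (c₀ i j) := fun i j => by
    rw [hc]
    simp only [map_mul, hc₁']
    ring
  set N' := N * Matrix.diagonal ![1, 1, 1, 1, (m : k)⁻¹] with hN'
  have hdet' : N'.det ≠ 0 := by
    rw [hN', Matrix.det_mul, Matrix.det_diagonal]
    refine mul_ne_zero hN ?_
    simp [Fin.prod_univ_five, hm0]
  have hφm : φ m ≠ 0 := (map_ne_zero φ).mpr hm0
  have hφτ : φ τ ≠ 0 := (map_ne_zero φ).mpr hG4
  have hmul : ∀ x : Fin 5 → AlgebraicClosure k, (N'.map φ).mulVec x =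
      (N.map φ).mulVec ![x 0, x 1, x 2, x 3, (φ m)⁻¹ * x 4] := fun x => by
    rw [hN', Matrix.map_mul, ← Matrix.mulVec_mulVec]
    congr 1
    ext i
    rw [Matrix.diagonal_map (map_zero φ), Matrix.mulVec_diagonal]
    fin_cases i <;> simp
  have h0 : ∀ x : Fin 5 → AlgebraicClosure k, quadVal ((T 0).map φ) ((N'.map φ).mulVec x) =
      x 0 * x 3 - x 1 * x 2 := fun x => by
    rw [hmul, quadVal_map_mulVec, hG0, quadVal_hyperbolic]
    rfl
  have h1 : ∀ x : Fin 5 → AlgebraicClosure k, quadVal ((T 1).map φ) ((N'.map φ).mulVec x) =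
      φ τ * ((φ m)⁻¹ ^ 2 * x 4 ^ 2 - segreForm (fun i j => φ (c₀ i j)) x) +
        φ κ * (x 0 * x 3 - x 1 * x 2) := fun x => by
    rw [hmul, quadVal_map_mulVec, hc₀ φ, ← mul_pow]
    rfl
  have hinj : Function.Injective (N'.map φ).mulVec := by
    refine Matrix.mulVec_injective_iff_isUnit.mpr ?_
    rw [Matrix.isUnit_iff_isUnit_det, ← RingHom.mapMatrix_apply, ← RingHom.map_det, isUnit_iff_ne_zero]
    exact (map_ne_zero φ).mpr hdet'
  have hcomp := hsmT.comp (LinearEquiv.ofInjectiveEndo (N'.map φ).mulVecLin hinj).toAddEquiv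
  have hlin := hcomp.of_lin_comb (g := !![1, 0; -(φ κ * φ m ^ 2 / φ τ), φ m ^ 2 / φ τ])
    (F' := segrePair fun i j => φ (c i j)) ?_ ?_
  · refine ⟨N', c, hdet', hlin.1.isNonsingularForm ?_, fun x => ?_⟩
    · rw [← map_ofNat φ 2]
      exact (map_ne_zero _).mpr two_ne_zero
    · rw [hlin.2 x]
      simp only [hQ', ← hφ]
      rw [← hiff]
      rfl
  · rw [Matrix.det_fin_two_of]
    simp [hφm, hφτ]
  · intro a x
    have e : ∀ b, quadVal ((T b).map (algebraMap k (AlgebraicClosure k)))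
      ((LinearEquiv.ofInjectiveEndo (N'.map φ).mulVecLin hinj).toAddEquiv x) =
        quadVal ((T b).map φ) ((N'.map φ).mulVec x) := fun b => rfl
    rw [Fin.sum_univ_two, e, e, h0, h1]
    fin_cases a
    · simp [segrePair]
    · simp only [segrePair, segreForm, hcc, Fin.mk_one, Matrix.cons_val_one, Matrix.cons_val_fin_one,
        Matrix.of_apply, Matrix.cons_val_zero]
      field_simp
      ring

end ExistsSegreModel

section Parametrization

theorem exists_eq_mul_of_mul_eq {k : Type*} [Field k] {a b : Fin 2 → 𝓞 k} (ha : a ≠ 0) (hb : b ≠ 0)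
    (h : a 0 * b 1 = b 0 * a 1) : ∃ r : k, r ≠ 0 ∧ ∀ i, (a i : k) = r * b i := by
  have h' : (a 0 : k) * b 1 = b 0 * a 1 := by exact_mod_cast congrArg (algebraMap (𝓞 k) k) h
  obtain ⟨r, hr⟩ : ∃ r : k, ∀ i, (a i : k) = r * b i := by
    by_cases h0 : (b 0 : k) = 0
    · have h1 : (b 1 : k) ≠ 0 := fun h1 => hb (funext fun i => by
        fin_cases i
        exacts [RingOfIntegers.coe_eq_zero_iff.mp h0, RingOfIntegers.coe_eq_zero_iff.mp h1])
      refine ⟨a 1 / b 1, fun i => ?_⟩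
      fin_cases i
      · rw [h0, zero_mul, mul_eq_zero] at h'
        simp [h'.resolve_right h1, h0]
      · simp [h1]
    · refine ⟨a 0 / b 0, fun i => ?_⟩
      fin_cases i
      · simp [h0]
      · simp only [Fin.mk_one]
        field_simp
        linear_combination -h'
  refine ⟨r, fun h0 => ha (funext fun i => ?_), hr⟩
  have := hr i
  rw [h0, zero_mul] at this
  exact RingOfIntegers.coe_eq_zero_iff.mp this

theorem exists_segre_factorization {R : Type*} [CommRing R] {v : Fin 4 → R} (hv : v ≠ 0)
    (h : v 0 * v 3 = v 1 * v 2) : ∃ (t : R) (a b : Fin 2 → R), t ≠ 0 ∧ a ≠ 0 ∧ b ≠ 0 ∧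
      (fun i => t * v i) = ![a 0 * b 0, a 0 * b 1, a 1 * b 0, a 1 * b 1] := by
  obtain ⟨i, hi⟩ := Function.ne_iff.mp hv
  fin_cases i
  · refine ⟨v 0, ![v 0, v 2], ![v 0, v 1], hi, fun h => hi (congrFun h 0),
      fun h => hi (congrFun h 0), funext fun i => ?_⟩
    fin_cases i <;> simp only [Fin.zero_eta, Fin.mk_one, Fin.reduceFinMk, Matrix.cons_val]
    · ring
    · rw [h]; ring
  · refine ⟨v 1, ![v 1, v 3], ![v 0, v 1], hi, fun h => hi (congrFun h 0),
      fun h => hi (congrFun h 1), funext fun i => ?_⟩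
    fin_cases i <;> simp only [Fin.zero_eta, Fin.mk_one, Fin.reduceFinMk, Matrix.cons_val]
    · rw [← h]; ring
    · ring
  · refine ⟨v 2, ![v 0, v 2], ![v 2, v 3], hi, fun h => hi (congrFun h 1),
      fun h => hi (congrFun h 0), funext fun i => ?_⟩
    fin_cases i <;> simp only [Fin.zero_eta, Fin.mk_one, Fin.reduceFinMk, Matrix.cons_val]
    · ring
    · rw [h]; ring
  · refine ⟨v 3, ![v 1, v 3], ![v 2, v 3], hi, fun h => hi (congrFun h 1),
      fun h => hi (congrFun h 1), funext fun i => ?_⟩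
    fin_cases i <;> simp only [Fin.zero_eta, Fin.mk_one, Fin.reduceFinMk, Matrix.cons_val]
    · rw [← h]; ring
    · ring

variable {k : Type*} [Field k] [NumberField k]

theorem exists_segrePoint_eq {S : Set (Fin 2 → 𝓞 k)} (hS0 : ∀ a ∈ S, a ≠ 0)
    (hrep : ∀ a : Fin 2 → 𝓞 k, a ≠ 0 → ∃ a' ∈ S, a 0 * a' 1 = a' 0 * a 1)
    {c : Fin 3 → Fin 3 → 𝓞 k} {v : Fin 5 → 𝓞 k} (hv : v ≠ 0) (h : ∀ i, segrePair c i v = 0) :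
    ∃ p ∈ S, ∃ q ∈ S, ∃ (z : 𝓞 k) (l : k), l ≠ 0 ∧
      (∀ i, (v i : k) = l * (segrePoint p q z i : 𝓞 k)) ∧ z ^ 2 = binQuad (conicCoeff c p) q ∧
      (fun i : Fin 4 => v i.castSucc) ≠ 0 ∧
      heightFn p * heightFn q = heightFn fun i : Fin 4 => v i.castSucc := by
  have h0 : v 0 * v 3 - v 1 * v 2 = 0 := h 0
  have h1 : v 4 ^ 2 - segreForm c v = 0 := h 1
  have hv' : (fun i : Fin 4 => v i.castSucc) ≠ 0 := by
    intro hz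
    have e0 : v 0 = 0 := congrFun hz 0
    have e1 : v 1 = 0 := congrFun hz 1
    have e2 : v 2 = 0 := congrFun hz 2
    have e3 : v 3 = 0 := congrFun hz 3
    refine hv (funext fun i => ?_)
    fin_cases i
    exacts [e0, e1, e2, e3, by simpa [segreForm, e0, e1, e2, e3] using h1]
  obtain ⟨t, a, b, ht, ha, hb, htv⟩ := exists_segre_factorization hv' (sub_eq_zero.mp h0)
  obtain ⟨p, hp, hap⟩ := hrep a ha
  obtain ⟨q, hq, hbq⟩ := hrep b hb
  obtain ⟨α, hα, hα'⟩ := exists_eq_mul_of_mul_eq ha (hS0 p hp) hap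
  obtain ⟨β, hβ, hβ'⟩ := exists_eq_mul_of_mul_eq hb (hS0 q hq) hbq
  have htk : (t : k) ≠ 0 := RingOfIntegers.coe_ne_zero_iff.mpr ht
  set l := α * β / t with hl
  have hl0 : l ≠ 0 := div_ne_zero (mul_ne_zero hα hβ) htk
  have key : ∀ (i : Fin 5) (i' j' : Fin 2), t * v i = a i' * b j' →
      (v i : k) = l * (p i' * q j') := by
    intro i i' j' he
    have he' : (t : k) * v i = a i' * b j' := by exact_mod_cast congrArg (algebraMap (𝓞 k) k) he
    rw [hα', hβ'] at he'
    rw [hl]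
    field_simp
    linear_combination he'
  have k0 := key 0 0 0 (congrFun htv 0)
  have k1 := key 1 0 1 (congrFun htv 1)
  have k2 := key 2 1 0 (congrFun htv 2)
  have k3 := key 3 1 1 (congrFun htv 3)
  have hz2 : ((v 4 : k) / l) ^ 2 = (binQuad (conicCoeff c p) q : 𝓞 k) := by
    have h1' : (v 4 : k) ^ 2 = (segreForm c v : 𝓞 k) := by
      exact_mod_cast congrArg (algebraMap (𝓞 k) k) (sub_eq_zero.mp h1)
    rw [div_pow, h1', div_eq_iff (pow_ne_zero 2 hl0)]
    simp only [segreForm, binQuad, conicCoeff, map_add, map_mul, map_pow, k0, k1, k2, k3]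
    ring
  obtain ⟨z, hz⟩ : ∃ z : 𝓞 k, (z : k) = v 4 / l :=
    ⟨⟨_, IsIntegral.of_pow two_pos (hz2 ▸ RingOfIntegers.isIntegral_coe _)⟩, rfl⟩
  refine ⟨p, hp, q, hq, z, l, hl0, fun i => ?_, ?_, hv', ?_⟩
  · fin_cases i
    · simpa [segrePoint] using k0
    · simpa [segrePoint] using k1
    · simpa [segrePoint] using k2
    · simpa [segrePoint] using k3
    · simp only [segrePoint, Fin.reduceFinMk, Matrix.cons_val]
      rw [hz]
      field_simp
  · refine RingOfIntegers.coe_injective ?_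
    exact ((map_pow (algebraMap (𝓞 k) k) z 2).trans (congrArg (· ^ 2) hz)).trans hz2
  · rw [← heightFn_smul ht (fun i : Fin 4 => v i.castSucc), htv, heightFn_segre,
      heightFn_eq_of_mul_eq ha (hS0 p hp) hap, heightFn_eq_of_mul_eq hb (hS0 q hq) hbq]

theorem exists_integral_adjugate (N : Matrix (Fin 5) (Fin 5) k) :
    ∃ (Λ : Matrix (Fin 5) (Fin 5) (𝓞 k)) (m : 𝓞 k), m ≠ 0 ∧
      Λ.map (fun x => (x : k)) = (m : k) • N⁻¹ := by
  obtain ⟨⟨m, hm⟩, hmc⟩ := IsLocalization.exist_integer_multiples_of_finite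
    (nonZeroDivisors (𝓞 k)) fun p : Fin 5 × Fin 5 => N⁻¹ p.1 p.2
  choose Λ hΛ using hmc
  refine ⟨Matrix.of fun i j => Λ (i, j), m, nonZeroDivisors.ne_zero hm, ?_⟩
  ext i j
  have := hΛ (i, j)
  simp only [Algebra.smul_def] at this
  exact this

end Parametrization

section SegreParametrization

variable {k : Type*} [Field k] [NumberField k] {Q : Fin 2 → MvPolynomial (Fin 5) k}
  {N : Matrix (Fin 5) (Fin 5) k} {c : Fin 3 → Fin 3 → 𝓞 k}

theorem map_segrePair {R R' : Type*} [CommRing R] [CommRing R'] (φ : R →+* R')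
    (c : Fin 3 → Fin 3 → R) (i : Fin 2) (x : Fin 5 → R) :
    φ (segrePair c i x) = segrePair (fun i j => φ (c i j)) i (fun i => φ (x i)) := by
  fin_cases i <;> simp [segrePair, segreForm]

theorem segrePair_smul {R : Type*} [CommRing R] (c : Fin 3 → Fin 3 → R) (i : Fin 2) (t : R)
    (x : Fin 5 → R) : segrePair c i (t • x) = t ^ 2 * segrePair c i x := by
  fin_cases i <;> simp [segrePair, segreForm] <;> ring

theorem map_segrePoint {R R' : Type*} [CommRing R] [CommRing R'] (φ : R →+* R')
    (a b : Fin 2 → R) (z : R) :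
    (fun i => φ (segrePoint a b z i)) =
      segrePoint (fun i => φ (a i)) (fun i => φ (b i)) (φ z) := by
  ext i
  fin_cases i <;> simp [segrePoint]

theorem map_binQuad {R R' : Type*} [CommRing R] [CommRing R'] (φ : R →+* R')
    (g : Fin 3 → R) (a : Fin 2 → R) :
    φ (binQuad g a) = binQuad (fun i => φ (g i)) (fun i => φ (a i)) := by
  simp [binQuad]

theorem IsSegreModel.segrePair_eq_zero (h : IsSegreModel Q N c) {x : Fin 5 → k}
    (hx : ∀ a, MvPolynomial.eval (N.mulVec x) (Q a) = 0) (i : Fin 2) :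
    segrePair (fun i j => (c i j : k)) i x = 0 := by
  set φ := algebraMap k (AlgebraicClosure k) with hφ
  have := (h.eval_eq_zero_iff fun i => φ (x i)).mp (fun a => by
    rw [hφ, map_mulVec_algebraMap, ← hφ]
    have := congrArg φ (hx a)
    rw [map_zero, MvPolynomial.eval, MvPolynomial.coe_eval₂Hom, MvPolynomial.eval₂_comp_left,
      RingHom.comp_id] at this
    rw [MvPolynomial.eval_map]
    exact this) i
  rw [← hφ, ← map_segrePair φ (fun i j => (c i j : k))] at this
  exact (map_eq_zero φ).mp this

theorem IsSegreModel.mulVec_injective (h : IsSegreModel Q N c) :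
    Function.Injective (N.map (algebraMap k (AlgebraicClosure k))).mulVec := by
  refine Matrix.mulVec_injective_iff_isUnit.mpr ?_
  rw [Matrix.isUnit_iff_isUnit_det, ← RingHom.mapMatrix_apply, ← RingHom.map_det,
    isUnit_iff_ne_zero]
  exact (map_ne_zero _).mpr h.det_ne_zero

theorem IsSegreModel.liesOnLineIn (h : IsSegreModel Q N c) {p q : Fin 2 → 𝓞 k} {z : 𝓞 k} {μ : k}
    (hp : p ≠ 0) (hq : q ≠ 0) (hz : z ^ 2 = binQuad (conicCoeff c p) q) {y : Fin 5 → k}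
    (hy : y = μ • N.mulVec fun i => ((segrePoint p q z i : 𝓞 k) : k))
    (hdisc : conicDisc c p = 0 ∨ conicDisc (fun i j => c j i) q = 0) :
    liesOnLineIn (fun a => MvPolynomial.map (algebraMap k (AlgebraicClosure k)) (Q a))
      fun i => algebraMap k (AlgebraicClosure k) (y i) := by
  set φ := algebraMap k (AlgebraicClosure k) with hφ
  set ψ : 𝓞 k →+* AlgebraicClosure k := φ.comp (algebraMap (𝓞 k) k) with hψ
  have hψinj : Function.Injective ψ := φ.injective.comp RingOfIntegers.coe_injective
  have hne : ∀ a : Fin 2 → 𝓞 k, a ≠ 0 → (fun i => ψ (a i)) ≠ 0 := fun a ha h0 =>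
    ha (funext fun i => (map_eq_zero_iff ψ hψinj).mp (congrFun h0 i))
  have hz' : ψ z ^ 2 = binQuad (conicCoeff (fun i j => ψ (c i j)) fun i => ψ (p i))
      fun i => ψ (q i) := by
    rw [← map_pow, hz, map_binQuad]
    simp only [map_conicCoeff]
  obtain ⟨w, hw, hw'⟩ : ∃ w : Fin 5 → AlgebraicClosure k,
      (∀ r, w ≠ r • segrePoint (fun i => ψ (p i)) (fun i => ψ (q i)) (ψ z)) ∧
      ∀ s t : AlgebraicClosure k, ∀ i, segrePair (fun i j => ψ (c i j)) i
        (s • segrePoint (fun i => ψ (p i)) (fun i => ψ (q i)) (ψ z) + t • w) = 0 := by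
    rcases hdisc with h0 | h0
    · exact exists_line_of_conicDisc_eq_zero (hne p hp) (by rw [← map_conicDisc, h0, map_zero]) hz'
    · refine exists_line_of_conicDisc_swap_eq_zero (hne q hq) ?_ hz'
      rw [← map_conicDisc ψ (fun i j => c j i), h0, map_zero]
  have hy' : (fun i => φ (y i)) = φ μ • (N.map φ).mulVec
      (segrePoint (fun i => ψ (p i)) (fun i => ψ (q i)) (ψ z)) := by
    rw [← map_segrePoint ψ]
    have : (fun i => ψ (segrePoint p q z i)) = fun i => φ ((segrePoint p q z i : 𝓞 k) : k) := rfl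
    rw [this, hφ, map_mulVec_algebraMap, hy]
    ext i
    simp
  refine ⟨(N.map φ).mulVec w, fun r hr => ?_, fun s t a => ?_⟩
  · rw [hy', smul_smul, ← Matrix.mulVec_smul] at hr
    exact hw _ (h.mulVec_injective hr)
  · rw [hy', smul_smul, ← Matrix.mulVec_smul, ← Matrix.mulVec_smul, ← Matrix.mulVec_add]
    exact (h.eval_eq_zero_iff _).mpr (fun i => hw' _ _ i) a

theorem IsSegreModel.exists_parametrization (h : IsSegreModel Q N c) {S : Set (Fin 2 → 𝓞 k)}
    (hS0 : ∀ a ∈ S, a ≠ 0)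
    (hrep : ∀ a : Fin 2 → 𝓞 k, a ≠ 0 → ∃ a' ∈ S, a 0 * a' 1 = a' 0 * a 1) :
    ∃ C > 0, ∀ y : Fin 5 → 𝓞 k, y ≠ 0 →
      (∀ a, MvPolynomial.eval (fun i => (y i : k)) (Q a) = 0) →
      ∃ p ∈ S, ∃ q ∈ S, ∃ (z : 𝓞 k) (μ : k), μ ≠ 0 ∧ z ^ 2 = binQuad (conicCoeff c p) q ∧
        (fun i => (y i : k)) = μ • N.mulVec (fun i => ((segrePoint p q z i : 𝓞 k) : k)) ∧
        heightFn p * heightFn q ≤ C * heightFn y := by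
  obtain ⟨Λ, m, hm, hΛ⟩ := exists_integral_adjugate N
  obtain ⟨C, hC, H⟩ := exists_heightFn_mulVec_le (Λ.submatrix Fin.castSucc id)
  have hmk : (m : k) ≠ 0 := RingOfIntegers.coe_ne_zero_iff.mpr hm
  have hdet : IsUnit N.det := isUnit_iff_ne_zero.mpr h.det_ne_zero
  refine ⟨C, hC, fun y hy hy0 => ?_⟩
  have hyk : (fun i => (y i : k)) ≠ 0 := fun h0 =>
    hy (funext fun i => RingOfIntegers.coe_eq_zero_iff.mp (congrFun h0 i))
  set v := Λ.mulVec y with hv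
  have hvk : (fun i => (v i : k)) = (m : k) • N⁻¹.mulVec fun i => (y i : k) := by
    rw [← Matrix.smul_mulVec, ← hΛ]
    ext i
    simp only [hv, Matrix.mulVec, dotProduct, map_sum, map_mul, Matrix.map_apply]
  have hNv : N.mulVec (fun i => (v i : k)) = (m : k) • fun i => (y i : k) := by
    rw [hvk, Matrix.mulVec_smul, Matrix.mulVec_mulVec, Matrix.mul_nonsing_inv _ hdet,
      Matrix.one_mulVec]
  have hv0 : v ≠ 0 := by
    intro h0
    rw [h0] at hNv
    refine smul_ne_zero hmk hyk (hNv.symm.trans ?_)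
    ext i
    simp [Matrix.mulVec, dotProduct]
  have hpair : ∀ i, segrePair c i v = 0 := fun i => by
    have h0 := h.segrePair_eq_zero (x := N⁻¹.mulVec fun i => (y i : k)) (fun a => by
      rw [Matrix.mulVec_mulVec, Matrix.mul_nonsing_inv _ hdet, Matrix.one_mulVec]
      exact hy0 a) i
    refine RingOfIntegers.coe_injective ?_
    rw [map_segrePair, hvk, segrePair_smul, h0, mul_zero, map_zero]
  obtain ⟨p, hp, q, hq, z, l, hl, hvl, hz, hne, hht⟩ := exists_segrePoint_eq hS0 hrep hv0 hpair
  refine ⟨p, hp, q, hq, z, l / m, div_ne_zero hl hmk, hz, ?_, ?_⟩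
  · have : (fun i => (v i : k)) = l • fun i => ((segrePoint p q z i : 𝓞 k) : k) := funext hvl
    rw [this, Matrix.mulVec_smul] at hNv
    rw [div_eq_inv_mul, mul_smul, hNv, smul_smul, inv_mul_cancel₀ hmk, one_smul]
  · rw [hht]
    exact H y hne

end SegreParametrization

section Count

variable {k : Type*} [Field k] [NumberField k]

theorem exists_card_triples_le_of_disc_ne_zero {S : Set (Fin 2 → 𝓞 k)} {T : (Fin 2 → 𝓞 k) → ℝ}
    {C₀ : ℝ} (hC₀ : 1 ≤ C₀) (hS : IsReducedSystem S T C₀) {c : Fin 3 → Fin 3 → 𝓞 k}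
    (hc : IsSmoothFibration c) (hc' : IsSmoothFibration fun i j => c j i) {ε : ℝ} (hε : 0 < ε) :
    ∃ C > 0, ∀ B : ℝ, 1 ≤ B → ∀ s : Finset ((Fin 2 → 𝓞 k) × (Fin 2 → 𝓞 k) × 𝓞 k),
      (∀ P ∈ s, P.1 ∈ S ∧ P.2.1 ∈ S ∧ conicDisc c P.1 ≠ 0 ∧
        conicDisc (fun i j => c j i) P.2.1 ≠ 0 ∧
        P.2.2 ^ 2 = binQuad (conicCoeff c P.1) P.2.1 ∧
        T P.1 ^ Module.finrank ℚ k * T P.2.1 ^ Module.finrank ℚ k ≤ B) →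
      (s.card : ℝ) ≤ C * B ^ (1 + ε) := by
  classical
  obtain ⟨C₁, hC₁, H₁⟩ := exists_card_triples_le hC₀ hS hc hε
  obtain ⟨C₂, hC₂, H₂⟩ := exists_card_triples_le hC₀ hS hc' hε
  refine ⟨C₁ + C₂, by positivity, fun B hB s hs => ?_⟩
  have h1 := H₁ B hB (s.filter fun P => T P.1 ≤ T P.2.1) fun P hP => by
    obtain ⟨hPs, hT⟩ := Finset.mem_filter.mp hP
    obtain ⟨hp, hq, hd, -, hz, hle⟩ := hs P hPs
    exact ⟨hp, hq, hd, hz, hT, hle⟩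
  let e : (Fin 2 → 𝓞 k) × (Fin 2 → 𝓞 k) × 𝓞 k → (Fin 2 → 𝓞 k) × (Fin 2 → 𝓞 k) × 𝓞 k :=
    fun P => (P.2.1, P.1, P.2.2)
  have he : Function.Injective e := fun P P' h => by
    simp only [e, Prod.mk.injEq] at h
    exact Prod.ext h.2.1 (Prod.ext h.1 h.2.2)
  have h2 := H₂ B hB ((s.filter fun P => ¬ T P.1 ≤ T P.2.1).image e) fun P' hP' => by
    obtain ⟨P, hP, rfl⟩ := Finset.mem_image.mp hP'
    obtain ⟨hPs, hT⟩ := Finset.mem_filter.mp hP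
    obtain ⟨hp, hq, -, hd, hz, hle⟩ := hs P hPs
    refine ⟨hq, hp, hd, ?_, (not_le.mp hT).le, ?_⟩
    · exact hz.trans (binQuad_conicCoeff_swap c P.1 P.2.1).symm
    · rwa [mul_comm]
  rw [Finset.card_image_of_injective _ he] at h2
  rw [← Finset.card_filter_add_card_filter_not (s := s) fun P => T P.1 ≤ T P.2.1]
  push_cast
  linarith

end Count

/-- Theorem 1.1: del Pezzo surfaces of degree 4 with a conic bundle
structure:  let `X ⊂ ℙ⁴` be a non-singular complete intersection of two quadrics
`Q₀ = Q₁ = 0` over a number field `k` (a del Pezzo surface of degree `4`,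
anticanonically embedded), containing a non-singular conic defined over `k`.  Let
`U ⊂ X` be the complement of the `16` lines of `X`.  Then for every `ε > 0` there is a
constant `C = C(ε, X, k)` with `N(U, k, B) = #{x ∈ U(k) : H_k(x) ≤ B} ≤ C·B^{1+ε}` for
all `B ≥ 1`. -/
theorem dp4_point_count {k : Type*} [Field k] [NumberField k]
    (Q : Fin 2 → MvPolynomial (Fin 5) k)
    (hdeg : ∀ a, (Q a).IsHomogeneous 2)
    -- `X` is a non-singular complete intersection (Jacobian criterion over `k̄`):
    (hsmooth : ∀ z : Fin 5 → AlgebraicClosure k, z ≠ 0 →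
      (∀ a, MvPolynomial.eval z
        (MvPolynomial.map (algebraMap k (AlgebraicClosure k)) (Q a)) = 0) →
      Matrix.rank (Matrix.of fun (a : Fin 2) (i : Fin 5) =>
        MvPolynomial.eval z (MvPolynomial.pderiv i
          (MvPolynomial.map (algebraMap k (AlgebraicClosure k)) (Q a)))) = 2)
    -- `X` contains a non-singular conic defined over `k`:
    (hconic : ∃ (q : MvPolynomial (Fin 3) k) (L : Matrix (Fin 5) (Fin 3) k),
      q.IsHomogeneous 2 ∧ L.rank = 3 ∧
      (∀ y : Fin 3 → AlgebraicClosure k, y ≠ 0 →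
        MvPolynomial.eval y (MvPolynomial.map (algebraMap k (AlgebraicClosure k)) q) = 0 →
        (fun i => MvPolynomial.eval y (MvPolynomial.pderiv i
          (MvPolynomial.map (algebraMap k (AlgebraicClosure k)) q))) ≠ 0) ∧
      (∀ y : Fin 3 → AlgebraicClosure k,
        MvPolynomial.eval y (MvPolynomial.map (algebraMap k (AlgebraicClosure k)) q) = 0 →
        ∀ a, MvPolynomial.eval ((L.map (algebraMap k (AlgebraicClosure k))).mulVec y)
          (MvPolynomial.map (algebraMap k (AlgebraicClosure k)) (Q a)) = 0))
    (ε : ℝ) (hε : 0 < ε) :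
    ∃ C : ℝ, 0 < C ∧ ∀ B : ℝ, 1 ≤ B →
      (let U : Set (Projectivization k (Fin 5 → k)) :=
        {x | ∃ (y : Fin 5 → 𝓞 k) (hy : (fun i => (y i : k)) ≠ 0),
          Projectivization.mk k (fun i => (y i : k)) hy = x ∧
          (∀ a, MvPolynomial.eval (fun i => (y i : k)) (Q a) = 0) ∧
          ¬ liesOnLineIn
            (fun a => MvPolynomial.map (algebraMap k (AlgebraicClosure k)) (Q a))
            (fun i => algebraMap k (AlgebraicClosure k) (y i : k)) ∧
          heightFn y ≤ B};
      U.Finite ∧ (U.ncard : ℝ) ≤ C * B ^ (1 + ε)) := by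
  obtain ⟨M, c, hM⟩ := exists_isSegreModel hdeg hsmooth hconic
  obtain ⟨C₀, S, T, hC₀, hS, hT, hrep⟩ := exists_isReducedSystem k
  obtain ⟨C₁, hC₁, hpar⟩ := hM.exists_parametrization (fun a ha => hS.ne_zero a ha) hrep
  obtain ⟨A, hA, hcard⟩ := exists_card_triples_le_of_disc_ne_zero hC₀ hS
    hM.isNonsingularForm.isSmoothFibration
    (IsNonsingularForm.isSmoothFibration (c := fun i j => c j i) hM.isNonsingularForm.swap) hε
  have hK : 1 ≤ C₀ ^ 2 * C₁ + 1 := le_add_of_nonneg_left (by positivity)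
  refine ⟨A * (C₀ ^ 2 * C₁ + 1) ^ (1 + ε), by positivity, fun B hB => ?_⟩
  intro U
  have hB0 : 0 ≤ B := zero_le_one.trans hB
  have hparU : ∀ x ∈ U, ∃ P : (Fin 2 → 𝓞 k) × (Fin 2 → 𝓞 k) × 𝓞 k,
      (P.1 ∈ S ∧ P.2.1 ∈ S ∧ conicDisc c P.1 ≠ 0 ∧ conicDisc (fun i j => c j i) P.2.1 ≠ 0 ∧
        P.2.2 ^ 2 = binQuad (conicCoeff c P.1) P.2.1 ∧
        T P.1 ^ Module.finrank ℚ k * T P.2.1 ^ Module.finrank ℚ k ≤ (C₀ ^ 2 * C₁ + 1) * B) ∧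
      ∃ μ : k, μ ≠ 0 ∧ x.rep =
        μ • M.mulVec fun i => ((segrePoint P.1 P.2.1 P.2.2 i : 𝓞 k) : k) := by
    rintro x ⟨y, hy, rfl, hy0, hline, hyB⟩
    obtain ⟨p, hp, q, hq, z, μ, hμ, hz, hyμ, hht⟩ := hpar y
      (fun h0 => hy (funext fun i => by simp [h0])) hy0
    refine ⟨(p, q, z), ⟨hp, hq, fun hd => hline ?_, fun hd => hline ?_, hz, ?_⟩, ?_⟩
    · exact hM.liesOnLineIn (hS.ne_zero p hp) (hS.ne_zero q hq) hz hyμ (.inl hd)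
    · exact hM.liesOnLineIn (hS.ne_zero p hp) (hS.ne_zero q hq) hz hyμ (.inr hd)
    · change T p ^ Module.finrank ℚ k * T q ^ Module.finrank ℚ k ≤ _
      rw [hT p hp, hT q hq]
      calc C₀ * heightFn p * (C₀ * heightFn q) = C₀ ^ 2 * (heightFn p * heightFn q) := by ring
        _ ≤ C₀ ^ 2 * (C₁ * B) :=
          mul_le_mul_of_nonneg_left (hht.trans (by gcongr)) (sq_nonneg C₀)
        _ ≤ (C₀ ^ 2 * C₁ + 1) * B := by linarith
    · obtain ⟨u, hu⟩ := Projectivization.exists_smul_eq_mk_rep k _ hy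
      refine ⟨u * μ, mul_ne_zero u.ne_zero hμ, ?_⟩
      rw [← hu, Units.smul_def, hyμ, smul_smul]
  choose! f hf μ hμ hfμ using hparU
  have hinj : Set.InjOn f U := fun x hx x' hx' hxx => by
    rw [← x.mk_rep, ← x'.mk_rep, Projectivization.mk_eq_mk_iff']
    refine ⟨μ x / μ x', ?_⟩
    rw [hfμ x hx, hfμ x' hx', hxx, smul_smul, div_mul_cancel₀ _ (hμ x' hx')]
  have hle : ∀ t : Finset (Projectivization k (Fin 5 → k)), ↑t ⊆ U →
      (t.card : ℝ) ≤ A * (C₀ ^ 2 * C₁ + 1) ^ (1 + ε) * B ^ (1 + ε) := fun t ht => by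
    classical
    have h := hcard _ (one_le_mul_of_one_le_of_one_le hK hB) (t.image f) fun P hP => by
      obtain ⟨x, hx, rfl⟩ := Finset.mem_image.mp hP
      exact hf x (ht hx)
    rwa [Finset.card_image_of_injOn (hinj.mono ht),
      Real.mul_rpow (zero_le_one.trans hK) hB0, ← mul_assoc] at h
  have hfin : U.Finite := by
    by_contra hinf
    obtain ⟨n, hn⟩ := exists_nat_gt (A * (C₀ ^ 2 * C₁ + 1) ^ (1 + ε) * B ^ (1 + ε))
    obtain ⟨t, ht, htn⟩ := Set.Infinite.exists_subset_card_eq hinf n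
    exact (hle t ht).not_gt (htn ▸ hn)
  refine ⟨hfin, ?_⟩
  rw [Set.ncard_eq_toFinset_card U hfin]
  exact hle _ (by simp)
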